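/- Single-point blow-up for the general cooperative system: under the stated hypotheses on F and G (growth bounds and structure condition (H)), blow-up occurs only at the origin; that is, for every point x in the ball with 0 < |x| < R one has sup_{0<t<T*} (u(t,x) + v(t,x)) < ∞. -/

import Mathlib

open Set Filter

namespace SPB

lemma touch {X : Type*} [TopologicalSpace X] {K : Set X} (hK : IsCompact K) {t0 t1 : ℝ}
    (f g : ℝ → X → ℝ)
    (hf : ContinuousOn (Function.uncurry f) (Icc t0 t1 ×ˢ K))
    (hg : ContinuousOn (Function.uncurry g) (Icc t0 t1 ×ˢ K))
    (f0 : ∀ x ∈ K, 0 < f t0 x) (g0 : ∀ x ∈ K, 0 < g t0 x)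
    (sf : ∀ t ∈ Ioc t0 t1, ∀ x ∈ K, (∀ s ∈ Icc t0 t, ∀ y ∈ K, 0 ≤ f s y) →
      (∀ s ∈ Icc t0 t, ∀ y ∈ K, 0 ≤ g s y) → f t x = 0 → False)
    (sg : ∀ t ∈ Ioc t0 t1, ∀ x ∈ K, (∀ s ∈ Icc t0 t, ∀ y ∈ K, 0 ≤ f s y) →
      (∀ s ∈ Icc t0 t, ∀ y ∈ K, 0 ≤ g s y) → g t x = 0 → False) :
    ∀ t ∈ Icc t0 t1, ∀ x ∈ K, 0 < f t x ∧ 0 < g t x := by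
  by_contra hcon
  push Not at hcon
  obtain ⟨t', ht', x', hx', hb⟩ := hcon
  set h : ℝ × X → ℝ := fun z => min (f z.1 z.2) (g z.1 z.2) with hh
  have hD : IsCompact (Icc t0 t1 ×ˢ K) := isCompact_Icc.prod hK
  have hc : ContinuousOn h (Icc t0 t1 ×ˢ K) := ContinuousOn.inf hf hg
  -- minimal time
  obtain ⟨C, hC, hCe⟩ := (continuousOn_iff_isClosed.1 hc) (Iic 0) isClosed_Iic
  have hS : IsCompact ((Icc t0 t1 ×ˢ K) ∩ C) := hD.inter_right hC
  have memS : ∀ z, z ∈ (Icc t0 t1 ×ˢ K) ∩ C ↔ z ∈ Icc t0 t1 ×ˢ K ∧ h z ≤ 0 := by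
    intro z
    have : z ∈ h ⁻¹' Iic 0 ∩ (Icc t0 t1 ×ˢ K) ↔ z ∈ C ∩ (Icc t0 t1 ×ˢ K) := by rw [hCe]
    simp only [mem_inter_iff, mem_preimage, mem_Iic] at this ⊢
    tauto
  have hne : ((Icc t0 t1 ×ˢ K) ∩ C).Nonempty := by
    refine ⟨(t', x'), (memS _).2 ⟨⟨ht', hx'⟩, ?_⟩⟩
    simp only [hh]
    by_cases h1 : 0 < f t' x'
    · exact (min_le_right _ _).trans (hb h1)
    · exact (min_le_left _ _).trans (not_lt.1 h1)
  obtain ⟨⟨t, x⟩, hz, hmin⟩ := hS.exists_isMinOn hne continuous_fst.continuousOn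
  obtain ⟨⟨ht, hx⟩, hle⟩ := (memS _).1 hz
  simp only at ht hx
  have hpos : ∀ s ∈ Ico t0 t, ∀ y ∈ K, 0 < f s y ∧ 0 < g s y := by
    intro s hs y hy
    by_contra hn
    have : (s, y) ∈ (Icc t0 t1 ×ˢ K) ∩ C := by
      refine (memS _).2 ⟨⟨⟨hs.1, hs.2.le.trans ht.2⟩, hy⟩, ?_⟩
      by_contra h2
      push Not at h2
      exact hn (lt_min_iff.1 h2)
    have := hmin this
    change t ≤ s at this
    exact absurd hs.2 (not_lt.2 this)
  have ht0 : t0 < t := by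
    rcases eq_or_lt_of_le ht.1 with h1 | h1
    · exfalso
      have := lt_min (f0 x hx) (g0 x hx)
      simp only [hh, ← h1] at hle
      linarith
    · exact h1
  have key : ∀ φ : ℝ → X → ℝ, ContinuousOn (Function.uncurry φ) (Icc t0 t1 ×ˢ K) →
      (∀ s ∈ Ico t0 t, ∀ y ∈ K, 0 < φ s y) → ∀ s ∈ Icc t0 t, ∀ y ∈ K, 0 ≤ φ s y := by
    intro φ hφ hp s hs y hy
    rcases eq_or_lt_of_le hs.2 with h1 | h1
    · subst h1
      have hcs : ContinuousOn (fun r => φ r y) (Icc t0 s) := by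
        have : ContinuousOn (fun r : ℝ => (r, y)) (Icc t0 s) := by fun_prop
        exact hφ.comp this (fun r hr => ⟨⟨hr.1, hr.2.trans ht.2⟩, hy⟩)
      have h3 := (hcs s ⟨ht0.le, le_rfl⟩).mono (Ico_subset_Icc_self)
      have hcl : s ∈ closure (Ico t0 s) := by
        rw [closure_Ico ht0.ne]; exact ⟨ht0.le, le_rfl⟩
      have : (nhdsWithin s (Ico t0 s)).NeBot := mem_closure_iff_nhdsWithin_neBot.1 hcl
      refine ge_of_tendsto h3 ?_
      filter_upwards [self_mem_nhdsWithin] with r hr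
      exact (hp r hr y hy).le
    · exact (hp s ⟨hs.1, h1⟩ y hy).le
  have kf := key f hf (fun s hs y hy => (hpos s hs y hy).1)
  have kg := key g hg (fun s hs y hy => (hpos s hs y hy).2)
  have hle' : f t x ≤ 0 ∨ g t x ≤ 0 := min_le_iff.1 hle
  rcases hle' with h1 | h1
  · exact sf t ⟨ht0, ht.2⟩ x hx kf kg (le_antisymm h1 (kf t ⟨ht0.le, le_rfl⟩ x hx))
  · exact sg t ⟨ht0, ht.2⟩ x hx kf kg (le_antisymm h1 (kg t ⟨ht0.le, le_rfl⟩ x hx))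

/-- minimum, approached from the right: derivative nonneg -/
lemma deriv_nonneg_right {φ : ℝ → ℝ} {x b D : ℝ} (hxb : x < b) (hD : HasDerivAt φ D x)
    (hmin : ∀ y ∈ Ioo x b, φ x ≤ φ y) : 0 ≤ D := by
  have h := hD.hasDerivWithinAt (s := Ioi x)
  rw [hasDerivWithinAt_iff_tendsto_slope' (by simp)] at h
  refine ge_of_tendsto h ?_
  filter_upwards [Ioo_mem_nhdsGT hxb] with y hy
  rw [slope_def_field]
  exact div_nonneg (sub_nonneg.2 (hmin y hy)) (sub_nonneg.2 hy.1.le)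

lemma deriv_nonpos_left {φ : ℝ → ℝ} {x a D : ℝ} (hxa : a < x) (hD : HasDerivAt φ D x)
    (hmin : ∀ y ∈ Ioo a x, φ x ≤ φ y) : D ≤ 0 := by
  have h := hD.hasDerivWithinAt (s := Iio x)
  rw [hasDerivWithinAt_iff_tendsto_slope' (by simp)] at h
  refine le_of_tendsto h ?_
  filter_upwards [Ioo_mem_nhdsLT hxa] with y hy
  rw [slope_def_field]
  exact div_nonpos_of_nonneg_of_nonpos (sub_nonneg.2 (hmin y hy)) (sub_nonpos.2 hy.2.le)

lemma second_right {φ ψ : ℝ → ℝ} {x b D : ℝ} (hxb : x < b)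
    (h1 : ∀ y ∈ Ico x b, HasDerivAt φ (ψ y) y) (h2 : HasDerivAt ψ D x) (h0 : ψ x = 0)
    (hmin : ∀ y ∈ Ioo x b, φ x ≤ φ y) : 0 ≤ D := by
  by_contra hD
  push Not at hD
  have h := h2.hasDerivWithinAt (s := Ioi x)
  rw [hasDerivWithinAt_iff_tendsto_slope' (by simp)] at h
  have h3 := (h.eventually (gt_mem_nhds hD)).and (Ioo_mem_nhdsGT hxb)
  rw [Filter.Eventually, mem_nhdsGT_iff_exists_Ioo_subset' hxb] at h3
  obtain ⟨c, hc, hcs⟩ := h3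
  have hc : x < c := hc
  set m := (x + c) / 2
  have hxm : x < m := by simp only [m]; linarith
  have hmc : m < c := by simp only [m]; linarith
  have hmb : m < b := (hcs ⟨hxm, hmc⟩).2.2
  have : StrictAntiOn φ (Icc x m) := by
    apply strictAntiOn_of_deriv_neg (convex_Icc _ _)
    · intro y hy
      exact (h1 y ⟨hy.1, hy.2.trans_lt hmb⟩).continuousAt.continuousWithinAt
    · intro y hy
      rw [interior_Icc] at hy
      rw [(h1 y ⟨hy.1.le, hy.2.trans hmb⟩).deriv]
      have h4 := (hcs ⟨hy.1, hy.2.trans hmc⟩).1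
      rw [slope_def_field, h0, sub_zero] at h4
      by_contra h5
      push Not at h5
      exact absurd h4 (not_lt.2 (div_nonneg h5 (sub_nonneg.2 hy.1.le)))
  have h6 := this ⟨le_rfl, hxm.le⟩ ⟨hxm.le, le_rfl⟩ hxm
  have h7 := hmin m ⟨hxm, hmb⟩
  linarith

lemma second_left {φ ψ : ℝ → ℝ} {x a D : ℝ} (hxa : a < x)
    (h1 : ∀ y ∈ Ioc a x, HasDerivAt φ (ψ y) y) (h2 : HasDerivAt ψ D x) (h0 : ψ x = 0)
    (hmin : ∀ y ∈ Ioo a x, φ x ≤ φ y) : 0 ≤ D := by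
  have hh2 : HasDerivAt ψ D (- -x) := by rwa [neg_neg]
  have e2 : HasDerivAt (fun y => -ψ (-y)) D (-x) := by
    have e3 := (hh2.comp (-x) (hasDerivAt_neg (-x))).neg
    rw [mul_neg, mul_one, neg_neg] at e3
    exact e3
  have := second_right (φ := fun y => φ (-y)) (ψ := fun y => -ψ (-y)) (x := -x) (b := -a)
    (D := D) (by linarith) ?_ e2
    (by simp [h0]) ?_
  · exact this
  · intro y hy
    have := h1 (-y) ⟨by linarith [hy.2], by linarith [hy.1]⟩
    have := this.comp y (hasDerivAt_neg y)
    simpa [Function.comp_def] using this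
  · intro y hy
    simp only [neg_neg]
    exact hmin (-y) ⟨by linarith [hy.2], by linarith [hy.1]⟩

/-- first and second order conditions at a minimum over `[a,b]`, `a<b`, when the derivative has
a favourable sign at the end points. -/
lemma min_cond {φ ψ : ℝ → ℝ} {x a b D : ℝ} (hab : a < b) (hx : x ∈ Icc a b)
    (h1 : ∀ y ∈ Icc a b, HasDerivAt φ (ψ y) y) (h2 : HasDerivAt ψ D x)
    (hmin : ∀ y ∈ Icc a b, φ x ≤ φ y) (ha : x = a → ψ a ≤ 0) (hb : x = b → 0 ≤ ψ b) :
    ψ x = 0 ∧ 0 ≤ D := by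
  have hlow : x < b → 0 ≤ ψ x := fun h => deriv_nonneg_right h (h1 x hx)
    (fun y hy => hmin y ⟨hx.1.trans hy.1.le, hy.2.le⟩)
  have hhigh : a < x → ψ x ≤ 0 := fun h => deriv_nonpos_left h (h1 x hx)
    (fun y hy => hmin y ⟨hy.1.le, hy.2.le.trans hx.2⟩)
  have h0 : ψ x = 0 := by
    apply le_antisymm
    · rcases eq_or_lt_of_le hx.1 with h | h
      · rw [← h]; exact ha h.symm
      · exact hhigh h
    · rcases eq_or_lt_of_le hx.2 with h | h
      · rw [h]; exact hb h
      · exact hlow h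
  refine ⟨h0, ?_⟩
  rcases eq_or_lt_of_le hx.2 with h | h
  · have hax : a < x := by rw [h]; exact hab
    exact second_left hax (fun y hy => h1 y ⟨hy.1.le, hy.2.trans hx.2⟩) h2 h0
      (fun y hy => hmin y ⟨hy.1.le, hy.2.le.trans hx.2⟩)
  · exact second_right h (fun y hy => h1 y ⟨hx.1.trans hy.1, hy.2.le⟩) h2 h0
      (fun y hy => hmin y ⟨hx.1.trans hy.1.le, hy.2.le⟩)

lemma time_cond {φ : ℝ → ℝ} {t0 t D : ℝ} (h : t0 < t) (hD : HasDerivAt φ D t) (h0 : φ t = 0)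
    (hp : ∀ s ∈ Icc t0 t, 0 ≤ φ s) : D ≤ 0 :=
  deriv_nonpos_left h hD (fun y hy => by rw [h0]; exact hp y ⟨hy.1.le, hy.2.le⟩)

end SPB

namespace SPB

noncomputable def gp (y : ℝ) : ℝ := max (1 - y ^ 2) 0
noncomputable def chi (y : ℝ) : ℝ := gp y ^ 3
noncomputable def chi1 (y : ℝ) : ℝ := -6 * y * gp y ^ 2
noncomputable def chi2 (y : ℝ) : ℝ := 24 * gp y - 30 * gp y ^ 2
noncomputable def Psi (y : ℝ) : ℝ := ∫ s in (0:ℝ)..y, chi s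

lemma gp_nonneg (y : ℝ) : 0 ≤ gp y := le_max_right _ _
lemma gp_le_one (y : ℝ) : gp y ≤ 1 := max_le (by nlinarith [sq_nonneg y]) (by norm_num)
lemma chi_nonneg (y : ℝ) : 0 ≤ chi y := pow_nonneg (gp_nonneg y) 3
lemma chi_le_one (y : ℝ) : chi y ≤ 1 := pow_le_one₀ (gp_nonneg y) (gp_le_one y)
lemma gp_zero {y : ℝ} (h : 1 ≤ |y|) : gp y = 0 := by
  apply max_eq_right
  have := (one_le_sq_iff_one_le_abs y).2 h
  linarith
lemma gp_pos {y : ℝ} (h : |y| < 1) : 0 < gp y := by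
  apply lt_max_of_lt_left
  have := (sq_lt_one_iff_abs_lt_one y).2 h
  linarith
lemma chi_zero {y : ℝ} (h : 1 ≤ |y|) : chi y = 0 := by simp [chi, gp_zero h]
lemma chi1_zero {y : ℝ} (h : 1 ≤ |y|) : chi1 y = 0 := by simp [chi1, gp_zero h]
lemma chi_at_zero : chi 0 = 1 := by simp [chi, gp]

lemma max_pow_deriv (m : ℕ) (x : ℝ) :
    HasDerivAt (fun x : ℝ => max x 0 ^ (m + 2)) ((m + 2) * max x 0 ^ (m + 1)) x := by
  have hne : ∀ y : ℝ, y ≠ 0 →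
      HasDerivAt (fun x : ℝ => max x 0 ^ (m + 2)) ((m + 2) * max y 0 ^ (m + 1)) y := by
    intro y hy
    rcases lt_or_gt_of_ne hy with h | h
    · have : (fun x : ℝ => max x 0 ^ (m + 2)) =ᶠ[nhds y] fun _ => 0 := by
        filter_upwards [gt_mem_nhds h] with z hz
        rw [max_eq_right hz.le]; simp
      have h2 := (hasDerivAt_const y (0:ℝ)).congr_of_eventuallyEq this
      rw [max_eq_right h.le]
      simpa using h2
    · have : (fun x : ℝ => max x 0 ^ (m + 2)) =ᶠ[nhds y] fun x => x ^ (m + 2) := by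
        filter_upwards [lt_mem_nhds h] with z hz
        rw [max_eq_left hz.le]
      have h2 := (hasDerivAt_pow (m + 2) y).congr_of_eventuallyEq this
      rw [max_eq_left h.le]
      simpa using h2
  by_cases hx : x = 0
  · subst hx
    exact hasDerivAt_of_hasDerivAt_of_ne (g := fun y => ((m:ℝ) + 2) * max y 0 ^ (m + 1)) hne
      (by fun_prop) (by fun_prop)
  · exact hne x hx

lemma gp_pow_deriv (m : ℕ) (y : ℝ) :
    HasDerivAt (fun y => gp y ^ (m + 2)) ((m + 2) * gp y ^ (m + 1) * (-2 * y)) y := by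
  have h1 : HasDerivAt (fun y : ℝ => 1 - y ^ 2) (-2 * y) y := by
    have := (hasDerivAt_pow 2 y).const_sub 1
    simpa using this
  exact (max_pow_deriv m (1 - y ^ 2)).comp y h1

lemma chi_deriv (y : ℝ) : HasDerivAt chi (chi1 y) y := by
  have := gp_pow_deriv 1 y
  have e : (((1:ℕ):ℝ) + 2) * gp y ^ (1 + 1) * (-2 * y) = chi1 y := by
    simp only [chi1]; push_cast; ring
  rw [e] at this
  exact this

lemma chi1_deriv (y : ℝ) : HasDerivAt chi1 (chi2 y) y := by
  have h1 : HasDerivAt (fun y : ℝ => -6 * y) (-6) y := by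
    simpa using (hasDerivAt_id y).const_mul (-6 : ℝ)
  have := h1.mul (gp_pow_deriv 0 y)
  have e : -6 * gp y ^ (0 + 2) + -6 * y * (((0:ℕ) + 2) * gp y ^ (0 + 1) * (-2 * y)) = chi2 y := by
    simp only [chi2]; push_cast
    by_cases h : 0 ≤ 1 - y ^ 2
    · have : gp y = 1 - y ^ 2 := max_eq_left h
      rw [this]; ring
    · have : gp y = 0 := max_eq_right (not_le.1 h).le
      rw [this]; ring
  rw [e] at this
  exact this

lemma chi_cont : Continuous chi := continuous_iff_continuousAt.2 fun y => (chi_deriv y).continuousAt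
lemma chi1_cont : Continuous chi1 :=
  continuous_iff_continuousAt.2 fun y => (chi1_deriv y).continuousAt

lemma Psi_deriv (y : ℝ) : HasDerivAt Psi (chi y) y :=
  intervalIntegral.integral_hasDerivAt_right (chi_cont.intervalIntegrable _ _)
    (chi_cont.stronglyMeasurableAtFilter _ _) chi_cont.continuousAt
lemma Psi_cont : Continuous Psi := continuous_iff_continuousAt.2 fun y => (Psi_deriv y).continuousAt

lemma chi1_abs (y : ℝ) : |chi1 y| ≤ 6 * gp y ^ 2 := by
  by_cases h : 1 ≤ |y|
  · simp [chi1, gp_zero h]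
  · simp only [chi1, abs_mul, abs_neg]
    rw [abs_of_nonneg (pow_nonneg (gp_nonneg y) 2)]
    have : |(6:ℝ)| = 6 := by norm_num
    rw [this]
    have := sq_nonneg (gp y)
    nlinarith [abs_nonneg y]

lemma bump_ineq {b B lam : ℝ} (hb : |b| ≤ B) (hl : (30 + 6 * B) ^ 2 ≤ lam) (y : ℝ) :
    0 ≤ chi2 y + b * chi1 y + lam * chi y := by
  have h1 := chi1_abs y
  have h0 := gp_nonneg y
  have h2 : -(B * (6 * gp y ^ 2)) ≤ b * chi1 y := by
    have : |b * chi1 y| ≤ B * (6 * gp y ^ 2) := by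
      rw [abs_mul]
      exact mul_le_mul hb h1 (abs_nonneg _) ((abs_nonneg _).trans hb)
    linarith [neg_abs_le (b * chi1 y)]
  have h3 : (30 + 6 * B) ^ 2 * chi y ≤ lam * chi y := mul_le_mul_of_nonneg_right hl (chi_nonneg y)
  simp only [chi2, chi] at *
  have : 0 ≤ gp y * (24 - (30 + 6 * B) * gp y + ((30 + 6 * B) * gp y) ^ 2) := by
    apply mul_nonneg h0
    nlinarith [sq_nonneg ((30 + 6 * B) * gp y - 1)]
  nlinarith

lemma scaled {f : ℝ → ℝ} {D ξ l x : ℝ} (h : HasDerivAt f D ((x - ξ) / l)) :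
    HasDerivAt (fun x => f ((x - ξ) / l)) (D / l) x := by
  have h1 : HasDerivAt (fun x : ℝ => (x - ξ) / l) (1 / l) x :=
    ((hasDerivAt_id x).sub_const ξ).div_const l
  have := h.comp x h1
  rw [mul_one_div] at this
  exact this

lemma bump_mono {l a k B : ℝ} (hl : 0 < l) (ha : 0 < a) (hk : 0 ≤ k) (hB : 0 ≤ B) :
    ∃ lam0 : ℝ, 0 ≤ lam0 ∧ ∀ lam ≥ lam0, ∀ ξ b : ℝ, |b| ≤ B →
      MonotoneOn (fun x => chi1 ((x - ξ) / l) / l + k / x * chi ((x - ξ) / l)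
        + b * chi ((x - ξ) / l) + lam * (l * Psi ((x - ξ) / l))) (Ici a) := by
  refine ⟨((30 + 6 * (k * l / a + B * l)) ^ 2 + k * l ^ 2 / a ^ 2) / l ^ 2, by positivity, ?_⟩
  intro lam hlam ξ b hb
  have hD : ∀ x, a ≤ x → HasDerivAt (fun x => chi1 ((x - ξ) / l) / l + k / x * chi ((x - ξ) / l)
        + b * chi ((x - ξ) / l) + lam * (l * Psi ((x - ξ) / l)))
        (chi2 ((x - ξ) / l) / l / l + (-k / x ^ 2 * chi ((x - ξ) / l) + k / x * (chi1 ((x - ξ) / l) / l))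
        + b * (chi1 ((x - ξ) / l) / l) + lam * (l * (chi ((x - ξ) / l) / l))) x := by
    intro x hx
    have hx0 : x ≠ 0 := (ha.trans_le hx).ne'
    have e1 := (scaled (chi1_deriv ((x - ξ) / l))).div_const l
    have e2 := scaled (chi_deriv ((x - ξ) / l))
    have e3 := scaled (Psi_deriv ((x - ξ) / l))
    have e4 : HasDerivAt (fun x : ℝ => k / x) (-k / x ^ 2) x := by
      have := (hasDerivAt_inv hx0).const_mul k
      have e : k * -(x ^ 2)⁻¹ = -k / x ^ 2 := by ring
      rw [e] at this
      exact this
    exact ((e1.add (e4.mul e2)).add (e2.const_mul b)).add ((e3.const_mul l).const_mul lam)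
  apply monotoneOn_of_deriv_nonneg (convex_Ici a)
  · intro x hx
    exact (hD x hx).continuousAt.continuousWithinAt
  · intro x hx
    rw [interior_Ici] at hx
    exact (hD x (le_of_lt hx)).differentiableAt.differentiableWithinAt
  · intro x hx
    rw [interior_Ici] at hx
    have hx : a < x := hx
    have hx0 : 0 < x := ha.trans hx
    rw [(hD x hx.le).deriv]
    have hbb : |k * l / x + b * l| ≤ k * l / a + B * l := by
      refine (abs_add_le _ _).trans (add_le_add ?_ ?_)
      · rw [abs_of_nonneg (by positivity)]
        exact div_le_div_of_nonneg_left (by positivity) ha hx.le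
      · rw [abs_mul, abs_of_pos hl]
        exact mul_le_mul_of_nonneg_right hb hl.le
    have hll : (30 + 6 * (k * l / a + B * l)) ^ 2 ≤ lam * l ^ 2 - k * l ^ 2 / x ^ 2 := by
      have h1 : k * l ^ 2 / x ^ 2 ≤ k * l ^ 2 / a ^ 2 :=
        div_le_div_of_nonneg_left (by positivity) (by positivity) (by gcongr)
      have h2 := (div_le_iff₀ (by positivity : 0 < l ^ 2)).1 hlam
      linarith
    have := bump_ineq hbb hll ((x - ξ) / l)
    have e : chi2 ((x - ξ) / l) / l / l + (-k / x ^ 2 * chi ((x - ξ) / l) + k / x * (chi1 ((x - ξ) / l) / l))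
        + b * (chi1 ((x - ξ) / l) / l) + lam * (l * (chi ((x - ξ) / l) / l))
        = (chi2 ((x - ξ) / l) + (k * l / x + b * l) * chi1 ((x - ξ) / l) +
          (lam * l ^ 2 - k * l ^ 2 / x ^ 2) * chi ((x - ξ) / l)) / l ^ 2 := by
      field_simp; ring
    rw [e]
    positivity

/-- Bundled hypotheses. -/
structure Sys (k R p q r s α β d e c₁ c₂ T : ℝ) (F G : ℝ → ℝ → ℝ) (u v : ℝ → ℝ → ℝ) : Prop where
  hk : 0 ≤ k
  hR : 0 < R
  hp : 1 < p
  hq : 1 < q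
  hr : 1 < r
  hs : 1 < s
  hα : 0 < α
  hβ : 0 < β
  hαq : α * q = β + 1
  hβp : β * p = α + 1
  hαr : α * r = α + 1
  hβs : β * s = β + 1
  hd : 0 < d
  he : 0 < e
  hc₁ : 0 < c₁
  hc₂ : 0 < c₂
  hT : 0 < T
  FC : ContDiff ℝ 1 (Function.uncurry F)
  GC : ContDiff ℝ 1 (Function.uncurry G)
  Fv : ∀ a b : ℝ, 0 ≤ a → 0 ≤ b → 0 ≤ deriv (fun y => F a y) b
  Gu : ∀ a b : ℝ, 0 ≤ a → 0 ≤ b → 0 ≤ deriv (fun x => G x b) a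
  Fl : ∀ a b : ℝ, 0 ≤ a → 0 ≤ b → c₁ * b ^ p ≤ F a b
  Fup : ∀ a b : ℝ, 0 ≤ a → 0 ≤ b → F a b ≤ c₂ * (b ^ p + a ^ r + 1)
  Gl : ∀ a b : ℝ, 0 ≤ a → 0 ≤ b → c₁ * a ^ q ≤ G a b
  Gup : ∀ a b : ℝ, 0 ≤ a → 0 ≤ b → G a b ≤ c₂ * (a ^ q + b ^ s + 1)
  un : ∀ t ∈ Ico (0:ℝ) T, ∀ ρ ∈ Icc (0:ℝ) R, 0 ≤ u t ρ
  vn : ∀ t ∈ Ico (0:ℝ) T, ∀ ρ ∈ Icc (0:ℝ) R, 0 ≤ v t ρ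
  uc : ContinuousOn (Function.uncurry u) (Ico (0:ℝ) T ×ˢ Icc (0:ℝ) R)
  vc : ContinuousOn (Function.uncurry v) (Ico (0:ℝ) T ×ˢ Icc (0:ℝ) R)
  ux : ∀ t ∈ Ioo (0:ℝ) T, ∀ x ∈ Ioo (0:ℝ) R, HasDerivAt (u t) (deriv (u t) x) x
  vx : ∀ t ∈ Ioo (0:ℝ) T, ∀ x ∈ Ioo (0:ℝ) R, HasDerivAt (v t) (deriv (v t) x) x
  uxx : ∀ t ∈ Ioo (0:ℝ) T, ∀ x ∈ Ioo (0:ℝ) R,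
    HasDerivAt (deriv (u t)) (deriv (deriv (u t)) x) x
  vxx : ∀ t ∈ Ioo (0:ℝ) T, ∀ x ∈ Ioo (0:ℝ) R,
    HasDerivAt (deriv (v t)) (deriv (deriv (v t)) x) x
  ut : ∀ t ∈ Ioo (0:ℝ) T, ∀ x ∈ Ioo (0:ℝ) R, HasDerivAt (fun s => u s x)
    (d * (deriv (deriv (u t)) x + k / x * deriv (u t) x) + F (u t x) (v t x)) t
  vt : ∀ t ∈ Ioo (0:ℝ) T, ∀ x ∈ Ioo (0:ℝ) R, HasDerivAt (fun s => v s x)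
    (e * (deriv (deriv (v t)) x + k / x * deriv (v t) x) + G (u t x) (v t x)) t
  ub : ∀ t ∈ Ioo (0:ℝ) T, u t R = 0
  vb : ∀ t ∈ Ioo (0:ℝ) T, v t R = 0
  um : ∀ t ∈ Ico (0:ℝ) T, AntitoneOn (u t) (Icc (0:ℝ) R)
  vm : ∀ t ∈ Ico (0:ℝ) T, AntitoneOn (v t) (Icc (0:ℝ) R)

variable {k R p q r s α β d e c₁ c₂ T : ℝ} {F G : ℝ → ℝ → ℝ} {u v : ℝ → ℝ → ℝ}

lemma Sys.swap (S : Sys k R p q r s α β d e c₁ c₂ T F G u v) :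
    Sys k R q p s r β α e d c₁ c₂ T (fun a b => G b a) (fun a b => F b a) v u where
  hk := S.hk
  hR := S.hR
  hp := S.hq
  hq := S.hp
  hr := S.hs
  hs := S.hr
  hα := S.hβ
  hβ := S.hα
  hαq := S.hβp
  hβp := S.hαq
  hαr := S.hβs
  hβs := S.hαr
  hd := S.he
  he := S.hd
  hc₁ := S.hc₁
  hc₂ := S.hc₂
  hT := S.hT
  FC := S.GC.comp (contDiff_snd.prodMk contDiff_fst)
  GC := S.FC.comp (contDiff_snd.prodMk contDiff_fst)
  Fv := fun a b ha hb => S.Gu b a hb ha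
  Gu := fun a b ha hb => S.Fv b a hb ha
  Fl := fun a b ha hb => S.Gl b a hb ha
  Fup := fun a b ha hb => S.Gup b a hb ha
  Gl := fun a b ha hb => S.Fl b a hb ha
  Gup := fun a b ha hb => S.Fup b a hb ha
  un := S.vn
  vn := S.un
  uc := S.vc
  vc := S.uc
  ux := S.vx
  vx := S.ux
  uxx := S.vxx
  vxx := S.uxx
  ut := S.vt
  vt := S.ut
  ub := S.vb
  vb := S.ub
  um := S.vm
  vm := S.um

lemma Sys.ux_nonpos (S : Sys k R p q r s α β d e c₁ c₂ T F G u v) {t x : ℝ}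
    (ht : t ∈ Ioo (0:ℝ) T) (hx : x ∈ Ioo (0:ℝ) R) : deriv (u t) x ≤ 0 := by
  have h := S.um t ⟨ht.1.le, ht.2⟩
  have := deriv_nonneg_right (φ := fun y => -u t y) hx.2 (S.ux t ht x hx).neg ?_
  · linarith
  · intro y hy
    have := h ⟨hx.1.le, hx.2.le⟩ ⟨hx.1.le.trans hy.1.le, hy.2.le⟩ hy.1.le
    simpa using this

end SPB

namespace SPB
variable {k R p q r s α β d e c₁ c₂ T : ℝ} {F G : ℝ → ℝ → ℝ} {u v : ℝ → ℝ → ℝ}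

lemma Sys.persist (S : Sys k R p q r s α β d e c₁ c₂ T F G u v) {a : ℝ} (ha : 0 < a) :
    ∃ Λ > 0, ∀ l ∈ Ioc 0 a, ∀ x0, 2 * a ≤ x0 → x0 + l < R → ∀ t1 t2, 0 < t1 → t1 ≤ t2 → t2 < T →
      ∀ m, 0 ≤ m → (∀ t ∈ Icc t1 t2, ∀ x ∈ Ioc 0 (x0 + l), m ≤ F (u t x) (v t x)) →
      (u t1 (x0 + l) + m * (t2 - t1)) * Real.exp (-(Λ / l ^ 2) * (t2 - t1)) ≤ u t2 x0 := by
  have hd := S.hd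
  have hk := S.hk
  refine ⟨d * (30 + 6 * k) ^ 2, by positivity, ?_⟩
  intro l hl x0 hx0 hx0R t1 t2 ht1 ht12 ht2 m hm hF
  obtain ⟨hl0, hla⟩ := hl
  set Λ := d * (30 + 6 * k) ^ 2 with hΛ
  set M := u t1 (x0 + l) with hM
  have hM0 : 0 ≤ M := S.un t1 ⟨ht1.le, ht12.trans_lt ht2⟩ _ ⟨by linarith, hx0R.le⟩
  set E : ℝ → ℝ := fun t => Real.exp (-(Λ / l ^ 2) * (t - t1)) with hE
  have hEd : ∀ t, HasDerivAt E (E t * (-(Λ / l ^ 2))) t := by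
    intro t
    have : HasDerivAt (fun t => -(Λ / l ^ 2) * (t - t1)) (-(Λ / l ^ 2)) t := by
      simpa using ((hasDerivAt_id t).sub_const t1).const_mul (-(Λ / l ^ 2))
    exact this.exp
  have hAd : ∀ t, HasDerivAt (fun t => M + m * (t - t1)) m t := by
    intro t
    simpa using (((hasDerivAt_id t).sub_const t1).const_mul m).const_add M
  set K := Icc (x0 - l) (x0 + l) with hK
  have hKsub : ∀ x ∈ K, x ∈ Ioo 0 R := fun x hx => ⟨by linarith [hx.1], by linarith [hx.2]⟩
  have main : ∀ θ > 0, (M + m * (t2 - t1)) * E t2 ≤ u t2 x0 + θ * (1 + (t2 - t1)) := by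
    intro θ hθ
    set f : ℝ → ℝ → ℝ := fun t x => u t x - (M + m * (t - t1)) * E t * chi ((x - x0) / l)
      + θ * (1 + (t - t1)) with hf
    have hfc : ContinuousOn (Function.uncurry f) (Icc t1 t2 ×ˢ K) := by
      have h1 : ContinuousOn (Function.uncurry u) (Icc t1 t2 ×ˢ K) := S.uc.mono (by
        rintro ⟨t, x⟩ ⟨h1, h2⟩
        have := hKsub x h2
        exact ⟨⟨ht1.le.trans h1.1, h1.2.trans_lt ht2⟩, this.1.le, this.2.le⟩)
      have h2 : Continuous fun z : ℝ × ℝ => (M + m * (z.1 - t1)) * E z.1 * chi ((z.2 - x0) / l) := by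
        have := chi_cont
        simp only [hE]; fun_prop
      have h3 : Continuous fun z : ℝ × ℝ => θ * (1 + (z.1 - t1)) := by fun_prop
      exact (h1.sub h2.continuousOn).add h3.continuousOn
    have f0 : ∀ x ∈ K, 0 < f t1 x := by
      intro x hx
      have h1 : M ≤ u t1 x := S.um t1 ⟨ht1.le, ht12.trans_lt ht2⟩
        ⟨(hKsub x hx).1.le, (hKsub x hx).2.le⟩ ⟨by linarith, hx0R.le⟩ hx.2
      have h2 := chi_le_one ((x - x0) / l)
      simp only [hf, hE]
      simp
      nlinarith
    have step : ∀ t ∈ Ioc t1 t2, ∀ x ∈ K, (∀ s ∈ Icc t1 t, ∀ y ∈ K, 0 ≤ f s y) →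
      (∀ s ∈ Icc t1 t, ∀ y ∈ K, 0 ≤ f s y) → f t x = 0 → False := by
      intro t ht x hx hpos _ h0
      have htT : t ∈ Ioo 0 T := ⟨ht1.trans ht.1, ht.2.trans_lt ht2⟩
      have hxR := hKsub x hx
      have hA0 : 0 ≤ M + m * (t - t1) := by
        have := mul_nonneg hm (sub_nonneg.2 ht.1.le); linarith
      have hE0 : 0 < E t := Real.exp_pos _
      have hE1 : E t ≤ 1 := by
        apply Real.exp_le_one_iff.2
        have : 0 ≤ Λ / l ^ 2 * (t - t1) := mul_nonneg (by positivity) (sub_nonneg.2 ht.1.le)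
        linarith
      set A := (M + m * (t - t1)) * E t with hA
      have hAA : 0 ≤ A := mul_nonneg hA0 hE0.le
      have hne : |((x - x0) / l)| < 1 := by
        by_contra hcon
        push Not at hcon
        have h1 := chi_zero hcon
        have h2 : f t x = u t x + θ * (1 + (t - t1)) := by simp only [hf, h1]; ring
        have h3 := S.un t ⟨htT.1.le, htT.2⟩ x ⟨hxR.1.le, hxR.2.le⟩
        have h4 : 0 < θ * (1 + (t - t1)) := mul_pos hθ (by linarith [ht.1])
        linarith
      rw [abs_div, abs_of_pos hl0, div_lt_one hl0, abs_lt] at hne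
      have hfx : ∀ y ∈ K, HasDerivAt (f t) (deriv (u t) y - A * (chi1 ((y - x0) / l) / l)) y := by
        intro y hy
        exact ((S.ux t htT y (hKsub y hy)).sub
          ((scaled (chi_deriv ((y - x0) / l))).const_mul A)).add_const _
      have hfxx := (S.uxx t htT x hxR).sub
          (((scaled (chi1_deriv ((x - x0) / l))).div_const l).const_mul A)
      obtain ⟨g1, g2⟩ := min_cond (φ := f t) (by linarith : x0 - l < x0 + l) hx hfx hfxx
        (fun y hy => by rw [h0]; exact hpos t ⟨ht.1.le, le_rfl⟩ y hy)
        (fun h => by linarith) (fun h => by linarith)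
      have hft : HasDerivAt (fun t => f t x) ((d * (deriv (deriv (u t)) x + k / x * deriv (u t) x)
          + F (u t x) (v t x)) - (m * E t + (M + m * (t - t1)) * (E t * (-(Λ / l ^ 2))))
            * chi ((x - x0) / l) + θ * 1) t := by
        have h5 : HasDerivAt (fun t => θ * (1 + (t - t1))) (θ * 1) t :=
          (((hasDerivAt_id t).sub_const t1).const_add 1).const_mul θ
        exact ((S.ut t htT x hxR).sub (((hAd t).mul (hEd t)).mul_const _)).add h5
      have g3 := time_cond ht.1 hft h0 (fun s hs => hpos s hs x hx)
      have g4 := hF t ⟨ht.1.le, ht.2⟩ x ⟨hxR.1, hx.2⟩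
      have hx1 : a ≤ x := by linarith
      have hb : |k * l / x| ≤ k := by
        rw [abs_of_nonneg (by have := hxR.1; positivity), div_le_iff₀ hxR.1]
        exact mul_le_mul_of_nonneg_left (by linarith) hk
      have g5 := bump_ineq hb le_rfl ((x - x0) / l)
      have g6 : 0 ≤ A * d / l ^ 2 * (chi2 ((x - x0) / l) + k * l / x * chi1 ((x - x0) / l)
          + (30 + 6 * k) ^ 2 * chi ((x - x0) / l)) := by positivity
      have g7 : d * (deriv (deriv (u t)) x + k / x * deriv (u t) x) ≥
          d * (A * (chi2 ((x - x0) / l) / l / l) + k / x * (A * (chi1 ((x - x0) / l) / l))) := by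
        apply mul_le_mul_of_nonneg_left _ hd.le
        have : deriv (u t) x = A * (chi1 ((x - x0) / l) / l) := by linarith
        rw [this]
        linarith
      have g8 : m * E t * chi ((x - x0) / l) ≤ m := by
        have : E t * chi ((x - x0) / l) ≤ 1 := mul_le_one₀ hE1 (chi_nonneg _) (chi_le_one _)
        nlinarith
      have g9 : A * d / l ^ 2 * (chi2 ((x - x0) / l) + k * l / x * chi1 ((x - x0) / l)
          + (30 + 6 * k) ^ 2 * chi ((x - x0) / l)) =
          d * (A * (chi2 ((x - x0) / l) / l / l) + k / x * (A * (chi1 ((x - x0) / l) / l)))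
          + A * (Λ / l ^ 2) * chi ((x - x0) / l) := by
        have := hxR.1.ne'
        rw [hΛ]; field_simp
      have g10 : (m * E t + (M + m * (t - t1)) * (E t * (-(Λ / l ^ 2)))) * chi ((x - x0) / l)
          = m * E t * chi ((x - x0) / l) - A * (Λ / l ^ 2) * chi ((x - x0) / l) := by
        rw [hA]; ring
      linarith
    have := (touch isCompact_Icc f f hfc hfc f0 f0 step step t2 ⟨ht12, le_rfl⟩ x0
      ⟨by linarith, by linarith⟩).1
    simp only [hf] at this
    rw [sub_self, zero_div, chi_at_zero, mul_one] at this
    linarith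
  refine le_of_forall_pos_le_add fun ε hε => ?_
  have h := main (ε / (1 + (t2 - t1))) (by have : 0 < 1 + (t2 - t1) := by linarith
                                           positivity)
  rwa [div_mul_cancel₀ _ (by linarith)] at h

end SPB

namespace SPB
variable {k R p q r s α β d e c₁ c₂ T : ℝ} {F G : ℝ → ℝ → ℝ} {u v : ℝ → ℝ → ℝ}

lemma Sys.F_nonneg (S : Sys k R p q r s α β d e c₁ c₂ T F G u v) {t x : ℝ}
    (ht : t ∈ Ico 0 T) (hx : x ∈ Icc 0 R) : 0 ≤ F (u t x) (v t x) :=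
  (mul_nonneg S.hc₁.le (Real.rpow_nonneg (S.vn t ht x hx) p)).trans
    (S.Fl _ _ (S.un t ht x hx) (S.vn t ht x hx))

lemma Sys.transfer (S : Sys k R p q r s α β d e c₁ c₂ T F G u v) {a : ℝ} (ha : 0 < a) :
    ∃ ν > 0, ∀ l ∈ Ioc 0 a, ∀ x0, 2 * a ≤ x0 → x0 + 2 * l < R → ∀ t1 τ, 0 < t1 → 0 < τ →
      τ ≤ ν * l ^ 2 → t1 + τ < T → ∀ A, 0 ≤ A → A ≤ u t1 (x0 + 2 * l) →
      (∀ t ∈ Icc t1 (t1 + τ), Real.exp (-1) * A ≤ u t (x0 + l)) ∧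
      Real.exp (-1) * c₁ * (Real.exp (-1) * A) ^ q * τ ≤ v (t1 + τ) x0 := by
  obtain ⟨Λ, hΛ, hP⟩ := S.persist ha
  obtain ⟨Λ', hΛ', hP'⟩ := S.swap.persist ha
  have hm : 0 < max Λ Λ' := lt_max_of_lt_left hΛ
  refine ⟨1 / max Λ Λ', by positivity, ?_⟩
  intro l hl x0 hx0 hxR t1 τ ht1 hτ hτl hT A hA hAu
  obtain ⟨hl0, hla⟩ := hl
  have hexp : ∀ L, 0 < L → L ≤ max Λ Λ' → ∀ w, 0 ≤ w → w ≤ τ →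
      Real.exp (-1) ≤ Real.exp (-(L / l ^ 2) * w) := by
    intro L hL hLm w hw hwτ
    apply Real.exp_le_exp.2
    have h1 : w ≤ 1 / max Λ Λ' * l ^ 2 := hwτ.trans hτl
    have h2 : L / l ^ 2 * w ≤ max Λ Λ' / l ^ 2 * (1 / max Λ Λ' * l ^ 2) := by gcongr
    have h3 : max Λ Λ' / l ^ 2 * (1 / max Λ Λ' * l ^ 2) = 1 := by field_simp
    linarith
  have first : ∀ t ∈ Icc t1 (t1 + τ), Real.exp (-1) * A ≤ u t (x0 + l) := by
    intro t ht
    have := hP l ⟨hl0, hla⟩ (x0 + l) (by linarith) (by linarith) t1 t ht1 ht.1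
      (ht.2.trans_lt hT) 0 le_rfl (fun t' ht' x hx => S.F_nonneg
        ⟨ht1.le.trans ht'.1, ht'.2.trans_lt (ht.2.trans_lt hT)⟩ ⟨hx.1.le, by linarith [hx.2]⟩)
    have h2 := hexp Λ hΛ (le_max_left _ _) (t - t1) (by linarith [ht.1]) (by linarith [ht.2])
    have e1 : x0 + l + l = x0 + 2 * l := by ring
    rw [e1, zero_mul, add_zero] at this
    refine le_trans ?_ this
    rw [mul_comm]
    have := (Real.exp_pos (-1)).le
    exact mul_le_mul hAu h2 this (hA.trans hAu)
  refine ⟨first, ?_⟩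
  set m := c₁ * (Real.exp (-1) * A) ^ q with hmdef
  have hc₁ := S.hc₁
  have hq := S.hq
  have hm0 : 0 ≤ m := by positivity
  have := hP' l ⟨hl0, hla⟩ x0 hx0 (by linarith) t1 (t1 + τ) ht1 (by linarith) hT m hm0 ?_
  · have h2 := hexp Λ' hΛ' (le_max_right _ _) (t1 + τ - t1) (by linarith) (by linarith)
    refine le_trans ?_ this
    have h3 : 0 ≤ v t1 (x0 + l) := S.vn t1 ⟨ht1.le, by linarith⟩ _ ⟨by linarith, by linarith⟩
    have h4 : m * τ ≤ v t1 (x0 + l) + m * (t1 + τ - t1) := by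
      have : t1 + τ - t1 = τ := by ring
      rw [this]; linarith
    calc _ = m * τ * Real.exp (-1) := by rw [hmdef]; ring
      _ ≤ _ := mul_le_mul h4 h2 (Real.exp_pos _).le ((by positivity : 0 ≤ m * τ).trans h4)
  · intro t ht x hx
    have htT : t ∈ Ico 0 T := ⟨ht1.le.trans ht.1, ht.2.trans_lt hT⟩
    have hxx : x ∈ Icc 0 R := ⟨hx.1.le, by linarith [hx.2]⟩
    refine le_trans ?_ (S.Gl _ _ (S.un t htT x hxx) (S.vn t htT x hxx))
    apply mul_le_mul_of_nonneg_left _ hc₁.le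
    apply Real.rpow_le_rpow (by positivity) _ (by linarith)
    exact (first t ht).trans (S.um t htT hxx ⟨by linarith, by linarith⟩ hx.2)

lemma exists_K {p q c α : ℝ} (hp : 1 < p) (hq : 1 < q) (hc : 0 < c) :
    ∃ K > 0, 4 ^ α * K ≤
      c * (Real.exp (-1) * (c * (Real.exp (-1) * K) ^ q)) ^ p := by
  have hpq : 0 < p * q - 1 := by nlinarith
  set E := Real.exp (-1)
  have hE : 0 < E := Real.exp_pos _
  set c3 := c * (E * (c * E ^ q)) ^ p with hc3
  have h3 : 0 < c3 := by positivity
  obtain ⟨K, h1, h2⟩ := ((tendsto_rpow_atTop hpq).eventually_ge_atTop (4 ^ α / c3) |>.and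
    (eventually_gt_atTop 0)).exists
  refine ⟨K, h2, ?_⟩
  have e1 : c * (E * (c * (E * K) ^ q)) ^ p = c3 * (K ^ (p * q - 1) * K) := by
    have e2 : K ^ (p * q - 1) * K = (K ^ q) ^ p := by
      rw [← Real.rpow_mul h2.le, mul_comm q p, Real.rpow_sub_one h2.ne']; field_simp
    rw [e2, Real.mul_rpow hE.le h2.le, hc3]
    have : E * (c * (E ^ q * K ^ q)) = (E * (c * E ^ q)) * K ^ q := by ring
    rw [this, Real.mul_rpow (by positivity) (by positivity)]; ring
  rw [e1, ← mul_assoc]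
  rw [div_le_iff₀ h3] at h1
  apply mul_le_mul_of_nonneg_right _ h2.le
  linarith

lemma Sys.typeI (S : Sys k R p q r s α β d e c₁ c₂ T F G u v) {a : ℝ} (ha : 0 < a) (haR : a < R) :
    ∃ K > 0, ∃ t' ∈ Ioo 0 T, ∀ t ∈ Ico t' T, ∀ x ∈ Icc a R, u t x ≤ K * (T - t) ^ (-α) := by
  obtain ⟨ν1, hν1, tr1⟩ := S.transfer (show 0 < a / 4 by positivity)
  obtain ⟨ν2, hν2, tr2⟩ := S.swap.transfer (show 0 < a / 4 by positivity)
  set c := Real.exp (-1) * c₁ with hc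
  have hc0 : 0 < c := mul_pos (Real.exp_pos _) S.hc₁
  obtain ⟨K, hK, hKe⟩ := exists_K (α := α) S.hp S.hq hc0
  set l := a / 16 with hl
  have hl0 : 0 < l := by positivity
  set ν := min ν1 ν2
  have hν : 0 < ν := lt_min hν1 hν2
  have hT := S.hT
  refine ⟨K * 3 ^ α, by positivity, max (T / 2) (T - 3 * ν * l ^ 2), ⟨lt_max_of_lt_left (by linarith),
    max_lt (by linarith) (by have : 0 < 3 * ν * l ^ 2 := by positivity
                             linarith)⟩, ?_⟩
  intro t ht x hx
  have ht0 : 0 < t := by have := (le_max_left _ _).trans ht.1; linarith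
  have htT : t < T := ht.2
  have htν : T - t ≤ 3 * ν * l ^ 2 := by have := (le_max_right _ _).trans ht.1; linarith
  have hua : u t x ≤ u t a := S.um t ⟨ht0.le, htT⟩ ⟨ha.le, haR.le⟩ ⟨ha.le.trans hx.1, hx.2⟩ hx.1
  refine hua.trans ?_
  set τ := (T - t) / 3 with hτ
  have hτ0 : 0 < τ := by simp only [hτ]; linarith
  have e0 : K * 3 ^ α * (T - t) ^ (-α) = K * τ ^ (-α) := by
    have : T - t = 3 * τ := by simp only [hτ]; ring
    rw [this, Real.mul_rpow (by norm_num) hτ0.le, Real.rpow_neg (by norm_num : (0:ℝ) ≤ 3)]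
    have : (3:ℝ) ^ α ≠ 0 := by positivity
    field_simp
  rw [e0]
  by_contra hcon
  push Not at hcon
  set tk : ℕ → ℝ := fun j => t + 8 / 3 * τ * (1 - 1 / 4 ^ j) with htk
  set xk : ℕ → ℝ := fun j => a - 8 * l * (1 - 1 / 2 ^ j) with hxk
  have tkb : ∀ j, tk j ∈ Icc t (t + 8 / 3 * τ) := by
    intro j
    have h1 : (0:ℝ) < 1 / 4 ^ j := by positivity
    have h2 : (1:ℝ) / 4 ^ j ≤ 1 := by
      rw [div_le_one (by positivity)]; exact one_le_pow₀ (by norm_num)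
    constructor <;> simp only [htk] <;> nlinarith
  have xkb : ∀ j, xk j ∈ Icc (a / 2) a := by
    intro j
    have h1 : (0:ℝ) < 1 / 2 ^ j := by positivity
    have h2 : (1:ℝ) / 2 ^ j ≤ 1 := by
      rw [div_le_one (by positivity)]; exact one_le_pow₀ (by norm_num)
    constructor <;> simp only [hxk] <;> nlinarith
  have ind : ∀ j : ℕ, K * (τ / 4 ^ j) ^ (-α) ≤ u (tk j) (xk j) := by
    intro j
    induction j with
    | zero => simp [htk, hxk]; exact hcon.le
    | succ j ih =>
      set τj := τ / 4 ^ j with hτj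
      set lj := l / 2 ^ j with hlj
      have hτj0 : 0 < τj := by positivity
      have hlj0 : 0 < lj := by positivity
      have hljl : lj ≤ l := div_le_self hl0.le (one_le_pow₀ (by norm_num))
      have hx1 : xk (j + 1) = xk j - 4 * lj := by
        simp only [hxk, hlj, pow_succ]; field_simp; ring
      have ht1 : tk (j + 1) = tk j + 2 * τj := by
        simp only [htk, hτj, pow_succ]; field_simp; ring
      have hsq : lj ^ 2 = l ^ 2 / 4 ^ j := by
        rw [hlj, div_pow, ← pow_mul, mul_comm j 2, pow_mul]; norm_num
      have hτl : τj ≤ ν * lj ^ 2 := by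
        rw [hsq, hτj, ← mul_div_assoc]
        apply div_le_div_of_nonneg_right _ (by positivity)
        simp only [hτ]; linarith
      have hb1 := tkb j
      have hb2 := tkb (j + 1)
      have hb3 := xkb j
      have hb4 := xkb (j + 1)
      have hTT : t + 8 / 3 * τ < T := by simp only [hτ]; linarith
      have hA0 : 0 ≤ K * τj ^ (-α) := by positivity
      have s1 := (tr1 lj ⟨hlj0, by linarith⟩ (xk j - 2 * lj) (by linarith [hb4.1]) (by linarith [hb3.2])
        (tk j) τj (by linarith [hb1.1]) hτj0
        (hτl.trans (mul_le_mul_of_nonneg_right (min_le_left _ _) (by positivity)))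
        (by linarith [hb2.2]) _ hA0 (by rw [sub_add_cancel]; exact ih)).2
      have s2 := (tr2 lj ⟨hlj0, by linarith⟩ (xk j - 4 * lj) (by linarith [hb4.1]) (by linarith [hb3.2])
        (tk j + τj) τj (by linarith [hb1.1]) hτj0
        (hτl.trans (mul_le_mul_of_nonneg_right (min_le_right _ _) (by positivity)))
        (by linarith [hb2.2]) (c * (Real.exp (-1) * (K * τj ^ (-α))) ^ q * τj) (by positivity)
        (by rw [show xk j - 4 * lj + 2 * lj = xk j - 2 * lj by ring]; exact s1)).2
      rw [hx1, ht1, show tk j + 2 * τj = tk j + τj + τj by ring]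
      refine le_trans ?_ s2
      have e1 : τ / 4 ^ (j + 1) = τj / 4 := by rw [hτj, pow_succ]; field_simp
      rw [e1, Real.div_rpow hτj0.le (by norm_num), Real.rpow_neg (by norm_num : (0:ℝ) ≤ 4), div_inv_eq_mul]
      set E := Real.exp (-1)
      have hE : 0 < E := Real.exp_pos _
      have e2 : c * (E * (K * τj ^ (-α))) ^ q * τj = (c * (E * K) ^ q) * τj ^ (-β) := by
        rw [← mul_assoc, Real.mul_rpow (by positivity) (by positivity), ← Real.rpow_mul hτj0.le]
        have : -β = -α * q + 1 := by linarith [S.hαq]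
        rw [this, Real.rpow_add_one hτj0.ne']; ring
      have e3 : c * (E * ((c * (E * K) ^ q) * τj ^ (-β))) ^ p * τj
          = c * (E * (c * (E * K) ^ q)) ^ p * τj ^ (-α) := by
        rw [← mul_assoc E, Real.mul_rpow (by positivity) (by positivity), ← Real.rpow_mul hτj0.le]
        have : -α = -β * p + 1 := by linarith [S.hβp]
        rw [this, Real.rpow_add_one hτj0.ne']; ring
      rw [e2, e3]
      have : 0 ≤ τj ^ (-α) := by positivity
      calc K * (τj ^ (-α) * 4 ^ α) = (4 ^ α * K) * τj ^ (-α) := by ring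
        _ ≤ _ := mul_le_mul_of_nonneg_right hKe this
  have hTT : t + 8 / 3 * τ < T := by simp only [hτ]; linarith
  have hcont : ContinuousOn (fun s => u s (a / 2)) (Icc t (t + 8 / 3 * τ)) := by
    have : ContinuousOn (fun s : ℝ => (s, a / 2)) (Icc t (t + 8 / 3 * τ)) := by fun_prop
    exact S.uc.comp this (fun s hs => ⟨⟨ht0.le.trans hs.1, hs.2.trans_lt hTT⟩, by positivity, by linarith⟩)
  obtain ⟨C, hC⟩ := (isCompact_Icc.image_of_continuousOn hcont).bddAbove
  have hbd : ∀ j : ℕ, K * τ ^ (-α) * (4 ^ α) ^ j ≤ C := by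
    intro j
    have h1 := hC (mem_image_of_mem _ (tkb j))
    have h2 : u (tk j) (xk j) ≤ u (tk j) (a / 2) := S.um (tk j) ⟨ht0.le.trans (tkb j).1,
      (tkb j).2.trans_lt hTT⟩ ⟨by positivity, by linarith⟩ ⟨by linarith [(xkb j).1],
        by linarith [(xkb j).2]⟩ (xkb j).1
    have h3 := ind j
    rw [Real.div_rpow hτ0.le (by positivity), Real.rpow_neg (by positivity : (0:ℝ) ≤ 4 ^ j),
      div_inv_eq_mul, ← Real.rpow_natCast, ← Real.rpow_mul (by norm_num), mul_comm (j:ℝ) α,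
      Real.rpow_mul (by norm_num), Real.rpow_natCast, ← mul_assoc] at h3
    exact h3.trans (h2.trans h1)
  have h4 : (1:ℝ) < 4 ^ α := Real.one_lt_rpow (by norm_num) S.hα
  have h5 := (tendsto_pow_atTop_atTop_of_one_lt h4).const_mul_atTop
    (show 0 < K * τ ^ (-α) by positivity)
  obtain ⟨j, hj⟩ := (h5.eventually_gt_atTop C).exists
  exact absurd (hbd j) (not_le.2 hj)

end SPB

namespace SPB
variable {k R p q r s α β d e c₁ c₂ T : ℝ} {F G : ℝ → ℝ → ℝ} {u v : ℝ → ℝ → ℝ}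

lemma Sys.comp_step (S : Sys k R p q r s α β d e c₁ c₂ T F G u v) {b t0 t x : ℝ} (hb : 0 < b)
    (ht0 : 0 < t0) (ht : t0 < t) (htT : t < T) (hx : x ∈ Ioo b R) {U V : ℝ → ℝ → ℝ}
    (hpos : ∀ s ∈ Icc t0 t, ∀ y ∈ Icc b R, u s y ≤ U s y) (hV : v t x ≤ V t x)
    (heq : u t x = U t x) {Ut Uxx : ℝ} {Ux : ℝ → ℝ} (h1 : HasDerivAt (fun s => U s x) Ut t)
    (h2 : ∀ y ∈ Ioo b R, HasDerivAt (U t) (Ux y) y) (h3 : HasDerivAt Ux Uxx x)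
    (h4 : d * Uxx + c₂ * ((V t x) ^ p + (U t x) ^ r + 1) < Ut) : False := by
  have htT' : t ∈ Ioo 0 T := ⟨ht0.trans ht, htT⟩
  have hxR : x ∈ Ioo 0 R := ⟨hb.trans hx.1, hx.2⟩
  have g := min_cond (φ := fun y => U t y - u t y) (ψ := fun y => Ux y - deriv (u t) y)
    (a := (b + x) / 2) (b := (x + R) / 2) (x := x) (D := Uxx - deriv (deriv (u t)) x)
    (by linarith [hx.1, hx.2]) ⟨by linarith [hx.1], by linarith [hx.2]⟩
    (fun y hy => (h2 y ⟨by linarith [hx.1, hy.1], by linarith [hx.2, hy.2]⟩).sub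
      (S.ux t htT' y ⟨by linarith [hx.1, hy.1], by linarith [hx.2, hy.2]⟩))
    (h3.sub (S.uxx t htT' x hxR))
    (fun y hy => by
      have := hpos t ⟨ht.le, le_rfl⟩ y ⟨by linarith [hx.1, hy.1], by linarith [hx.2, hy.2]⟩
      simp only [heq]; linarith)
    (fun h => by linarith [hx.1]) (fun h => by linarith [hx.2])
  have g2 := time_cond (φ := fun s => U s x - u s x) ht (h1.sub (S.ut t htT' x hxR))
    (by simp [heq]) (fun s hs => by have := hpos s hs x ⟨hx.1.le, hx.2.le⟩; linarith)
  have htI : t ∈ Ico 0 T := ⟨htT'.1.le, htT⟩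
  have hxI : x ∈ Icc 0 R := ⟨hxR.1.le, hxR.2.le⟩
  have hu0 := S.un t htI x hxI
  have hv0 := S.vn t htI x hxI
  have g3 := S.Fup _ _ hu0 hv0
  have g4 : v t x ^ p ≤ V t x ^ p := Real.rpow_le_rpow hv0 hV (by linarith [S.hp])
  have g5 := S.ux_nonpos htT' hxR
  have g6 : d * (deriv (deriv (u t)) x + k / x * deriv (u t) x) ≤ d * Uxx := by
    apply mul_le_mul_of_nonneg_left _ S.hd.le
    have : k / x * deriv (u t) x ≤ 0 :=
      mul_nonpos_of_nonneg_of_nonpos (div_nonneg S.hk hxR.1.le) g5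
    linarith [g.2]
  have g7 : c₂ * (v t x ^ p + u t x ^ r + 1) ≤ c₂ * (V t x ^ p + U t x ^ r + 1) := by
    apply mul_le_mul_of_nonneg_left _ S.hc₂.le
    rw [heq]; linarith
  linarith

lemma Sys.comp (S : Sys k R p q r s α β d e c₁ c₂ T F G u v) {b t0 t1 : ℝ} (hb : 0 < b)
    (ht0 : 0 < t0) (ht1T : t1 < T) {U V : ℝ → ℝ → ℝ}
    (Uc : ContinuousOn (Function.uncurry U) (Icc t0 t1 ×ˢ Icc b R))
    (Vc : ContinuousOn (Function.uncurry V) (Icc t0 t1 ×ˢ Icc b R))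
    (U0 : ∀ x ∈ Icc b R, u t0 x < U t0 x) (V0 : ∀ x ∈ Icc b R, v t0 x < V t0 x)
    (Ub : ∀ t ∈ Icc t0 t1, u t b < U t b) (Vb : ∀ t ∈ Icc t0 t1, v t b < V t b)
    (UR : ∀ t ∈ Icc t0 t1, 0 < U t R) (VR : ∀ t ∈ Icc t0 t1, 0 < V t R)
    (hU : ∀ t ∈ Ioc t0 t1, ∀ x ∈ Ioo b R, u t x = U t x → ∃ (Ut Uxx : ℝ) (Ux : ℝ → ℝ),
      HasDerivAt (fun s => U s x) Ut t ∧ (∀ y ∈ Ioo b R, HasDerivAt (U t) (Ux y) y) ∧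
      HasDerivAt Ux Uxx x ∧ d * Uxx + c₂ * ((V t x) ^ p + (U t x) ^ r + 1) < Ut)
    (hV : ∀ t ∈ Ioc t0 t1, ∀ x ∈ Ioo b R, v t x = V t x → ∃ (Vt Vxx : ℝ) (Vx : ℝ → ℝ),
      HasDerivAt (fun s => V s x) Vt t ∧ (∀ y ∈ Ioo b R, HasDerivAt (V t) (Vx y) y) ∧
      HasDerivAt Vx Vxx x ∧ e * Vxx + c₂ * ((U t x) ^ q + (V t x) ^ s + 1) < Vt) :
    ∀ t ∈ Icc t0 t1, ∀ x ∈ Icc b R, u t x < U t x ∧ v t x < V t x := by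
  have hsub : Icc t0 t1 ×ˢ Icc b R ⊆ Ico 0 T ×ˢ Icc 0 R := by
    rintro ⟨t, x⟩ ⟨h1, h2⟩
    exact ⟨⟨ht0.le.trans h1.1, h1.2.trans_lt ht1T⟩, hb.le.trans h2.1, h2.2⟩
  have T1 := touch (K := Icc b R) isCompact_Icc (fun t x => U t x - u t x)
    (fun t x => V t x - v t x) (Uc.sub (S.uc.mono hsub)) (Vc.sub (S.vc.mono hsub))
    (t0 := t0) (t1 := t1)
    (fun x hx => sub_pos.2 (U0 x hx)) (fun x hx => sub_pos.2 (V0 x hx)) ?_ ?_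
  · intro t ht x hx
    have := T1 t ht x hx
    exact ⟨sub_pos.1 this.1, sub_pos.1 this.2⟩
  · intro t ht x hx hf hg h0
    have ht' : t ∈ Icc t0 t1 := ⟨ht.1.le, ht.2⟩
    have hxb : x ≠ b := by rintro rfl; have := Ub t ht'; linarith
    have hxR : x ≠ R := by
      rintro rfl; have := UR t ht'
      have := S.ub t ⟨ht0.trans ht.1, ht.2.trans_lt ht1T⟩; linarith
    have hxo : x ∈ Ioo b R := ⟨lt_of_le_of_ne hx.1 hxb.symm, lt_of_le_of_ne hx.2 hxR⟩
    obtain ⟨Ut, Uxx, Ux, a1, a2, a3, a4⟩ := hU t ht x hxo (by linarith)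
    exact S.comp_step hb ht0 ht.1 (ht.2.trans_lt ht1T) hxo
      (fun s hs y hy => sub_nonneg.1 (hf s hs y hy)) (sub_nonneg.1 (hg t ⟨ht.1.le, le_rfl⟩ x hx))
      (by linarith) a1 a2 a3 a4
  · intro t ht x hx hf hg h0
    have ht' : t ∈ Icc t0 t1 := ⟨ht.1.le, ht.2⟩
    have hxb : x ≠ b := by rintro rfl; have := Vb t ht'; linarith
    have hxR : x ≠ R := by
      rintro rfl; have := VR t ht'
      have := S.vb t ⟨ht0.trans ht.1, ht.2.trans_lt ht1T⟩; linarith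
    have hxo : x ∈ Ioo b R := ⟨lt_of_le_of_ne hx.1 hxb.symm, lt_of_le_of_ne hx.2 hxR⟩
    obtain ⟨Ut, Uxx, Ux, a1, a2, a3, a4⟩ := hV t ht x hxo (by linarith)
    exact S.swap.comp_step hb ht0 ht.1 (ht.2.trans_lt ht1T) hxo
      (fun s hs y hy => sub_nonneg.1 (hg s hs y hy)) (sub_nonneg.1 (hf t ⟨ht.1.le, le_rfl⟩ x hx))
      (by linarith) a1 a2 a3 a4

end SPB

namespace SPB

lemma pow_split {p η K E : ℝ} (hp : 1 < p) (hη : 0 < η) (hE : 0 < E) (hEK : E ≤ K) :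
    (η + E) ^ p ≤ (2 * η) ^ (p - 1) * (η + E) + 2 * (K + η) ^ (p - 1) * E := by
  have h0 : 0 < η + E := by linarith
  have h1 : (η + E) ^ p = (η + E) ^ (p - 1) * (η + E) := by
    rw [← Real.rpow_add_one h0.ne']; congr 1; ring
  rw [h1]
  rcases le_total E η with h | h
  · have : (η + E) ^ (p - 1) ≤ (2 * η) ^ (p - 1) :=
      Real.rpow_le_rpow h0.le (by linarith) (by linarith)
    have h3 := mul_le_mul_of_nonneg_right this h0.le
    have : 0 ≤ 2 * (K + η) ^ (p - 1) * E := by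
      have : 0 < K + η := by linarith
      positivity
    linarith
  · have : (η + E) ^ (p - 1) ≤ (K + η) ^ (p - 1) :=
      Real.rpow_le_rpow h0.le (by linarith) (by linarith)
    have h3 : (η + E) ^ (p - 1) * (η + E) ≤ (K + η) ^ (p - 1) * (2 * E) :=
      mul_le_mul this (by linarith) h0.le (Real.rpow_nonneg (by linarith) _)
    have : 0 ≤ (2 * η) ^ (p - 1) * (η + E) := by positivity
    linarith

lemma bar_num {p r d α η K c₂ : ℝ} (hp : 1 < p) (hr : 1 < r) (hα : 0 < α)
    (hη : 0 < η) (hK : 0 < K) (hc₂ : 0 < c₂) (h1 : c₂ * (2 * η) ^ (p - 1) ≤ α / 8)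
    (h2 : c₂ * (2 * η) ^ (r - 1) ≤ α / 8) :
    ∃ c0 > 0, ∀ c ≥ c0, ∀ z ≥ 0, ∀ w, c₂ * w < α * η / 4 →
      d * (K * Real.exp (-z)) + c₂ * ((η + K * Real.exp (-z)) ^ p + (η + K * Real.exp (-z)) ^ r + w)
      < α * (η + K * Real.exp (-z)) + (c - z / 2) * (K * Real.exp (-z)) := by
  set M := 2 * c₂ * ((K + η) ^ (p - 1) + (K + η) ^ (r - 1)) with hM
  have hM0 : 0 < M := by positivity
  have hlim : ∀ᶠ c in atTop, K * Real.exp (-(c / 2)) < α * η / 4 := by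
    have h : Tendsto (fun c : ℝ => K * Real.exp (-(c / 2))) atTop (nhds (K * 0)) := by
      apply Tendsto.const_mul
      apply Real.tendsto_exp_neg_atTop_nhds_zero.comp
      exact tendsto_id.atTop_div_const (by norm_num)
    rw [mul_zero] at h
    exact h.eventually_lt_const (by positivity)
  obtain ⟨c1, hc1⟩ := eventually_atTop.1 hlim
  refine ⟨max (max c1 (2 * (d + M))) 1, by positivity, fun c hc z hz w hw => ?_⟩
  have hcc1 : c1 ≤ c := ((le_max_left _ _).trans (le_max_left _ _)).trans hc
  have hcd : 2 * (d + M) ≤ c := ((le_max_right _ _).trans (le_max_left _ _)).trans hc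
  have hc0 : 1 ≤ c := (le_max_right _ _).trans hc
  set E := K * Real.exp (-z) with hE
  have hE0 : 0 < E := by positivity
  have hEK : E ≤ K := by
    have : Real.exp (-z) ≤ 1 := Real.exp_le_one_iff.2 (by linarith)
    nlinarith
  have g1 := pow_split hp hη hE0 hEK
  have g2 := pow_split hr hη hE0 hEK
  have g3 : c₂ * (η + E) ^ p ≤ α / 8 * (η + E) + c₂ * (2 * (K + η) ^ (p - 1) * E) := by
    have a1 := mul_le_mul_of_nonneg_left g1 hc₂.le
    have a2 := mul_le_mul_of_nonneg_right h1 (by linarith : 0 ≤ η + E)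
    linarith
  have g4 : c₂ * (η + E) ^ r ≤ α / 8 * (η + E) + c₂ * (2 * (K + η) ^ (r - 1) * E) := by
    have a1 := mul_le_mul_of_nonneg_left g2 hc₂.le
    have a2 := mul_le_mul_of_nonneg_right h2 (by linarith : 0 ≤ η + E)
    linarith
  have g5 : z / 2 * E ≤ c / 2 * E + α * η / 4 := by
    rcases le_total z c with h | h
    · have : z / 2 * E ≤ c / 2 * E := mul_le_mul_of_nonneg_right (by linarith) hE0.le
      have : 0 < α * η := by positivity
      linarith
    · have a1 : z / 2 ≤ Real.exp (z / 2) := by linarith [Real.add_one_le_exp (z / 2)]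
      have a2 : z / 2 * E ≤ K * Real.exp (-(z / 2)) := by
        have : z / 2 * E ≤ Real.exp (z / 2) * E := mul_le_mul_of_nonneg_right a1 hE0.le
        have e : Real.exp (z / 2) * E = K * Real.exp (-(z / 2)) := by
          rw [hE, mul_left_comm, ← Real.exp_add]; congr 2; ring
        linarith
      have a3 := hc1 z (hcc1.trans h)
      have : 0 ≤ c / 2 * E := by positivity
      linarith
  have g6 : (d + M) * E ≤ c / 2 * E := mul_le_mul_of_nonneg_right (by linarith) hE0.le
  have g7 : M * E = c₂ * (2 * (K + η) ^ (p - 1) * E) + c₂ * (2 * (K + η) ^ (r - 1) * E) := by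
    rw [hM]; ring
  have : 0 < α * E := by positivity
  have : 0 < α * η := by positivity
  nlinarith

/-- the barrier similarity variable -/
noncomputable def zz (a c θ T t x : ℝ) : ℝ := (x - a - 2 * c * θ) / √(T - t) + 2 * c

noncomputable def bar (α η K a c θ T t x : ℝ) : ℝ :=
  (T - t) ^ (-α) * (η + K * Real.exp (-(zz a c θ T t x)))

lemma zz_x {a c θ T t x : ℝ} : HasDerivAt (zz a c θ T t) (1 / √(T - t)) x := by
  unfold zz
  have := ((((hasDerivAt_id x).sub_const a).sub_const (2 * c * θ)).div_const (√(T - t))).add_const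
    (2 * c)
  exact this

lemma zz_t {a c θ T t x : ℝ} (ht : t < T) :
    HasDerivAt (fun t => zz a c θ T t x) ((zz a c θ T t x - 2 * c) / (2 * (T - t))) t := by
  unfold zz
  have hτ : 0 < T - t := by linarith
  have h1 : HasDerivAt (fun t => T - t) (-1) t := by
    simpa using (hasDerivAt_id t).const_sub T
  have h2 := h1.sqrt hτ.ne'
  have hs : √(T - t) ≠ 0 := (Real.sqrt_pos.2 hτ).ne'
  have h3 := ((hasDerivAt_const t (x - a - 2 * c * θ)).div h2 hs).add_const (2 * c)
  refine h3.congr_deriv ?_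
  have e : T - t = √(T - t) * √(T - t) := (Real.mul_self_sqrt hτ.le).symm
  rw [add_sub_cancel_right]
  nth_rewrite 5 [e]
  field_simp
  ring

lemma bar_x {α η K a c θ T t x : ℝ} : HasDerivAt (bar α η K a c θ T t)
    ((T - t) ^ (-α) * (K * (Real.exp (-(zz a c θ T t x)) * (-(1 / √(T - t)))))) x := by
  unfold bar
  exact (((zz_x.neg.exp).const_mul K).const_add η).const_mul _

lemma bar_xx {α K a c θ T t x : ℝ} (ht : t < T) :
    HasDerivAt (fun x => (T - t) ^ (-α) * (K * (Real.exp (-(zz a c θ T t x)) * (-(1 / √(T - t))))))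
    ((T - t) ^ (-α) / (T - t) * (K * Real.exp (-(zz a c θ T t x)))) x := by
  have hτ : 0 < T - t := by linarith
  have hs : √(T - t) ≠ 0 := (Real.sqrt_pos.2 hτ).ne'
  have e : T - t = √(T - t) * √(T - t) := (Real.mul_self_sqrt hτ.le).symm
  refine ((((zz_x.neg.exp).mul_const (-(1 / √(T - t)))).const_mul K).const_mul _).congr_deriv ?_
  have : (1:ℝ) / (T - t) = 1 / √(T - t) * (1 / √(T - t)) := by
    nth_rewrite 1 [e]; field_simp
  rw [div_eq_mul_one_div _ (T - t), this]; simp only [Pi.neg_apply]; ring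

lemma bar_t {α η K a c θ T t x : ℝ} (ht : t < T) :
    HasDerivAt (fun t => bar α η K a c θ T t x)
    ((T - t) ^ (-α) / (T - t) * (α * (η + K * Real.exp (-(zz a c θ T t x)))
      + (c - zz a c θ T t x / 2) * (K * Real.exp (-(zz a c θ T t x))))) t := by
  have hτ : 0 < T - t := by linarith
  have h1 : HasDerivAt (fun t => T - t) (-1) t := by
    simpa using (hasDerivAt_id t).const_sub T
  have h2 := h1.rpow_const (p := -α) (Or.inl hτ.ne')
  unfold bar
  refine (h2.mul ((((zz_t (a := a) (c := c) (θ := θ) (x := x) ht).neg.exp).const_mul K).const_add η)).congr_deriv ?_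
  have : (T - t) ^ (-α - 1) = (T - t) ^ (-α) / (T - t) := Real.rpow_sub_one hτ.ne' _
  rw [this]
  generalize Real.exp _ = E
  field_simp
  ring

lemma bar_cont {α η K a c θ T t0 t1 b R : ℝ} (ht1 : t1 < T) :
    ContinuousOn (Function.uncurry (bar α η K a c θ T)) (Icc t0 t1 ×ˢ Icc b R) := by
  have h0 : ∀ z ∈ Icc t0 t1 ×ˢ Icc b R, (0:ℝ) < T - z.1 := fun z hz => by linarith [hz.1.2]
  have h1 : ContinuousOn (fun z : ℝ × ℝ => T - z.1) (Icc t0 t1 ×ˢ Icc b R) := by fun_prop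
  have h2 : ContinuousOn (fun z : ℝ × ℝ => zz a c θ T z.1 z.2) (Icc t0 t1 ×ˢ Icc b R) := by
    unfold zz
    apply ContinuousOn.add _ continuousOn_const
    apply ContinuousOn.div (by fun_prop) h1.sqrt
    intro z hz; exact (Real.sqrt_pos.2 (h0 z hz)).ne'
  unfold bar
  apply ContinuousOn.mul
  · exact h1.rpow_const fun z hz => Or.inl (h0 z hz).ne'
  · exact ((h2.neg.rexp).const_mul K).const_add η |>.congr fun z hz => rfl

lemma rpow_bar {τ α β p Φ : ℝ} (hτ : 0 < τ) (hΦ : 0 ≤ Φ) (h : β * p = α + 1) :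
    (τ ^ (-β) * Φ) ^ p = τ ^ (-α) / τ * Φ ^ p := by
  rw [Real.mul_rpow (Real.rpow_nonneg hτ.le _) hΦ, ← Real.rpow_mul hτ.le, ← Real.rpow_sub_one hτ.ne']
  congr 2; linarith

/-- the pointwise supersolution inequality -/
lemma bar_super {α β p r d η K c₂ a c θ T t x : ℝ} (ht : t < T) (hη : 0 < η) (hK : 0 < K)
    (hβp : β * p = α + 1) (hαr : α * r = α + 1)
    (h : d * (K * Real.exp (-(zz a c θ T t x))) + c₂ * ((η + K * Real.exp (-(zz a c θ T t x))) ^ p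
      + (η + K * Real.exp (-(zz a c θ T t x))) ^ r + (T - t) ^ (α + 1))
      < α * (η + K * Real.exp (-(zz a c θ T t x))) + (c - zz a c θ T t x / 2) * (K * Real.exp (-(zz a c θ T t x)))) :
    d * ((T - t) ^ (-α) / (T - t) * (K * Real.exp (-(zz a c θ T t x))))
     + c₂ * ((bar β η K a c θ T t x) ^ p + (bar α η K a c θ T t x) ^ r + 1)
     < (T - t) ^ (-α) / (T - t) * (α * (η + K * Real.exp (-(zz a c θ T t x)))
      + (c - zz a c θ T t x / 2) * (K * Real.exp (-(zz a c θ T t x)))) := by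
  have hτ : 0 < T - t := by linarith
  unfold bar
  rw [rpow_bar hτ (by positivity) hβp, rpow_bar hτ (by positivity) hαr]
  have e : 1 = (T - t) ^ (-α) / (T - t) * (T - t) ^ (α + 1) := by
    rw [← Real.rpow_sub_one hτ.ne', ← Real.rpow_add hτ]; ring_nf; simp
  have hP : 0 < (T - t) ^ (-α) / (T - t) := by positivity
  have := mul_lt_mul_of_pos_left h hP
  rw [mul_add] at this
  have e2 : c₂ = c₂ * ((T - t) ^ (-α) / (T - t) * (T - t) ^ (α + 1)) := by rw [← e, mul_one]
  linarith

variable {k R p q r s α β d e c₁ c₂ T : ℝ} {F G : ℝ → ℝ → ℝ} {u v : ℝ → ℝ → ℝ}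

lemma near_T {T c ε : ℝ} (hε : 0 < ε) (hc : 0 < c) {α : ℝ} (hα : 0 < α) :
    ∃ t', t' < T ∧ ∀ t ∈ Ico t' T, c * (T - t) ^ α < ε := by
  refine ⟨T - (ε / (2 * c)) ^ (1 / α), by linarith [Real.rpow_pos_of_pos (by positivity : 0 < ε / (2 * c)) (1 / α)], fun t ht => ?_⟩
  have h1 : 0 ≤ T - t := by linarith [ht.2]
  have h2 : (T - t) ^ α ≤ ((ε / (2 * c)) ^ (1 / α)) ^ α :=
    Real.rpow_le_rpow h1 (by linarith [ht.1]) hα.le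
  rw [← Real.rpow_mul (by positivity), one_div, inv_mul_cancel₀ hα.ne', Real.rpow_one] at h2
  have := mul_le_mul_of_nonneg_left h2 hc.le
  have e : c * (ε / (2 * c)) = ε / 2 := by field_simp
  linarith

set_option maxHeartbeats 1000000 in
lemma Sys.small (S : Sys k R p q r s α β d e c₁ c₂ T F G u v) {a b η : ℝ} (ha : 0 < a) (hab : a < b)
    (hbR : b < R) (hη : 0 < η)
    (h1 : c₂ * (2 * η) ^ (p - 1) ≤ α / 8) (h2 : c₂ * (2 * η) ^ (r - 1) ≤ α / 8)
    (h3 : c₂ * (2 * η) ^ (q - 1) ≤ β / 8) (h4 : c₂ * (2 * η) ^ (s - 1) ≤ β / 8) :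
    ∃ t' ∈ Ioo 0 T, ∀ t0 ∈ Ico t' T, u t0 a < η * (T - t0) ^ (-α) → v t0 a < η * (T - t0) ^ (-β) →
      ∀ t ∈ Ico t0 T, ∀ x ∈ Icc b R,
        u t x < (2 * η) * (T - t) ^ (-α) ∧ v t x < (2 * η) * (T - t) ^ (-β) := by
  obtain ⟨K1, hK1, t1, ht1, H1⟩ := S.typeI ha (hab.trans hbR)
  obtain ⟨K2, hK2, t2, ht2, H2⟩ := S.swap.typeI ha (hab.trans hbR)
  set K := max K1 K2 with hKd
  have hK : 0 < K := lt_max_of_lt_left hK1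
  obtain ⟨c3, hc3, H3⟩ := bar_num (d := d) S.hp S.hr S.hα hη hK S.hc₂ h1 h2
  obtain ⟨c4, hc4, H4⟩ := bar_num (d := e) S.hq S.hs S.hβ hη hK S.hc₂ h3 h4
  set c := max c3 c4 with hcd
  have hc : 0 < c := lt_max_of_lt_left hc3
  obtain ⟨t5, ht5, H5⟩ := near_T (T := T) (ε := α * η / 4) (c := c₂)
    (by have := S.hα; positivity) S.hc₂ (α := α + 1) (by linarith [S.hα])
  obtain ⟨t6, ht6, H6⟩ := near_T (T := T) (ε := β * η / 4) (c := c₂)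
    (by have := S.hβ; positivity) S.hc₂ (α := β + 1) (by linarith [S.hβ])
  obtain ⟨t7, ht7, H7⟩ := near_T (T := T) (ε := (b - a) / 2) (c := 2 * c)
    (by linarith) (by positivity) (α := 1 / 2) (by norm_num)
  set Z := max 1 (Real.log (K / η) + 1) with hZ
  have hZ1 : 1 ≤ Z := le_max_left _ _
  obtain ⟨t8, ht8, H8⟩ := near_T (T := T) (ε := (b - a) / 2) (c := Z)
    (by linarith) (by linarith) (α := 1 / 2) (by norm_num)
  have hZK : K * Real.exp (-Z) < η := by
    have : Real.log (K / η) < Z := by linarith [le_max_right 1 (Real.log (K / η) + 1)]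
    rw [Real.log_lt_iff_lt_exp (by positivity), div_lt_iff₀ hη] at this
    rw [Real.exp_neg, ← div_eq_mul_inv, div_lt_iff₀ (Real.exp_pos _)]; linarith
  refine ⟨max (max t1 t2) (max (max t5 t6) (max t7 t8)), ⟨lt_max_of_lt_left (lt_max_of_lt_left ht1.1),
    max_lt (max_lt ht1.2 ht2.2) (max_lt (max_lt ht5 ht6) (max_lt ht7 ht8))⟩, ?_⟩
  intro t0 ht0 hu0 hv0
  have m := ht0.1
  simp only [max_le_iff] at m
  obtain ⟨⟨m1, m2⟩, ⟨m5, m6⟩, m7, m8⟩ := m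
  have ht0T : t0 < T := ht0.2
  have ht00 : 0 < t0 := ht1.1.trans_le m1
  set θ := √(T - t0) with hθ
  have hθ0 : 0 < θ := Real.sqrt_pos.2 (by linarith)
  have h7 : 2 * c * θ < (b - a) / 2 := by
    rw [hθ, Real.sqrt_eq_rpow]; exact H7 t0 ⟨m7, ht0T⟩
  have h8 : Z * θ < (b - a) / 2 := by
    rw [hθ, Real.sqrt_eq_rpow]; exact H8 t0 ⟨m8, ht0T⟩
  have zneg : ∀ {γ : ℝ} {t x : ℝ}, t < T → zz a c θ T t x ≤ 0 →
      K * (T - t) ^ (-γ) < bar γ η K a c θ T t x := by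
    intro γ t x ht hz
    have hP : 0 < (T - t) ^ (-γ) := Real.rpow_pos_of_pos (by linarith) _
    have h : 1 ≤ Real.exp (-(zz a c θ T t x)) := Real.one_le_exp (by linarith)
    unfold bar
    have : K < η + K * Real.exp (-(zz a c θ T t x)) := by nlinarith
    have := mul_lt_mul_of_pos_left this hP
    linarith
  have barpos : ∀ {γ : ℝ} {t x : ℝ}, t < T → η * (T - t) ^ (-γ) < bar γ η K a c θ T t x := by
    intro γ t x ht
    have hP : 0 < (T - t) ^ (-γ) := Real.rpow_pos_of_pos (by linarith) _
    unfold bar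
    have : η < η + K * Real.exp (-(zz a c θ T t x)) := by linarith [mul_pos hK (Real.exp_pos (-(zz a c θ T t x)))]
    have := mul_lt_mul_of_pos_left this hP
    linarith
  have uK : ∀ t ∈ Ico t0 T, ∀ x ∈ Icc a R, u t x ≤ K * (T - t) ^ (-α) := by
    intro t ht x hx
    refine (H1 t ⟨m1.trans ht.1, ht.2⟩ x hx).trans ?_
    exact mul_le_mul_of_nonneg_right (le_max_left _ _) (Real.rpow_nonneg (by linarith [ht.2]) _)
  have vK : ∀ t ∈ Ico t0 T, ∀ x ∈ Icc a R, v t x ≤ K * (T - t) ^ (-β) := by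
    intro t ht x hx
    refine (H2 t ⟨m2.trans ht.1, ht.2⟩ x hx).trans ?_
    exact mul_le_mul_of_nonneg_right (le_max_right _ _) (Real.rpow_nonneg (by linarith [ht.2]) _)
  have za : ∀ t ∈ Ico t0 T, zz a c θ T t a ≤ 0 := by
    intro t ht
    have h : 0 < √(T - t) := Real.sqrt_pos.2 (by linarith [ht.2])
    have h' : √(T - t) ≤ θ := Real.sqrt_le_sqrt (by linarith [ht.1])
    unfold zz
    have : (a - a - 2 * c * θ) / √(T - t) ≤ -(2 * c) := by
      rw [div_le_iff₀ h]
      have := mul_le_mul_of_nonneg_left h' (by linarith : 0 ≤ 2 * c)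
      linarith
    linarith
  have haR : a ∈ Icc a R := ⟨le_rfl, (hab.trans hbR).le⟩
  intro t ht x hx
  have ht00I : t0 ∈ Ico 0 T := ⟨ht00.le, ht0T⟩
  have key := S.comp ha ht00 ht.2 (U := bar α η K a c θ T) (V := bar β η K a c θ T)
    (bar_cont ht.2) (bar_cont ht.2)
    (fun x hx => ((S.um t0 ht00I ⟨ha.le, haR.2⟩ ⟨ha.le.trans hx.1, hx.2⟩ hx.1).trans_lt hu0).trans
      (barpos ht0T))
    (fun x hx => ((S.vm t0 ht00I ⟨ha.le, haR.2⟩ ⟨ha.le.trans hx.1, hx.2⟩ hx.1).trans_lt hv0).trans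
      (barpos ht0T))
    (fun s hs => (uK s ⟨hs.1, hs.2.trans_lt ht.2⟩ a haR).trans_lt
      (zneg (hs.2.trans_lt ht.2) (za s ⟨hs.1, hs.2.trans_lt ht.2⟩)))
    (fun s hs => (vK s ⟨hs.1, hs.2.trans_lt ht.2⟩ a haR).trans_lt
      (zneg (hs.2.trans_lt ht.2) (za s ⟨hs.1, hs.2.trans_lt ht.2⟩)))
    (fun s hs => lt_trans (mul_pos hη (Real.rpow_pos_of_pos (by linarith [hs.2, ht.2]) _))
      (barpos (hs.2.trans_lt ht.2)))
    (fun s hs => lt_trans (mul_pos hη (Real.rpow_pos_of_pos (by linarith [hs.2, ht.2]) _))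
      (barpos (hs.2.trans_lt ht.2)))
    (fun s hs y hy heq => ?_) (fun s hs y hy heq => ?_) t ⟨ht.1, le_rfl⟩ x ⟨hab.le.trans hx.1, hx.2⟩
  · have h : 0 < √(T - t) := Real.sqrt_pos.2 (by linarith [ht.2])
    have h' : √(T - t) ≤ θ := Real.sqrt_le_sqrt (by linarith [ht.1])
    have hzZ : Z ≤ zz a c θ T t x := by
      unfold zz
      have : Z ≤ (x - a - 2 * c * θ) / √(T - t) := by
        rw [le_div_iff₀ h]
        have := mul_le_mul_of_nonneg_left h' (by linarith : 0 ≤ Z)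
        linarith [hx.1]
      linarith
    have hE : K * Real.exp (-(zz a c θ T t x)) < η := by
      have : Real.exp (-(zz a c θ T t x)) ≤ Real.exp (-Z) := Real.exp_le_exp.2 (by linarith)
      exact (mul_le_mul_of_nonneg_left this hK.le).trans_lt hZK
    have B : ∀ γ, bar γ η K a c θ T t x ≤ 2 * η * (T - t) ^ (-γ) := by
      intro γ
      have hP : 0 < (T - t) ^ (-γ) := Real.rpow_pos_of_pos (by linarith [ht.2]) _
      unfold bar
      have : η + K * Real.exp (-(zz a c θ T t x)) ≤ 2 * η := by linarith
      have := mul_le_mul_of_nonneg_left this hP.le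
      linarith
    exact ⟨key.1.trans_le (B α), key.2.trans_le (B β)⟩
  · have hsT : s < T := hs.2.trans_lt ht.2
    refine ⟨_, _, _, bar_t hsT, fun y _ => bar_x, bar_xx hsT, ?_⟩
    refine bar_super hsT hη hK S.hβp S.hαr (H3 c (le_max_left _ _) _ ?_ _ (H5 s ⟨m5.trans hs.1.le, hsT⟩))
    by_contra hz
    have := uK s ⟨hs.1.le, hsT⟩ y ⟨hy.1.le, hy.2.le⟩
    have h' := zneg (γ := α) hsT (not_le.1 hz).le
    linarith
  · have hsT : s < T := hs.2.trans_lt ht.2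
    refine ⟨_, _, _, bar_t hsT, fun y _ => bar_x, bar_xx hsT, ?_⟩
    refine bar_super hsT hη hK S.hαq S.hβs (H4 c (le_max_right _ _) _ ?_ _ (H6 s ⟨m6.trans hs.1.le, hsT⟩))
    by_contra hz
    have := vK s ⟨hs.1.le, hsT⟩ y ⟨hy.1.le, hy.2.le⟩
    have h' := zneg (γ := β) hsT (not_le.1 hz).le
    linarith

end SPB

namespace SPB
variable {k R p q r s α β d e c₁ c₂ T : ℝ} {F G : ℝ → ℝ → ℝ} {u v : ℝ → ℝ → ℝ}

lemma quad_x {γ η1 ε b T t x : ℝ} (hs : 0 < T - t + ε * (x - b) ^ 2) :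
    HasDerivAt (fun x => η1 * (T - t + ε * (x - b) ^ 2) ^ (-γ))
      (η1 * (-γ * (T - t + ε * (x - b) ^ 2) ^ (-γ - 1) * (2 * ε * (x - b)))) x := by
  have h1 : HasDerivAt (fun x => T - t + ε * (x - b) ^ 2) (2 * ε * (x - b)) x := by
    refine (((((hasDerivAt_id x).sub_const b).pow 2).const_mul ε).const_add (T - t)).congr_deriv ?_
    simp; ring
  refine ((h1.rpow_const (p := -γ) (Or.inl hs.ne')).const_mul η1).congr_deriv ?_
  ring

lemma quad_xx {γ η1 ε b T t x : ℝ} (hs : 0 < T - t + ε * (x - b) ^ 2) :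
    HasDerivAt (fun x => η1 * (-γ * (T - t + ε * (x - b) ^ 2) ^ (-γ - 1) * (2 * ε * (x - b))))
      (η1 * (γ * (γ + 1) * ((T - t + ε * (x - b) ^ 2) ^ (-γ - 1) / (T - t + ε * (x - b) ^ 2)) * (4 * ε * (ε * (x - b) ^ 2))
       - γ * (T - t + ε * (x - b) ^ 2) ^ (-γ - 1) * (2 * ε))) x := by
  have h1 : HasDerivAt (fun x => T - t + ε * (x - b) ^ 2) (2 * ε * (x - b)) x := by
    refine (((((hasDerivAt_id x).sub_const b).pow 2).const_mul ε).const_add (T - t)).congr_deriv ?_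
    simp; ring
  have h2 := h1.rpow_const (p := -γ - 1) (Or.inl hs.ne')
  have h3 : HasDerivAt (fun x => 2 * ε * (x - b)) (2 * ε) x := by
    simpa using ((hasDerivAt_id x).sub_const b).const_mul (2 * ε)
  refine (((h2.const_mul (-γ)).mul h3).const_mul η1).congr_deriv ?_
  rw [Real.rpow_sub_one hs.ne' (-γ - 1)]
  ring

lemma quad_t {γ η1 ε b T t x : ℝ} (hs : 0 < T - t + ε * (x - b) ^ 2) :
    HasDerivAt (fun t => η1 * (T - t + ε * (x - b) ^ 2) ^ (-γ))
      (η1 * γ * (T - t + ε * (x - b) ^ 2) ^ (-γ - 1)) t := by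
  have h1 : HasDerivAt (fun t => T - t + ε * (x - b) ^ 2) (-1) t := by
    simpa using ((hasDerivAt_id t).const_sub T).add_const (ε * (x - b) ^ 2)
  refine ((h1.rpow_const (p := -γ) (Or.inl hs.ne')).const_mul η1).congr_deriv ?_
  ring

lemma quad_super {α β p r d η1 c₂ ε b T t x : ℝ} (ht : t < T) (hα : 0 < α) (hη : 0 < η1) (hε : 0 < ε)
    (hβp : β * p = α + 1) (hαr : α * r = α + 1) (hd : 0 < d) (hεd : 8 * d * ε * (α + 1) ≤ 1)
    (h : c₂ * (η1 ^ p + η1 ^ r) ≤ α * η1 / 4)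
    (hs : c₂ * (T - t + ε * (x - b) ^ 2) ^ (α + 1) < α * η1 / 4) :
    d * (η1 * (α * (α + 1) * ((T - t + ε * (x - b) ^ 2) ^ (-α - 1) / (T - t + ε * (x - b) ^ 2)) * (4 * ε * (ε * (x - b) ^ 2))
       - α * (T - t + ε * (x - b) ^ 2) ^ (-α - 1) * (2 * ε)))
    + c₂ * ((η1 * (T - t + ε * (x - b) ^ 2) ^ (-β)) ^ p + (η1 * (T - t + ε * (x - b) ^ 2) ^ (-α)) ^ r + 1)
    < η1 * α * (T - t + ε * (x - b) ^ 2) ^ (-α - 1) := by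
  set w := ε * (x - b) ^ 2 with hw
  have hw0 : 0 ≤ w := by positivity
  set σ := T - t + w with hσ
  have hσ0 : 0 < σ := by linarith
  have hwσ : w / σ ≤ 1 := by rw [div_le_one hσ0]; linarith
  set P := σ ^ (-α - 1) with hP
  have hP0 : 0 < P := by positivity
  have e1 : (η1 * σ ^ (-β)) ^ p = P * η1 ^ p := by
    rw [mul_comm, rpow_bar hσ0 hη.le hβp, ← Real.rpow_sub_one hσ0.ne']
  have e2 : (η1 * σ ^ (-α)) ^ r = P * η1 ^ r := by
    rw [mul_comm, rpow_bar hσ0 hη.le hαr, ← Real.rpow_sub_one hσ0.ne']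
  have e3 : P * σ ^ (α + 1) = 1 := by
    rw [hP, ← Real.rpow_add hσ0]; ring_nf; simp
  rw [e1, e2]
  have f1 : d * (η1 * (α * (α + 1) * (P / σ) * (4 * ε * w) - α * P * (2 * ε))) ≤ η1 * α * P / 2 := by
    have a1 : d * (η1 * (α * (α + 1) * (P / σ) * (4 * ε * w))) =
      (4 * d * ε * (α + 1)) * (w / σ) * (η1 * α * P) := by ring
    have a2 : (4 * d * ε * (α + 1)) * (w / σ) ≤ 1 / 2 := by
      have : 0 ≤ w / σ := by positivity
      have : 0 < 4 * d * ε * (α + 1) := by positivity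
      nlinarith
    have a3 := mul_le_mul_of_nonneg_right a2 (by positivity : 0 ≤ η1 * α * P)
    have : 0 ≤ d * (η1 * (α * P * (2 * ε))) := by positivity
    linarith
  have f2 := mul_le_mul_of_nonneg_left h hP0.le
  have f3 := mul_lt_mul_of_pos_left hs hP0
  have e4 : c₂ = P * (c₂ * σ ^ (α + 1)) := by rw [mul_left_comm, e3, mul_one]
  linarith

set_option maxHeartbeats 1000000 in
lemma Sys.quad (S : Sys k R p q r s α β d e c₁ c₂ T F G u v) {b η η1 : ℝ} (hb : 0 < b)
    (hbR : b < R) (hη : 0 < η) (hη1 : 0 < η1)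
    (h1 : c₂ * (η1 ^ p + η1 ^ r) ≤ α * η1 / 4) (h2 : c₂ * (η1 ^ q + η1 ^ s) ≤ β * η1 / 4)
    (h3 : 2 * η ≤ η1 * 2 ^ (-α)) (h4 : 2 * η ≤ η1 * 2 ^ (-β)) :
    ∃ t' ∈ Ioo 0 T, ∀ t0 ∈ Ico t' T,
      (∀ t ∈ Ico t0 T, u t b < (2 * η) * (T - t) ^ (-α) ∧ v t b < (2 * η) * (T - t) ^ (-β)) →
      ∃ ε > 0, ∀ t ∈ Ico t0 T, ∀ x ∈ Icc b R,
        u t x < η1 * (T - t + ε * (x - b) ^ 2) ^ (-α) ∧ v t x < η1 * (T - t + ε * (x - b) ^ 2) ^ (-β) := by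
  have hα := S.hα
  have hβ := S.hβ
  have hd := S.hd
  have he := S.he
  have hR := S.hR
  have hc₂ := S.hc₂
  obtain ⟨t5, ht5, H5⟩ := near_T (T := T) (ε := α * η1 / 4) (c := c₂ * 2 ^ (α + 1))
    (by positivity) (by positivity) (α := α + 1) (by linarith)
  obtain ⟨t6, ht6, H6⟩ := near_T (T := T) (ε := β * η1 / 4) (c := c₂ * 2 ^ (β + 1))
    (by positivity) (by positivity) (α := β + 1) (by linarith)
  refine ⟨max (T / 2) (max t5 t6), ⟨lt_max_of_lt_left (by linarith [S.hT]),
    max_lt (by linarith [S.hT]) (max_lt ht5 ht6)⟩, ?_⟩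
  intro t0 ht0 hb0
  have m := ht0.1
  simp only [max_le_iff] at m
  obtain ⟨m0, m5, m6⟩ := m
  have ht0T : t0 < T := ht0.2
  have ht00 : 0 < t0 := by linarith [S.hT]
  have hτ0 : 0 < T - t0 := by linarith
  set ε := min ((T - t0) / R ^ 2) (1 / (8 * (d + e) * (α + β + 1))) with hεd
  have hε : 0 < ε := lt_min (by positivity) (by positivity)
  have hε1 : ε * R ^ 2 ≤ T - t0 := by
    have := min_le_left ((T - t0) / R ^ 2) (1 / (8 * (d + e) * (α + β + 1)))
    rwa [← hεd, le_div_iff₀ (by positivity)] at this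
  have hε2 : ε * (8 * (d + e) * (α + β + 1)) ≤ 1 := by
    have := min_le_right ((T - t0) / R ^ 2) (1 / (8 * (d + e) * (α + β + 1)))
    rwa [← hεd, le_div_iff₀ (by positivity)] at this
  have hε3 : 8 * d * ε * (α + 1) ≤ 1 := by
    have : d * (α + 1) ≤ (d + e) * (α + β + 1) := mul_le_mul (by linarith) (by linarith) (by linarith) (by linarith)
    have := mul_le_mul_of_nonneg_left this hε.le
    linarith
  have hε4 : 8 * e * ε * (β + 1) ≤ 1 := by
    have : e * (β + 1) ≤ (d + e) * (α + β + 1) := mul_le_mul (by linarith) (by linarith) (by linarith) (by linarith)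
    have := mul_le_mul_of_nonneg_left this hε.le
    linarith
  have hsp : ∀ {t x : ℝ}, t < T → 0 < T - t + ε * (x - b) ^ 2 := fun {t x} ht => by
    have : 0 ≤ ε * (x - b) ^ 2 := by positivity
    linarith
  have hs2 : ∀ {t x : ℝ}, t0 ≤ t → x ∈ Icc b R → T - t + ε * (x - b) ^ 2 ≤ 2 * (T - t0) := by
    intro t x ht hx
    have : (x - b) ^ 2 ≤ R ^ 2 := by
      apply pow_le_pow_left₀ (by linarith [hx.1]); linarith [hx.2]
    have := mul_le_mul_of_nonneg_left this hε.le
    linarith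
  have hs3 : ∀ {t x γ η2: ℝ}, 0 < γ → c₂ * 2 ^ (γ + 1) * (T - t0) ^ (γ + 1) < η2 → t0 ≤ t → t < T →
      x ∈ Icc b R → c₂ * (T - t + ε * (x - b) ^ 2) ^ (γ + 1) < η2 := by
    intro t x γ η2 hγ h ht ht' hx
    refine lt_of_le_of_lt ?_ h
    rw [mul_assoc, ← Real.mul_rpow (by norm_num) hτ0.le]
    exact mul_le_mul_of_nonneg_left (Real.rpow_le_rpow (hsp ht').le (hs2 ht hx) (by linarith)) hc₂.le
  have init : ∀ {x γ : ℝ}, 0 < γ → 2 * η ≤ η1 * 2 ^ (-γ) → x ∈ Icc b R →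
      2 * η * (T - t0) ^ (-γ) ≤ η1 * (T - t0 + ε * (x - b) ^ 2) ^ (-γ) := by
    intro x γ hγ h hx
    have a1 : (2 * (T - t0)) ^ (-γ) ≤ (T - t0 + ε * (x - b) ^ 2) ^ (-γ) :=
      Real.rpow_le_rpow_of_nonpos (hsp ht0T) (hs2 le_rfl hx) (by linarith)
    rw [Real.mul_rpow (by norm_num) hτ0.le] at a1
    have a2 := mul_le_mul_of_nonneg_right h (Real.rpow_nonneg hτ0.le (-γ))
    have a3 := mul_le_mul_of_nonneg_left a1 hη1.le
    linarith
  have bd : ∀ {t γ : ℝ}, 0 < γ → 2 * η ≤ η1 * 2 ^ (-γ) → t < T →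
      2 * η * (T - t) ^ (-γ) ≤ η1 * (T - t + ε * (b - b) ^ 2) ^ (-γ) := by
    intro t γ hγ h ht
    have : (2:ℝ) ^ (-γ) ≤ 1 := Real.rpow_le_one_of_one_le_of_nonpos (by norm_num) (by linarith)
    have : 2 * η ≤ η1 := by nlinarith
    simp only [sub_self, ne_eq, OfNat.ofNat_ne_zero, not_false_eq_true, zero_pow, mul_zero, add_zero]
    exact mul_le_mul_of_nonneg_right this (Real.rpow_nonneg (by linarith) _)
  have cont : ∀ {γ t1 : ℝ}, t1 < T → ContinuousOn (Function.uncurry fun t x =>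
      η1 * (T - t + ε * (x - b) ^ 2) ^ (-γ)) (Icc t0 t1 ×ˢ Icc b R) := by
    intro γ t1 ht1
    apply ContinuousOn.const_mul _ _ |>.congr (fun z hz => rfl)
    apply ContinuousOn.rpow_const (by fun_prop)
    intro z hz
    exact Or.inl (hsp (hz.1.2.trans_lt ht1)).ne'
  have ht00I : t0 ∈ Ico 0 T := ⟨ht00.le, ht0T⟩
  have hbI : b ∈ Icc 0 R := ⟨hb.le, hbR.le⟩
  refine ⟨ε, hε, fun t ht x hx => ?_⟩
  refine S.comp hb ht00 ht.2 (U := fun t x => η1 * (T - t + ε * (x - b) ^ 2) ^ (-α))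
    (V := fun t x => η1 * (T - t + ε * (x - b) ^ 2) ^ (-β)) (cont ht.2) (cont ht.2)
    (fun x hx => ((S.um t0 ht00I hbI ⟨hb.le.trans hx.1, hx.2⟩ hx.1).trans_lt
      (hb0 t0 ⟨le_rfl, ht0T⟩).1).trans_le (init hα h3 hx))
    (fun x hx => ((S.vm t0 ht00I hbI ⟨hb.le.trans hx.1, hx.2⟩ hx.1).trans_lt
      (hb0 t0 ⟨le_rfl, ht0T⟩).2).trans_le (init hβ h4 hx))
    (fun t' ht' => (hb0 t' ⟨ht'.1, ht'.2.trans_lt ht.2⟩).1.trans_le (bd hα h3 (ht'.2.trans_lt ht.2)))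
    (fun t' ht' => (hb0 t' ⟨ht'.1, ht'.2.trans_lt ht.2⟩).2.trans_le (bd hβ h4 (ht'.2.trans_lt ht.2)))
    (fun t' ht' => mul_pos hη1 (Real.rpow_pos_of_pos (hsp (ht'.2.trans_lt ht.2)) _))
    (fun t' ht' => mul_pos hη1 (Real.rpow_pos_of_pos (hsp (ht'.2.trans_lt ht.2)) _))
    (fun t' ht' y hy heq => ?_) (fun t' ht' y hy heq => ?_) t ⟨ht.1, le_rfl⟩ x hx
  · have hsT := ht'.2.trans_lt ht.2
    exact ⟨_, _, _, quad_t (hsp hsT), fun y _ => quad_x (hsp hsT), quad_xx (hsp hsT),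
      quad_super hsT hα hη1 hε S.hβp S.hαr hd hε3 h1
        (hs3 hα (H5 t0 ⟨m5, ht0T⟩) ht'.1.le hsT ⟨hy.1.le, hy.2.le⟩)⟩
  · have hsT := ht'.2.trans_lt ht.2
    exact ⟨_, _, _, quad_t (hsp hsT), fun y _ => quad_x (hsp hsT), quad_xx (hsp hsT),
      quad_super hsT hβ hη1 hε S.hαq S.hβs he hε4 h2
        (hs3 hβ (H6 t0 ⟨m6, ht0T⟩) ht'.1.le hsT ⟨hy.1.le, hy.2.le⟩)⟩

end SPB

namespace SPB
variable {k R p q r s α β d e c₁ c₂ T : ℝ} {F G : ℝ → ℝ → ℝ} {u v : ℝ → ℝ → ℝ}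

lemma ev_pow (c : ℝ) {γ ε : ℝ} (hγ : 0 < γ) (hε : 0 < ε) :
    ∀ᶠ y in nhdsWithin (0:ℝ) (Ioi 0), c * y ^ γ ≤ ε := by
  have h : ContinuousAt (fun y : ℝ => c * y ^ γ) 0 :=
    continuousAt_const.mul (Real.continuousAt_rpow_const 0 γ (Or.inr hγ.le))
  have h2 : Tendsto (fun y : ℝ => c * y ^ γ) (nhds 0) (nhds 0) := by
    have := h.tendsto
    simpa [Real.zero_rpow hγ.ne'] using this
  exact (h2.eventually_le_const hε).filter_mono nhdsWithin_le_nhds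

lemma Sys.local_bdd (S : Sys k R p q r s α β d e c₁ c₂ T F G u v) {a b : ℝ} (ha : 0 < a)
    (hab : a < b) (hbR : b < R) :
    ∃ η > 0, ∃ t' ∈ Ioo 0 T, ∀ t0 ∈ Ico t' T, u t0 a < η * (T - t0) ^ (-α) →
      v t0 a < η * (T - t0) ^ (-β) → ∃ C, ∀ t ∈ Ioo 0 T, u t b + v t b ≤ C := by
  have hα := S.hα
  have hβ := S.hβ
  have hc₂ := S.hc₂
  have pos : ∀ᶠ y in nhdsWithin (0:ℝ) (Ioi 0), 0 < y := self_mem_nhdsWithin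
  obtain ⟨η1, ⟨⟨⟨⟨f1, f2⟩, f3⟩, f4⟩, hη1⟩⟩ := (((((ev_pow c₂ (sub_pos.2 S.hp) (by positivity : 0 < α / 8)).and
    (ev_pow c₂ (sub_pos.2 S.hr) (by positivity : 0 < α / 8))).and
    (ev_pow c₂ (sub_pos.2 S.hq) (by positivity : 0 < β / 8))).and
    (ev_pow c₂ (sub_pos.2 S.hs) (by positivity : 0 < β / 8))).and pos).exists
  have pw : ∀ z : ℝ, η1 ^ z = η1 ^ (z - 1) * η1 := fun z => by
    rw [← Real.rpow_add_one hη1.ne']; congr 1; ring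
  have A1 : c₂ * (η1 ^ p + η1 ^ r) ≤ α * η1 / 4 := by
    rw [pw p, pw r]
    have a1 := mul_le_mul_of_nonneg_right f1 hη1.le
    have a2 := mul_le_mul_of_nonneg_right f2 hη1.le
    linarith
  have A2 : c₂ * (η1 ^ q + η1 ^ s) ≤ β * η1 / 4 := by
    rw [pw q, pw s]
    have a1 := mul_le_mul_of_nonneg_right f3 hη1.le
    have a2 := mul_le_mul_of_nonneg_right f4 hη1.le
    linarith
  have t1 : ∀ {γ ε : ℝ}, 0 < γ → 0 < ε → ∀ᶠ y in nhdsWithin (0:ℝ) (Ioi 0), c₂ * (2 * y) ^ γ ≤ ε := by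
    intro γ ε hγ hε
    filter_upwards [ev_pow (c₂ * 2 ^ γ) hγ hε, pos] with y hy hy0
    rw [Real.mul_rpow (by norm_num) hy0.le]; linarith
  obtain ⟨η, ⟨⟨⟨⟨⟨⟨g1, g2⟩, g3⟩, g4⟩, g5⟩, g6⟩, hη⟩⟩ := (((((((t1 (sub_pos.2 S.hp) (by positivity : 0 < α / 8)).and
    (t1 (sub_pos.2 S.hr) (by positivity : 0 < α / 8))).and
    (t1 (sub_pos.2 S.hq) (by positivity : 0 < β / 8))).and
    (t1 (sub_pos.2 S.hs) (by positivity : 0 < β / 8))).and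
    (ev_pow 2 one_pos (by positivity : 0 < η1 * 2 ^ (-α)))).and
    (ev_pow 2 one_pos (by positivity : 0 < η1 * 2 ^ (-β)))).and pos).exists
  rw [Real.rpow_one] at g5 g6
  obtain ⟨ta, hta, HA⟩ := S.small ha (by linarith : a < (a + b) / 2) (by linarith) hη g1 g2 g3 g4
  obtain ⟨tb, htb, HB⟩ := S.quad (b := (a + b) / 2) (by linarith) (by linarith) hη hη1 A1 A2 g5 g6
  refine ⟨η, hη, max ta tb, ⟨lt_max_of_lt_left hta.1, max_lt hta.2 htb.2⟩, fun t0 ht0 h1 h2 => ?_⟩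
  obtain ⟨ε, hε, H⟩ := HB t0 ⟨(le_max_right _ _).trans ht0.1, ht0.2⟩
    (fun t ht => HA t0 ⟨(le_max_left _ _).trans ht0.1, ht0.2⟩ h1 h2 t ht _ ⟨le_rfl, by linarith⟩)
  have hbI : b ∈ Icc 0 R := ⟨by linarith, hbR.le⟩
  have ct : ContinuousOn (fun t => u t b + v t b) (Icc 0 t0) := by
    have m : MapsTo (fun t : ℝ => (t, b)) (Icc 0 t0) (Ico 0 T ×ˢ Icc 0 R) :=
      fun t ht => ⟨⟨ht.1, ht.2.trans_lt ht0.2⟩, hbI⟩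
    exact (S.uc.comp (by fun_prop) m).add (S.vc.comp (by fun_prop) m)
  obtain ⟨M, hM⟩ := isCompact_Icc.bddAbove_image ct
  refine ⟨max M (η1 * (ε * (b - (a + b) / 2) ^ 2) ^ (-α) + η1 * (ε * (b - (a + b) / 2) ^ 2) ^ (-β)),
    fun t ht => ?_⟩
  rcases le_total t t0 with h | h
  · exact (hM ⟨t, ⟨ht.1.le, h⟩, rfl⟩).trans (le_max_left _ _)
  · refine le_trans ?_ (le_max_right _ _)
    have hz : 0 < ε * (b - (a + b) / 2) ^ 2 := by
      have : b - (a + b) / 2 ≠ 0 := by intro h; linarith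
      positivity
    have := H t ⟨h, ht.2⟩ b ⟨by linarith, hbR.le⟩
    have B : ∀ γ : ℝ, 0 < γ → η1 * (T - t + ε * (b - (a + b) / 2) ^ 2) ^ (-γ) ≤
        η1 * (ε * (b - (a + b) / 2) ^ 2) ^ (-γ) := fun γ hγ =>
      mul_le_mul_of_nonneg_left (Real.rpow_le_rpow_of_nonpos hz (by linarith [ht.2]) (by linarith)) hη1.le
    linarith [B α hα, B β hβ, this.1, this.2]

lemma Sys.nondeg (S : Sys k R p q r s α β d e c₁ c₂ T F G u v) {ρ ρ1 : ℝ} (hρ : 0 < ρ)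
    (hρ1 : ρ < ρ1) (hR1 : ρ1 < R) (hB : ¬ ∃ C, ∀ t ∈ Ioo 0 T, u t ρ1 + v t ρ1 ≤ C) :
    ∃ κ > 0, ∃ t' ∈ Ioo 0 T, ∀ t ∈ Ico t' T, κ * (T - t) ^ (-α) ≤ u t ρ := by
  have hα := S.hα
  have hβ := S.hβ
  have hc₁ := S.hc₁
  set l := min (ρ / 2) ((ρ1 - ρ) / 4) with hl
  have hl0 : 0 < l := lt_min (by linarith) (by linarith)
  have hl1 : l ≤ ρ / 2 := min_le_left _ _
  have hl2 : l ≤ (ρ1 - ρ) / 4 := min_le_right _ _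
  obtain ⟨η, hη, t', ht', H⟩ := S.local_bdd (a := ρ + 2 * l) (b := ρ1) (by linarith) (by linarith) hR1
  obtain ⟨ν1, hν1, H1⟩ := S.transfer (a := ρ / 2) (by linarith)
  obtain ⟨ν2, hν2, H2⟩ := S.swap.transfer (a := ρ / 2) (by linarith)
  set κ1 := Real.exp (-1) * (η * 2 ^ (-α)) with hκ1
  set κ2 := Real.exp (-1) * c₁ * (Real.exp (-1) * (η * 2 ^ (-β))) ^ p with hκ2
  set m := min ((T - t') / 2) (min (ν1 * l ^ 2) (ν2 * l ^ 2)) with hm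
  have hm0 : 0 < m := lt_min (by linarith [ht'.2]) (lt_min (by positivity) (by positivity))
  have hm1 : m ≤ (T - t') / 2 := min_le_left _ _
  have hm2 : m ≤ ν1 * l ^ 2 := (min_le_right _ _).trans (min_le_left _ _)
  have hm3 : m ≤ ν2 * l ^ 2 := (min_le_right _ _).trans (min_le_right _ _)
  refine ⟨min κ1 κ2, lt_min (by positivity) (by positivity), T - m,
    ⟨by linarith [ht'.1, ht'.2], by linarith⟩, fun t ht => ?_⟩
  set τ := T - t with hτ
  have hτ0 : 0 < τ := by linarith [ht.2]
  have hτm : τ ≤ m := by linarith [ht.1]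
  have et : T - (t - τ) = 2 * τ := by rw [hτ]; ring
  have ht1 : t - τ ∈ Ico t' T := ⟨by linarith, by linarith⟩
  have ht10 : 0 < t - τ := ht'.1.trans_le ht1.1
  have htI : t ∈ Ico 0 T := ⟨by linarith, ht.2⟩
  have hP : 0 < τ ^ (-α) := by positivity
  have e2 : ∀ γ : ℝ, (2 * τ) ^ (-γ) = 2 ^ (-γ) * τ ^ (-γ) := fun γ =>
    Real.mul_rpow (by norm_num) hτ0.le
  by_cases hu : u (t - τ) (ρ + 2 * l) < η * (T - (t - τ)) ^ (-α)
  · by_cases hv : v (t - τ) (ρ + 2 * l) < η * (T - (t - τ)) ^ (-β)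
    · exact absurd (H _ ht1 hu hv) hB
    · have := (H2 l ⟨hl0, hl1⟩ ρ (by linarith) (by linarith) (t - τ) τ ht10 hτ0 (by linarith)
        (by linarith [ht.2]) (η * (T - (t - τ)) ^ (-β)) (by rw [et]; positivity) (not_lt.1 hv)).2
      rw [sub_add_cancel, et, e2] at this
      refine le_trans ?_ this
      have a1 : (Real.exp (-1) * (η * (2 ^ (-β) * τ ^ (-β)))) ^ p
          = (Real.exp (-1) * (η * 2 ^ (-β))) ^ p * (τ ^ (-α) / τ) := by
        rw [mul_comm _ (τ ^ (-α) / τ), ← rpow_bar hτ0 (by positivity) S.hβp]; congr 1; ring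
      rw [a1]
      have a2 : Real.exp (-1) * c₁ * ((Real.exp (-1) * (η * 2 ^ (-β))) ^ p * (τ ^ (-α) / τ)) * τ
        = κ2 * τ ^ (-α) := by rw [hκ2]; field_simp
      rw [a2]
      exact mul_le_mul_of_nonneg_right (min_le_right _ _) hP.le
  · have := (H1 l ⟨hl0, hl1⟩ ρ (by linarith) (by linarith) (t - τ) τ ht10 hτ0 (by linarith)
        (by linarith [ht.2]) (η * (T - (t - τ)) ^ (-α)) (by rw [et]; positivity) (not_lt.1 hu)).1
        t ⟨by linarith, by linarith⟩
    rw [et, e2] at this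
    have h3 := S.um t htI ⟨hρ.le, by linarith⟩ ⟨by linarith, by linarith⟩ (by linarith : ρ ≤ ρ + l)
    refine le_trans ?_ (this.trans h3)
    have : Real.exp (-1) * (η * (2 ^ (-α) * τ ^ (-α))) = κ1 * τ ^ (-α) := by rw [hκ1]; ring
    rw [this]
    exact mul_le_mul_of_nonneg_right (min_le_left _ _) hP.le

end SPB

namespace SPB
variable {k R p q r s α β d e c₁ c₂ T : ℝ} {F G : ℝ → ℝ → ℝ} {u v : ℝ → ℝ → ℝ}

lemma two_pt {φ ψ χ : ℝ → ℝ} {a b x y : ℝ} (hax : a ≤ x) (hxy : x < y) (hyb : y ≤ b)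
    (hd : ∀ z ∈ Icc a b, HasDerivAt φ (ψ z) z) (hD : ∀ z ∈ Icc a b, HasDerivAt ψ (χ z) z)
    (hmin : ∀ z w, a ≤ z → z ≤ w → w ≤ b → φ x - φ y ≤ φ z - φ w) (ha : ψ a ≤ 0) (hb : ψ b ≤ 0) :
    ψ x = 0 ∧ ψ y = 0 ∧ 0 ≤ χ x ∧ χ y ≤ 0 := by
  have h1 := min_cond (φ := φ) (ψ := ψ) (x := x) (a := a) (b := y) (D := χ x) (by linarith)
    ⟨hax, hxy.le⟩ (fun z hz => hd z ⟨hz.1, hz.2.trans hyb⟩) (hD x ⟨hax, hxy.le.trans hyb⟩)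
    (fun z hz => by linarith [hmin z y hz.1 hz.2 hyb]) (fun _ => ha) (fun h => absurd h hxy.ne)
  have h2 := min_cond (φ := fun z => -φ z) (ψ := fun z => -ψ z) (x := y) (a := x) (b := b)
    (D := -χ y) (by linarith)
    ⟨hxy.le, hyb⟩ (fun z hz => (hd z ⟨hax.trans hz.1, hz.2⟩).neg) (hD y ⟨hax.trans hxy.le, hyb⟩).neg
    (fun z hz => by linarith [hmin x z hax hz.1 hz.2]) (fun h => absurd h hxy.ne')
    (fun _ => by linarith)
  exact ⟨h1.1, by linarith [h2.1], h1.2, by linarith [h2.2]⟩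

lemma tri_compact (a b : ℝ) : IsCompact {z : ℝ × ℝ | a ≤ z.1 ∧ z.1 ≤ z.2 ∧ z.2 ≤ b} := by
  apply (isCompact_Icc (a := a) (b := b)).prod (isCompact_Icc (a := a) (b := b)) |>.of_isClosed_subset
  · have h1 : IsClosed {z : ℝ × ℝ | a ≤ z.1} := isClosed_le (by fun_prop) (by fun_prop)
    have h2 : IsClosed {z : ℝ × ℝ | z.1 ≤ z.2} := isClosed_le (by fun_prop) (by fun_prop)
    have h3 : IsClosed {z : ℝ × ℝ | z.2 ≤ b} := isClosed_le (by fun_prop) (by fun_prop)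
    exact h1.inter (h2.inter h3)
  · rintro ⟨x, y⟩ ⟨h1, h2, h3⟩
    exact ⟨⟨h1, h2.trans h3⟩, h1.trans h2, h3⟩

lemma Sys.F_diff_v (S : Sys k R p q r s α β d e c₁ c₂ T F G u v) (a b : ℝ) :
    DifferentiableAt ℝ (fun y => F a y) b := by
  have h := (S.FC.differentiable one_ne_zero) (a, b)
  exact h.comp b (by fun_prop : DifferentiableAt ℝ (fun y : ℝ => (a, y)) b)

lemma Sys.F_diff_u (S : Sys k R p q r s α β d e c₁ c₂ T F G u v) (a b : ℝ) :
    DifferentiableAt ℝ (fun x => F x b) a := by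
  have h := (S.FC.differentiable one_ne_zero) (a, b)
  exact h.comp a (by fun_prop : DifferentiableAt ℝ (fun x : ℝ => (x, b)) a)

lemma Sys.F_mono (S : Sys k R p q r s α β d e c₁ c₂ T F G u v) {a b b' : ℝ} (ha : 0 ≤ a)
    (hb : 0 ≤ b) (hbb : b ≤ b') : F a b ≤ F a b' := by
  have : MonotoneOn (fun y => F a y) (Ici 0) := by
    apply monotoneOn_of_deriv_nonneg (convex_Ici 0)
    · exact fun y _ => (S.F_diff_v a y).continuousAt.continuousWithinAt
    · exact fun y _ => (S.F_diff_v a y).differentiableWithinAt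
    · intro y hy
      rw [interior_Ici] at hy
      exact S.Fv a y ha (le_of_lt hy)
  exact this hb (hb.trans hbb) hbb

lemma Sys.F_lip (S : Sys k R p q r s α β d e c₁ c₂ T F G u v) (M : ℝ) :
    ∃ L ≥ 0, ∀ x ∈ Icc 0 M, ∀ y ∈ Icc 0 M, ∀ w ∈ Icc 0 M, |F x w - F y w| ≤ L * |x - y| := by
  have hc : Continuous fun z : ℝ × ℝ => fderiv ℝ (Function.uncurry F) z :=
    S.FC.continuous_fderiv one_ne_zero
  obtain ⟨L, hL⟩ := ((isCompact_Icc (a := (0:ℝ)) (b := M)).prod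
    (isCompact_Icc (a := (0:ℝ)) (b := M))).bddAbove_image hc.norm.continuousOn
  refine ⟨max L 0, le_max_right _ _, fun x hx y hy w hw => ?_⟩
  have h := ((convex_Icc (0:ℝ) M).prod (convex_Icc (0:ℝ) M)).norm_image_sub_le_of_norm_fderiv_le
    (f := Function.uncurry F) (C := max L 0)
    (fun z _ => S.FC.differentiable one_ne_zero z)
    (fun z hz => (hL ⟨z, hz, rfl⟩).trans (le_max_left _ _)) (x := (y, w)) (y := (x, w)) ⟨hy, hw⟩ ⟨hx, hw⟩
  have e : ‖((x, w) - (y, w) : ℝ × ℝ)‖ = |x - y| := by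
    simp [Prod.norm_def]
  rw [e] at h
  exact h

set_option maxHeartbeats 1000000 in
lemma Sys.hopf_path (S : Sys k R p q r s α β d e c₁ c₂ T F G u v) {a b l L M m0 Λ ω ξ0 t1 t0 : ℝ}
    (ha : 0 < a) (hab : a < b) (hbR : b < R) (ht1 : 0 < t1) (ht : t1 < t0) (ht0 : t0 < T) (hl : 0 < l)
    (hm0 : 0 < m0) (hξ : ∀ t ∈ Icc t1 t0, a + l ≤ ξ0 + ω * (t - t1) ∧ ξ0 + ω * (t - t1) + l ≤ b)
    (hL0 : 0 ≤ L)
    (hL : ∀ x ∈ Icc 0 M, ∀ y ∈ Icc 0 M, ∀ w ∈ Icc 0 M, |F x w - F y w| ≤ L * |x - y|)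
    (hu : ∀ t ∈ Icc t1 t0, ∀ x ∈ Icc a b, u t x ≤ M) (hv : ∀ t ∈ Icc t1 t0, ∀ x ∈ Icc a b, v t x ≤ M)
    (hmono : ∀ ξ, MonotoneOn (fun x => chi1 ((x - ξ) / l) / l + k / x * chi ((x - ξ) / l)
        + (ω / d) * chi ((x - ξ) / l) + ((Λ - L) / d) * (l * Psi ((x - ξ) / l))) (Ici a))
    (hinit : ∀ x ∈ Icc a b, |x - ξ0| < l → deriv (u t1) x ≤ -m0) :
    deriv (u t0) (ξ0 + ω * (t0 - t1)) ≤ -(m0 * Real.exp (-Λ * (t0 - t1))) := by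
  have hd := S.hd
  have hk := S.hk
  set E : ℝ → ℝ := fun t => m0 * Real.exp (-Λ * (t - t1)) with hE
  have hE0 : ∀ t, 0 < E t := fun t => by simp only [hE]; positivity
  have hEd : ∀ t, HasDerivAt E (-Λ * E t) t := by
    intro t
    have : HasDerivAt (fun t => -Λ * (t - t1)) (-Λ) t := by
      simpa using ((hasDerivAt_id t).sub_const t1).const_mul (-Λ)
    refine (this.exp.const_mul m0).congr_deriv ?_
    simp only [hE]; ring
  set ξ : ℝ → ℝ := fun t => ξ0 + ω * (t - t1) with hξd
  have hξD : ∀ t, HasDerivAt ξ ω t := by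
    intro t
    have h := (((hasDerivAt_id t).sub_const t1).const_mul ω).const_add ξ0
    rw [mul_one] at h
    exact h
  set W : ℝ → ℝ → ℝ := fun t x => E t * (l * Psi ((x - ξ t) / l)) with hW
  have hIo : ∀ x ∈ Icc a b, x ∈ Ioo 0 R := fun x hx => ⟨ha.trans_le hx.1, hx.2.trans_lt hbR⟩
  have hWx : ∀ t x, HasDerivAt (W t) (E t * chi ((x - ξ t) / l)) x := by
    intro t x
    refine (((scaled (Psi_deriv ((x - ξ t) / l))).const_mul l).const_mul (E t)).congr_deriv ?_
    field_simp
  have hWxx : ∀ t x, HasDerivAt (fun x => E t * chi ((x - ξ t) / l))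
      (E t * (chi1 ((x - ξ t) / l) / l)) x := fun t x =>
    (scaled (chi_deriv ((x - ξ t) / l))).const_mul (E t)
  have hWt : ∀ t x, HasDerivAt (fun t => W t x)
      (-Λ * W t x - E t * ω * chi ((x - ξ t) / l)) t := by
    intro t x
    have h1 : HasDerivAt (fun t => (x - ξ t) / l) (-ω / l) t := ((hξD t).const_sub x).div_const l
    have h2 := ((Psi_deriv ((x - ξ t) / l)).comp t h1).const_mul l
    refine ((hEd t).mul h2).congr_deriv ?_
    simp only [hW, Function.comp]
    field_simp
    ring
  have hWc : Continuous fun z : ℝ × ℝ => W z.1 z.2 := by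
    have := Psi_cont
    simp only [hW, hE, hξd]; fun_prop
  have chia : ∀ t ∈ Icc t1 t0, chi ((a - ξ t) / l) = 0 := by
    intro t ht
    apply chi_zero
    rw [abs_div, abs_of_pos hl, le_div_iff₀ hl, one_mul]
    rw [abs_sub_comm]
    exact le_trans (by linarith [(hξ t ht).1]) (le_abs_self _)
  have chib : ∀ t ∈ Icc t1 t0, chi ((b - ξ t) / l) = 0 := by
    intro t ht
    apply chi_zero
    rw [abs_div, abs_of_pos hl, le_div_iff₀ hl, one_mul]
    exact le_trans (by linarith [(hξ t ht).2]) (le_abs_self _)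
  have htI : ∀ t ∈ Icc t1 t0, t ∈ Ioo 0 T := fun t h => ⟨ht1.trans_le h.1, h.2.trans_lt ht0⟩
  set K := {z : ℝ × ℝ | a ≤ z.1 ∧ z.1 ≤ z.2 ∧ z.2 ≤ b} with hK
  have main : ∀ θ > 0, ∀ x y, a ≤ x → x ≤ y → y ≤ b →
      0 ≤ (u t0 x + W t0 x) - (u t0 y + W t0 y) + θ * (1 + (t0 - t1)) := by
    intro θ hθ
    set f : ℝ → ℝ × ℝ → ℝ := fun t z => (u t z.1 + W t z.1) - (u t z.2 + W t z.2)
      + θ * (1 + (t - t1)) with hf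
    have hfc : ContinuousOn (Function.uncurry f) (Icc t1 t0 ×ˢ K) := by
      have h1 : ContinuousOn (fun z : ℝ × ℝ × ℝ => u z.1 z.2.1) (Icc t1 t0 ×ˢ K) := by
        apply S.uc.comp (f := fun z : ℝ × ℝ × ℝ => (z.1, z.2.1)) (by fun_prop)
        rintro ⟨t, x, y⟩ ⟨h1, h2, h3, h4⟩
        have h5 := htI t h1
        have h6 := hIo x ⟨h2, h3.trans h4⟩
        exact ⟨⟨h5.1.le, h5.2⟩, h6.1.le, h6.2.le⟩
      have h2 : ContinuousOn (fun z : ℝ × ℝ × ℝ => u z.1 z.2.2) (Icc t1 t0 ×ˢ K) := by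
        apply S.uc.comp (f := fun z : ℝ × ℝ × ℝ => (z.1, z.2.2)) (by fun_prop)
        rintro ⟨t, x, y⟩ ⟨h1, h2, h3, h4⟩
        have h5 := htI t h1
        have h6 := hIo y ⟨h2.trans h3, h4⟩
        exact ⟨⟨h5.1.le, h5.2⟩, h6.1.le, h6.2.le⟩
      have h3 : Continuous (fun z : ℝ × ℝ × ℝ => W z.1 z.2.1) :=
        hWc.comp (by fun_prop : Continuous fun z : ℝ × ℝ × ℝ => (z.1, z.2.1))
      have h4 : Continuous (fun z : ℝ × ℝ × ℝ => W z.1 z.2.2) :=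
        hWc.comp (by fun_prop : Continuous fun z : ℝ × ℝ × ℝ => (z.1, z.2.2))
      have h5 : Continuous fun z : ℝ × ℝ × ℝ => θ * (1 + (z.1 - t1)) := by fun_prop
      exact ((h1.add h3.continuousOn).sub (h2.add h4.continuousOn)).add h5.continuousOn
    have f0 : ∀ z ∈ K, 0 < f t1 z := by
      rintro ⟨x, y⟩ ⟨h1, h2, h3⟩
      have h1m : t1 ∈ Icc t1 t0 := ⟨le_rfl, ht.le⟩
      have anti : AntitoneOn (fun x => u t1 x + W t1 x) (Icc a b) := by
        have hD : ∀ x ∈ Icc a b, HasDerivAt (fun x => u t1 x + W t1 x)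
            (deriv (u t1) x + E t1 * chi ((x - ξ t1) / l)) x := fun x hx =>
          (S.ux t1 (htI t1 h1m) x (hIo x hx)).add (hWx t1 x)
        apply antitoneOn_of_deriv_nonpos (convex_Icc a b)
        · exact fun x hx => (hD x hx).continuousAt.continuousWithinAt
        · exact fun x hx => (hD x (interior_subset hx)).differentiableAt.differentiableWithinAt
        · intro x hx
          have hx := interior_subset hx
          rw [(hD x hx).deriv]
          have e1 : E t1 = m0 := by simp [hE]
          have e2 : ξ t1 = ξ0 := by simp [hξd]
          rw [e1, e2]
          by_cases h : |x - ξ0| < l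
          · have := hinit x hx h
            have := chi_le_one ((x - ξ0) / l)
            nlinarith
          · have : chi ((x - ξ0) / l) = 0 := by
              apply chi_zero
              rw [abs_div, abs_of_pos hl, le_div_iff₀ hl]; linarith
            rw [this]
            linarith [S.ux_nonpos (htI t1 h1m) (hIo x hx)]
      have := anti ⟨h1, h2.trans h3⟩ ⟨h1.trans h2, h3⟩ h2
      simp only [hf, sub_self, add_zero, mul_one]
      simp only at this
      linarith
    have step : ∀ t ∈ Ioc t1 t0, ∀ z ∈ K, (∀ s ∈ Icc t1 t, ∀ y ∈ K, 0 ≤ f s y) →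
        (∀ s ∈ Icc t1 t, ∀ y ∈ K, 0 ≤ f s y) → f t z = 0 → False := by
      rintro t htt ⟨x, y⟩ ⟨h1, h2, h3⟩ hpos _ h0
      have htc : t ∈ Icc t1 t0 := ⟨htt.1.le, htt.2⟩
      have htT := htI t htc
      simp only at h1 h2 h3
      have hθt : 0 < θ * (1 + (t - t1)) := by
        have : 0 < 1 + (t - t1) := by linarith [htt.1]
        positivity
      have hxy : x < y := by
        rcases h2.lt_or_eq with h | h
        · exact h
        · subst h
          simp only [hf, sub_self, zero_add] at h0
          linarith
      have hxab : x ∈ Icc a b := ⟨h1, h2.trans h3⟩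
      have hyab : y ∈ Icc a b := ⟨h1.trans h2, h3⟩
      have hx0 := hIo x hxab
      have hy0 := hIo y hyab
      obtain ⟨g1, g2, g3, g4⟩ := two_pt (φ := fun x => u t x + W t x)
        (ψ := fun x => deriv (u t) x + E t * chi ((x - ξ t) / l))
        (χ := fun x => deriv (deriv (u t)) x + E t * (chi1 ((x - ξ t) / l) / l)) h1 hxy h3
        (fun z hz => (S.ux t htT z (hIo z hz)).add (hWx t z))
        (fun z hz => (S.uxx t htT z (hIo z hz)).add (hWxx t z))
        (fun z w hz hzw hw => by
          have := hpos t ⟨htt.1.le, le_rfl⟩ (z, w) ⟨hz, hzw, hw⟩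
          simp only [hf] at this h0
          linarith)
        (by rw [chia t htc]; linarith [S.ux_nonpos htT (hIo a ⟨le_rfl, hab.le⟩)])
        (by rw [chib t htc]; linarith [S.ux_nonpos htT (hIo b ⟨hab.le, le_rfl⟩)])
      have hθD : HasDerivAt (fun t => θ * (1 + (t - t1))) θ t := by
        simpa using (((hasDerivAt_id t).sub_const t1).const_add 1).const_mul θ
      have g5 := time_cond (φ := fun t => f t (x, y)) htt.1
        ((((S.ut t htT x hx0).add (hWt t x)).sub ((S.ut t htT y hy0).add (hWt t y))).add hθD) h0
        (fun s hs => hpos s hs (x, y) ⟨h1, h2, h3⟩)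
      have htI' : t ∈ Ico 0 T := ⟨htT.1.le, htT.2⟩
      have hxR : x ∈ Icc 0 R := ⟨hx0.1.le, hx0.2.le⟩
      have hyR : y ∈ Icc 0 R := ⟨hy0.1.le, hy0.2.le⟩
      have hux := S.un t htI' x hxR
      have huy := S.un t htI' y hyR
      have hvx := S.vn t htI' x hxR
      have hvy := S.vn t htI' y hyR
      have hvm := S.vm t htI' hxR hyR h2
      have hum := S.um t htI' hxR hyR h2
      have k1 := S.F_mono hux hvy hvm
      have k2 := hL _ ⟨hux, hu t htc x hxab⟩ _ ⟨huy, hu t htc y hyab⟩ _ ⟨hvy, hv t htc y hyab⟩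
      rw [abs_of_nonneg (sub_nonneg.2 hum)] at k2
      have k3 := neg_abs_le (F (u t x) (v t y) - F (u t y) (v t y))
      have k4 : u t x - u t y ≤ W t y - W t x := by
        simp only [hf] at h0; linarith
      have k5 := mul_le_mul_of_nonneg_left k4 hL0
      have k6 := hmono (ξ t) h1 (h1.trans h2) h2
      have k7 := mul_le_mul_of_nonneg_left k6 (mul_pos hd (hE0 t)).le
      have exp1 : ∀ z, d * E t * (chi1 ((z - ξ t) / l) / l + k / z * chi ((z - ξ t) / l)
        + (ω / d) * chi ((z - ξ t) / l) + ((Λ - L) / d) * (l * Psi ((z - ξ t) / l)))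
        = d * (E t * (chi1 ((z - ξ t) / l) / l)) + d * (k / z * (E t * chi ((z - ξ t) / l)))
          + E t * ω * chi ((z - ξ t) / l) + (Λ - L) * W t z := by
        intro z
        simp only [hW]
        field_simp
      rw [exp1, exp1] at k7
      have l1 : deriv (u t) x = -(E t * chi ((x - ξ t) / l)) := by linarith
      have l2 : deriv (u t) y = -(E t * chi ((y - ξ t) / l)) := by linarith
      rw [l1, l2] at g5
      have l3 := mul_le_mul_of_nonneg_left g3 hd.le
      have l4 := mul_le_mul_of_nonneg_left g4 hd.le
      linarith
    have T1 := touch (tri_compact a b) f f hfc hfc f0 f0 step step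
    intro x y hx hxy hy
    exact (T1 t0 ⟨ht.le, le_rfl⟩ (x, y) ⟨hx, hxy, hy⟩).1.le
  have anti : AntitoneOn (fun x => u t0 x + W t0 x) (Icc a b) := by
    intro x hx y hy hxy
    apply le_of_forall_pos_le_add
    intro ε hε
    have h1 : 0 < 1 + (t0 - t1) := by linarith
    have := main (ε / (1 + (t0 - t1))) (by positivity) x y hx.1 hxy hy.2
    rw [div_mul_cancel₀ _ h1.ne'] at this
    simp only
    linarith
  have h0m : t0 ∈ Icc t1 t0 := ⟨ht.le, le_rfl⟩
  have hc := hξ t0 h0m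
  have hin : ξ t0 ∈ Ioo a b := ⟨by simp only [hξd]; linarith, by simp only [hξd]; linarith⟩
  have hD := (S.ux t0 (htI t0 h0m) (ξ t0) (hIo _ ⟨hin.1.le, hin.2.le⟩)).add (hWx t0 (ξ t0))
  rw [sub_self, zero_div, chi_at_zero, mul_one] at hD
  have h1 : derivWithin (fun x => u t0 x + W t0 x) (Icc a b) (ξ t0) ≤ 0 := anti.derivWithin_nonpos
  rw [derivWithin_of_mem_nhds (Icc_mem_nhds hin.1 hin.2)] at h1
  have h2 : deriv (fun x => u t0 x + W t0 x) (ξ t0) = _ := hD.deriv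
  rw [h2] at h1
  simp only [hE] at h1
  linarith

end SPB

namespace SPB
variable {k R p q r s α β d e c₁ c₂ T : ℝ} {F G : ℝ → ℝ → ℝ} {u v : ℝ → ℝ → ℝ}

lemma Sys.u_bdd (S : Sys k R p q r s α β d e c₁ c₂ T F G u v) {t1 t0 : ℝ} (ht1 : 0 ≤ t1) (ht0 : t0 < T) :
    ∃ M, ∀ t ∈ Icc t1 t0, ∀ x ∈ Icc 0 R, u t x ≤ M := by
  have hc : ContinuousOn (Function.uncurry u) (Icc t1 t0 ×ˢ Icc 0 R) := S.uc.mono (by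
    rintro ⟨t, x⟩ ⟨h1, h2⟩
    exact ⟨⟨ht1.trans h1.1, h1.2.trans_lt ht0⟩, h2⟩)
  obtain ⟨M, hM⟩ := (isCompact_Icc.prod isCompact_Icc).bddAbove_image hc
  exact ⟨M, fun t ht x hx => hM ⟨(t, x), ⟨ht, hx⟩, rfl⟩⟩

lemma Sys.hopf (S : Sys k R p q r s α β d e c₁ c₂ T F G u v) {a b t1 t0 : ℝ} (ha : 0 < a)
    (hab : a ≤ b) (hbR : b < R) (ht1 : 0 < t1) (ht : t1 < t0) (ht0 : t0 < T) (hpos : 0 < u t1 a) :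
    ∃ m > 0, ∀ x ∈ Icc a b, deriv (u t0) x ≤ -m := by
  have hd := S.hd
  have ht1T : t1 ∈ Ioo 0 T := ⟨ht1, ht.trans ht0⟩
  have hcR : ContinuousOn (u t1) (Icc a R) :=
    S.uc.comp (f := fun x => (t1, x)) (by fun_prop) (fun x hx => ⟨⟨ht1.le, ht1T.2⟩, ha.le.trans hx.1, hx.2⟩)
  obtain ⟨xs, hxs, hsl⟩ := exists_hasDerivAt_eq_slope (u t1) (deriv (u t1)) (hab.trans_lt hbR) hcR
    (fun x hx => S.ux t1 ht1T x ⟨ha.trans hx.1, hx.2⟩)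
  rw [S.ub t1 ht1T] at hsl
  have hneg : deriv (u t1) xs < 0 := by
    rw [hsl]; apply div_neg_of_neg_of_pos <;> linarith
  set m0 := -deriv (u t1) xs / 2 with hm0
  have hm00 : 0 < m0 := by linarith
  have hxR : xs ∈ Ioo 0 R := ⟨ha.trans hxs.1, hxs.2⟩
  have hev := (S.uxx t1 ht1T xs hxR).continuousAt.eventually_lt_const (by linarith : deriv (u t1) xs < -m0)
  obtain ⟨l0, hl0, hl0'⟩ := Metric.eventually_nhds_iff.1 hev
  set X := max b xs with hX
  have hXR : X < R := max_lt hbR hxs.2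
  have hbX : b ≤ X := le_max_left _ _
  have hxX : xs ≤ X := le_max_right _ _
  set l := min l0 (min (a / 2) ((R - X) / 2)) with hl
  have hlp : 0 < l := lt_min hl0 (lt_min (by linarith) (by linarith))
  have hl1 : l ≤ l0 := min_le_left _ _
  have hl2 : l ≤ a / 2 := (min_le_right _ _).trans (min_le_left _ _)
  have hl3 : l ≤ (R - X) / 2 := (min_le_right _ _).trans (min_le_right _ _)
  have hR := S.hR
  have hΔ : 0 < t0 - t1 := by linarith
  obtain ⟨lam0, hlam0, hmono⟩ := bump_mono hlp (by linarith : 0 < a / 2) S.hk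
    (by positivity : 0 ≤ R / (t0 - t1) / d)
  obtain ⟨M1, hM1⟩ := S.u_bdd ht1.le ht0
  obtain ⟨M2, hM2⟩ := S.swap.u_bdd ht1.le ht0
  obtain ⟨L, hL0, hL⟩ := S.F_lip (max M1 M2)
  refine ⟨m0 * Real.exp (-(L + d * lam0) * (t0 - t1)), by positivity, fun x hx => ?_⟩
  have e1 : xs + (x - xs) / (t0 - t1) * (t0 - t1) = x := by field_simp; ring
  have := S.hopf_path (a := a / 2) (b := (X + R) / 2) (l := l) (L := L) (M := max M1 M2) (m0 := m0)
    (Λ := L + d * lam0) (ω := (x - xs) / (t0 - t1)) (ξ0 := xs) (t1 := t1) (t0 := t0)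
    (by linarith) (by linarith) (by linarith) ht1 ht ht0 hlp hm00 ?_ hL0 hL
    (fun t ht x hx => (hM1 t ht x ⟨by linarith [hx.1], by linarith [hx.2]⟩).trans (le_max_left _ _))
    (fun t ht x hx => (hM2 t ht x ⟨by linarith [hx.1], by linarith [hx.2]⟩).trans (le_max_right _ _))
    ?_ ?_
  · rwa [e1] at this
  · intro t htt
    set lm := (t - t1) / (t0 - t1) with hlm
    have h0 : 0 ≤ lm := div_nonneg (by linarith [htt.1]) hΔ.le
    have h1 : lm ≤ 1 := by rw [hlm, div_le_one hΔ]; linarith [htt.2]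
    have e2 : xs + (x - xs) / (t0 - t1) * (t - t1) = (1 - lm) * xs + lm * x := by
      rw [hlm]; field_simp; ring
    rw [e2]
    have a1 : (1 - lm) * a ≤ (1 - lm) * xs := mul_le_mul_of_nonneg_left hxs.1.le (by linarith)
    have a2 : lm * a ≤ lm * x := mul_le_mul_of_nonneg_left hx.1 h0
    have a3 : (1 - lm) * xs ≤ (1 - lm) * X := mul_le_mul_of_nonneg_left hxX (by linarith)
    have a4 : lm * x ≤ lm * X := mul_le_mul_of_nonneg_left (hx.2.trans hbX) h0
    constructor <;> linarith
  · intro ξ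
    have e3 : (L + d * lam0 - L) / d = lam0 := by field_simp; ring
    rw [e3]
    apply hmono lam0 le_rfl
    rw [abs_div, abs_div, abs_of_pos hd, abs_of_pos hΔ]
    gcongr
    rw [abs_le]
    constructor <;> linarith [hx.1, hx.2, hxR.1, hxR.2]
  · intro y _ hy
    exact (hl0' (by rw [Real.dist_eq]; exact hy.trans_le hl1)).le

end SPB

namespace SPB
variable {k R p q r s α β d e c₁ c₂ T : ℝ} {F G : ℝ → ℝ → ℝ} {u v : ℝ → ℝ → ℝ}

lemma Sys.F_path (S : Sys k R p q r s α β d e c₁ c₂ T F G u v) {f g : ℝ → ℝ} {f' g' w : ℝ}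
    (hf : HasDerivAt f f' w) (hg : HasDerivAt g g' w) :
    HasDerivAt (fun w => F (f w) (g w))
      (f' * deriv (fun x => F x (g w)) (f w) + g' * deriv (fun y => F (f w) y) (g w)) w := by
  have h := (S.FC.differentiable one_ne_zero (f w, g w)).hasFDerivAt
  set Lf := fderiv ℝ (Function.uncurry F) (f w, g w) with hL
  have h1 : HasDerivAt (fun x => F x (g w)) (Lf (1, 0)) (f w) :=
    h.comp_hasDerivAt (f w) (f := fun x => (x, g w)) ((hasDerivAt_id _).prodMk (hasDerivAt_const _ _))
  have h2 : HasDerivAt (fun y => F (f w) y) (Lf (0, 1)) (g w) :=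
    h.comp_hasDerivAt (g w) (f := fun y => (f w, y)) ((hasDerivAt_const _ _).prodMk (hasDerivAt_id _))
  have h3 : HasDerivAt (fun w => F (f w) (g w)) (Lf (f', g')) w :=
    h.comp_hasDerivAt w (f := fun w => (f w, g w)) (hf.prodMk hg)
  rw [h1.deriv, h2.deriv]
  refine h3.congr_deriv ?_
  have : ((f', g') : ℝ × ℝ) = f' • (1, 0) + g' • (0, 1) := by simp
  rw [this, map_add, map_smul, map_smul]
  simp

/-- derivative of `w ↦ (X + E w)^(-1/σ)` -/
lemma inv_path {X E σ w : ℝ} (hσ : 0 < σ) (h : 0 < X + E * w) :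
    HasDerivAt (fun w => (X + E * w) ^ (-σ⁻¹))
      (-(E / σ) * ((X + E * w) ^ (-σ⁻¹) * ((X + E * w) ^ (-σ⁻¹)) ^ σ)) w := by
  have h1 : HasDerivAt (fun w => X + E * w) E w := by
    simpa using ((hasDerivAt_id w).const_mul E).const_add X
  refine (h1.rpow_const (p := -σ⁻¹) (Or.inl h.ne')).congr_deriv ?_
  rw [← Real.rpow_mul h.le, ← Real.rpow_add h]
  have e1 : -σ⁻¹ + -σ⁻¹ * σ = -σ⁻¹ - 1 := by field_simp; ring
  rw [e1]; ring

lemma Sys.react (S : Sys k R p q r s α β d e c₁ c₂ T F G u v) {σ σ' E E' D Γ ul uu vl vu x1 x2 y1 y2 : ℝ}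
    (hσ : 0 < σ) (hσ' : 0 < σ') (hE : 0 < E) (hE' : 0 < E') (hD : 0 ≤ D) (hul : 0 < ul) (hvl : 0 < vl)
    (hΓ : ∀ a b, ul ≤ a → a ≤ uu → vl ≤ b → b ≤ vu → Γ * a ≤ a * deriv (fun x => F x b) a
      - (1 + σ) * F a b + σ * E' / (σ' * E) * (b ^ σ' / a ^ σ) * (b * deriv (fun y => F a y) b))
    (hx1 : x1 ≤ uu) (hy1 : ul ≤ y1) (hx2 : x2 ≤ vu) (hy2 : vl ≤ y2) (hx10 : 0 < x1) (hx20 : 0 < x2)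
    (h1 : y1 ^ (-σ) = x1 ^ (-σ) + E * D) (h2 : x2 ^ (-σ') + E' * D ≤ y2 ^ (-σ')) :
    σ * y1 ^ (-σ - 1) * F y1 y2 ≤ σ * x1 ^ (-σ - 1) * F x1 x2 - E * D * Γ := by
  have hy10 : 0 < y1 := hul.trans_le hy1
  have hy20 : 0 < y2 := hvl.trans_le hy2
  set X := x1 ^ (-σ) with hX
  set Y := x2 ^ (-σ') with hY
  have hX0 : 0 < X := Real.rpow_pos_of_pos hx10 _
  have hY0 : 0 < Y := Real.rpow_pos_of_pos hx20 _
  set A : ℝ → ℝ := fun w => (X + E * w) ^ (-σ⁻¹) with hA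
  set B : ℝ → ℝ := fun w => (Y + E' * w) ^ (-σ'⁻¹) with hB
  have inv : ∀ {z τ : ℝ}, 0 < z → 0 < τ → (z ^ (-τ)) ^ (-τ⁻¹) = z := by
    intro z τ hz hτ
    rw [← Real.rpow_mul hz.le]
    have : -τ * -τ⁻¹ = 1 := by field_simp
    rw [this, Real.rpow_one]
  have A0 : A 0 = x1 := by simp only [hA, mul_zero, add_zero, hX]; exact inv hx10 hσ
  have B0 : B 0 = x2 := by simp only [hB, mul_zero, add_zero, hY]; exact inv hx20 hσ'
  have AD : A D = y1 := by simp only [hA]; rw [← h1]; exact inv hy10 hσ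
  have BD : y2 ≤ B D := by
    rw [← inv hy20 hσ']
    simp only [hB]
    exact Real.rpow_le_rpow_of_nonpos (by positivity) h2 (by simp [hσ'.le])
  have Apos : ∀ w, 0 ≤ w → 0 < X + E * w := fun w hw => by positivity
  have Bpos : ∀ w, 0 ≤ w → 0 < Y + E' * w := fun w hw => by positivity
  have Aanti : ∀ w z, 0 ≤ w → w ≤ z → A z ≤ A w := fun w z hw hz =>
    Real.rpow_le_rpow_of_nonpos (Apos w hw) (by nlinarith) (by simp [hσ.le])
  have Banti : ∀ w z, 0 ≤ w → w ≤ z → B z ≤ B w := fun w z hw hz =>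
    Real.rpow_le_rpow_of_nonpos (Bpos w hw) (by nlinarith) (by simp [hσ'.le])
  have hAd : ∀ w, 0 ≤ w → HasDerivAt A (-(E / σ) * (A w * A w ^ σ)) w := fun w hw =>
    inv_path hσ (Apos w hw)
  have hBd : ∀ w, 0 ≤ w → HasDerivAt B (-(E' / σ') * (B w * B w ^ σ')) w := fun w hw =>
    inv_path hσ' (Bpos w hw)
  have hA0 : ∀ w, 0 ≤ w → 0 < A w := fun w hw => Real.rpow_pos_of_pos (Apos w hw) _
  have hB0 : ∀ w, 0 ≤ w → 0 < B w := fun w hw => Real.rpow_pos_of_pos (Bpos w hw) _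
  set N : ℝ → ℝ := fun w => -(σ * A w ^ (-σ - 1) * F (A w) (B w)) - E * w * Γ with hN
  have hND : ∀ w, 0 ≤ w → HasDerivAt N (E / A w * (A w * deriv (fun x => F x (B w)) (A w)
      - (1 + σ) * F (A w) (B w) + σ * E' / (σ' * E) * (B w ^ σ' / A w ^ σ) *
        (B w * deriv (fun y => F (A w) y) (B w)) - Γ * A w)) w := by
    intro w hw
    have e1 := (((hAd w hw).rpow_const (p := -σ - 1) (Or.inl (hA0 w hw).ne')).const_mul σ).mul
      (S.F_path (hAd w hw) (hBd w hw))
    have e2 : HasDerivAt (fun w => E * w * Γ) (E * Γ) w := by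
      simpa using ((hasDerivAt_id w).const_mul E).mul_const Γ
    refine (e1.neg.sub e2).congr_deriv ?_
    have hAw := hA0 w hw
    have hpw : 0 < A w ^ σ := Real.rpow_pos_of_pos hAw _
    have p1 : A w ^ (-σ - 1) = 1 / (A w ^ σ * A w) := by
      rw [Real.rpow_sub_one hAw.ne', Real.rpow_neg hAw.le]; field_simp
    have p2 : A w ^ (-σ - 1 - 1) = 1 / (A w ^ σ * A w * A w) := by
      rw [Real.rpow_sub_one hAw.ne', p1]; field_simp
    rw [p1, p2]
    field_simp
    ring
  have hmono : MonotoneOn N (Icc 0 D) := by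
    apply monotoneOn_of_deriv_nonneg (convex_Icc 0 D)
    · exact fun w hw => (hND w hw.1).continuousAt.continuousWithinAt
    · exact fun w hw => (hND w (interior_subset hw).1).differentiableAt.differentiableWithinAt
    · intro w hw
      have hw := interior_subset hw
      rw [(hND w hw.1).deriv]
      have := hΓ (A w) (B w) (by have := Aanti w D hw.1 hw.2; rw [AD] at this; linarith)
        (by have := Aanti 0 w le_rfl hw.1; rw [A0] at this; linarith)
        (by have := Banti w D hw.1 hw.2; linarith)
        (by have := Banti 0 w le_rfl hw.1; rw [B0] at this; linarith)
      have := hA0 w hw.1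
      apply mul_nonneg (by positivity)
      linarith
  have := hmono ⟨le_rfl, hD⟩ ⟨hD, le_rfl⟩ hD
  simp only [hN, A0, B0, AD] at this
  have hFm := S.F_mono hy10.le hy20.le BD
  have hy : 0 < σ * y1 ^ (-σ - 1) := by positivity
  have := mul_le_mul_of_nonneg_left hFm hy.le
  linarith

lemma chi_sq_anti {l : ℝ} (hl : 0 < l) (m : ℝ) {x y : ℝ} (hxy : x ≤ y) :
    chi ((y - m) / l) ^ 2 - chi ((x - m) / l) ^ 2 ≤
      12 / l * (l * Psi ((y - m) / l) - l * Psi ((x - m) / l)) := by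
  have hD : ∀ x, HasDerivAt (fun x => 12 / l * (l * Psi ((x - m) / l)) - chi ((x - m) / l) ^ 2)
      (12 / l * (l * (chi ((x - m) / l) / l)) - 2 * chi ((x - m) / l) * (chi1 ((x - m) / l) / l)) x := by
    intro x
    have e := (scaled (chi_deriv ((x - m) / l))).pow 2
    refine ((((scaled (Psi_deriv ((x - m) / l))).const_mul l).const_mul (12 / l)).sub e).congr_deriv ?_
    push_cast; ring
  have : Monotone (fun x => 12 / l * (l * Psi ((x - m) / l)) - chi ((x - m) / l) ^ 2) := by
    apply monotone_of_deriv_nonneg (fun x => (hD x).differentiableAt)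
    intro x
    rw [(hD x).deriv]
    set z := (x - m) / l
    have h1 := chi1_abs z
    have h2 := gp_le_one z
    have h3 := gp_nonneg z
    have h4 := chi_nonneg z
    have h5 : chi1 z ≤ 6 := by
      have := le_abs_self (chi1 z)
      nlinarith
    have e : 12 / l * (l * (chi z / l)) - 2 * chi z * (chi1 z / l) = 2 * chi z * (6 - chi1 z) / l := by
      field_simp; ring
    rw [e]
    apply div_nonneg _ hl.le
    apply mul_nonneg <;> linarith
  have := this hxy
  simp only at this
  linarith

lemma Sys.jstep (S : Sys k R p q r s α β d e c₁ c₂ T F G u v)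
    {a b m h σ E D Γ lam t x y : ℝ}
    (hσ : 0 < σ) (hE : 0 < E) (hh : 0 < h) (ht : t ∈ Ioo 0 T)
    (ha : 0 < a) (hbR : b < R) (hax : a ≤ x) (hxy : x < y) (hyb : y ≤ b)
    (hpos : ∀ z ∈ Icc a b, 0 < u t z)
    (hca : chi ((a - m) / h) = 0) (hcb : chi ((b - m) / h) = 0)
    (hmin : ∀ z w, a ≤ z → z ≤ w → w ≤ b →
      u t y ^ (-σ) - u t x ^ (-σ) - E * (h * Psi ((y - m) / h) - h * Psi ((x - m) / h)) ≤
      u t w ^ (-σ) - u t z ^ (-σ) - E * (h * Psi ((w - m) / h) - h * Psi ((z - m) / h)))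
    (hreact : σ * u t y ^ (-σ - 1) * F (u t y) (v t y) ≤
      σ * u t x ^ (-σ - 1) * F (u t x) (v t x) - E * D * Γ)
    (hbump : MonotoneOn (fun x => chi1 ((x - m) / h) / h + k / x * chi ((x - m) / h)
        + lam * (h * Psi ((x - m) / h))) (Ici a))
    (herr : d * lam + d * ((σ + 1) / σ) * E * (12 / h) * u t x ^ σ ≤ Γ) :
    -(E * Γ * (h * Psi ((y - m) / h) - h * Psi ((x - m) / h) - D)) ≤
    (d * (deriv (deriv (u t)) y + k / y * deriv (u t) y) + F (u t y) (v t y)) * (-σ) * u t y ^ (-σ - 1)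
    - (d * (deriv (deriv (u t)) x + k / x * deriv (u t) x) + F (u t x) (v t x)) * (-σ) * u t x ^ (-σ - 1)
     := by
  have hd := S.hd
  have hIo : ∀ x ∈ Icc a b, x ∈ Ioo 0 R := fun x hx => ⟨ha.trans_le hx.1, hx.2.trans_lt hbR⟩
  set U1 : ℝ → ℝ := fun z => deriv (u t) z * (-σ) * u t z ^ (-σ - 1) with hU1
  set U2 : ℝ → ℝ := fun z => deriv (deriv (u t)) z * (-σ) * u t z ^ (-σ - 1) +
    deriv (u t) z * (-σ) * (deriv (u t) z * (-σ - 1) * u t z ^ (-σ - 1 - 1)) with hU2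
  have dU : ∀ z ∈ Icc a b, HasDerivAt (fun z => u t z ^ (-σ)) (U1 z) z := fun z hz =>
    (S.ux t ht z (hIo z hz)).rpow_const (Or.inl (hpos z hz).ne')
  have dU1 : ∀ z ∈ Icc a b, HasDerivAt U1 (U2 z) z := fun z hz =>
    ((S.uxx t ht z (hIo z hz)).mul_const (-σ)).mul
      ((S.ux t ht z (hIo z hz)).rpow_const (Or.inl (hpos z hz).ne'))
  have hab : a ≤ b := hax.trans (hxy.le.trans hyb)
  have U1nn : ∀ z ∈ Icc a b, 0 ≤ U1 z := by
    intro z hz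
    have h1 := S.ux_nonpos ht (hIo z hz)
    have h2 : 0 < u t z ^ (-σ - 1) := Real.rpow_pos_of_pos (hpos z hz) _
    apply mul_nonneg _ h2.le
    nlinarith
  have dC : ∀ z, HasDerivAt (fun z => E * (h * Psi ((z - m) / h))) (E * chi ((z - m) / h)) z := by
    intro z
    refine (((scaled (Psi_deriv ((z - m) / h))).const_mul h).const_mul E).congr_deriv ?_
    field_simp
  have dc : ∀ z, HasDerivAt (fun z => E * chi ((z - m) / h)) (E * (chi1 ((z - m) / h) / h)) z := fun z =>
    (scaled (chi_deriv ((z - m) / h))).const_mul E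
  obtain ⟨g1, g2, g3, g4⟩ := two_pt (φ := fun z => E * (h * Psi ((z - m) / h)) - u t z ^ (-σ))
    (ψ := fun z => E * chi ((z - m) / h) - U1 z)
    (χ := fun z => E * (chi1 ((z - m) / h) / h) - U2 z) hax hxy hyb
    (fun z hz => (dC z).sub (dU z hz)) (fun z hz => (dc z).sub (dU1 z hz))
    (fun z w hz hzw hw => by
      have := hmin z w hz hzw hw
      linarith)
    (by rw [hca]; linarith [U1nn a ⟨le_rfl, hab⟩]) (by rw [hcb]; linarith [U1nn b ⟨hab, le_rfl⟩])
  have hxI : x ∈ Icc a b := ⟨hax, hxy.le.trans hyb⟩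
  have hyI : y ∈ Icc a b := ⟨hax.trans hxy.le, hyb⟩
  -- rewriting the time derivative
  have key : ∀ z ∈ Icc a b, (d * (deriv (deriv (u t)) z + k / z * deriv (u t) z) + F (u t z) (v t z))
      * (-σ) * u t z ^ (-σ - 1) = d * (U2 z + k / z * U1 z) - d * ((σ + 1) / σ) * (U1 z ^ 2 * u t z ^ σ)
        - σ * u t z ^ (-σ - 1) * F (u t z) (v t z) := by
    intro z hz
    have hAw := hpos z hz
    have hpw : 0 < u t z ^ σ := Real.rpow_pos_of_pos hAw _
    have p1 : u t z ^ (-σ - 1) = 1 / (u t z ^ σ * u t z) := by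
      rw [Real.rpow_sub_one hAw.ne', Real.rpow_neg hAw.le]; field_simp
    have p2 : u t z ^ (-σ - 1 - 1) = 1 / (u t z ^ σ * u t z * u t z) := by
      rw [Real.rpow_sub_one hAw.ne', p1]; field_simp
    simp only [hU1, hU2, p1, p2]
    field_simp
    ring
  rw [key x hxI, key y hyI]
  have l1 : U1 x = E * chi ((x - m) / h) := by linarith
  have l2 : U1 y = E * chi ((y - m) / h) := by linarith
  rw [l1, l2]
  have b1 := hbump hax (hax.trans hxy.le) hxy.le
  simp only at b1
  have b2 := mul_le_mul_of_nonneg_left b1 (mul_pos hd hE).le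
  have l3 := mul_le_mul_of_nonneg_left g3 hd.le
  have l4 := mul_le_mul_of_nonneg_left g4 hd.le
  -- gradient
  have hum : u t y ^ σ ≤ u t x ^ σ := by
    apply Real.rpow_le_rpow (hpos y hyI).le _ hσ.le
    have h1 := hIo x hxI
    have h2 := hIo y hyI
    exact S.um t ⟨ht.1.le, ht.2⟩ ⟨h1.1.le, h1.2.le⟩ ⟨h2.1.le, h2.2.le⟩ hxy.le
  have hux : 0 < u t x ^ σ := Real.rpow_pos_of_pos (hpos x hxI) _
  have q1 := chi_sq_anti hh m hxy.le
  set ΔC := h * Psi ((y - m) / h) - h * Psi ((x - m) / h) with hΔ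
  have q2 : (E * chi ((y - m) / h)) ^ 2 * u t y ^ σ - (E * chi ((x - m) / h)) ^ 2 * u t x ^ σ ≤
      E ^ 2 * (12 / h * ΔC) * u t x ^ σ := by
    have r1 := mul_le_mul_of_nonneg_left hum (sq_nonneg (E * chi ((y - m) / h)))
    have r2 := mul_le_mul_of_nonneg_right (mul_le_mul_of_nonneg_left q1 (sq_nonneg E)) hux.le
    linarith
  have q3 := mul_le_mul_of_nonneg_left q2 (by positivity : 0 ≤ d * ((σ + 1) / σ))
  have hΔ0 : 0 ≤ ΔC := by
    have : Monotone fun z => E * (h * Psi ((z - m) / h)) := by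
      apply monotone_of_deriv_nonneg (fun z => (dC z).differentiableAt)
      intro z
      rw [(dC z).deriv]
      exact mul_nonneg hE.le (chi_nonneg _)
    have := this hxy.le
    simp only at this
    have : 0 ≤ E * ΔC := by rw [hΔ]; linarith
    exact nonneg_of_mul_nonneg_right this hE
  have q4 := mul_le_mul_of_nonneg_right herr (mul_nonneg hE.le hΔ0)
  have q5 : d * ((σ + 1) / σ) * E * (12 / h) * u t x ^ σ * (E * ΔC) =
    d * ((σ + 1) / σ) * (E ^ 2 * (12 / h * ΔC) * u t x ^ σ) := by ring
  rw [add_mul, q5] at q4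
  have q6 : d * E * (lam * (h * Psi ((y - m) / h))) - d * E * (lam * (h * Psi ((x - m) / h)))
     = d * lam * (E * ΔC) := by rw [hΔ]; ring
  linarith

end SPB

namespace SPB
variable {k R p q r s α β d e c₁ c₂ T : ℝ} {F G : ℝ → ℝ → ℝ} {u v : ℝ → ℝ → ℝ}

noncomputable def CC (m h z : ℝ) : ℝ := h * Psi ((z - m) / h)

noncomputable def ff (u : ℝ → ℝ → ℝ) (m h σ E θ L t0 t : ℝ) (z : ℝ × ℝ) : ℝ :=
  u t z.2 ^ (-σ) - u t z.1 ^ (-σ) - E * (CC m h z.2 - CC m h z.1) + E * (θ * Real.exp (L * (t - t0)))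

def RR (F : ℝ → ℝ → ℝ) (u v : ℝ → ℝ → ℝ) (a b σ σ' E E' t Γ : ℝ) : Prop :=
  ∀ x y D, a ≤ x → x ≤ y → y ≤ b → 0 ≤ D → u t y ^ (-σ) = u t x ^ (-σ) + E * D →
    v t x ^ (-σ') + E' * D ≤ v t y ^ (-σ') →
    σ * u t y ^ (-σ - 1) * F (u t y) (v t y) ≤ σ * u t x ^ (-σ - 1) * F (u t x) (v t x) - E * D * Γ

lemma CC_cont (m h : ℝ) : Continuous (CC m h) := by
  have := Psi_cont
  unfold CC; fun_prop

lemma Sys.ff_cont (S : Sys k R p q r s α β d e c₁ c₂ T F G u v) {a b m h σ E θ L t0 t1 : ℝ}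
    (ha : 0 < a) (hbR : b < R) (ht0 : 0 < t0) (ht1 : t1 < T)
    (hpos : ∀ t ∈ Icc t0 t1, ∀ z ∈ Icc a b, 0 < u t z) :
    ContinuousOn (Function.uncurry (ff u m h σ E θ L t0))
      (Icc t0 t1 ×ˢ {z : ℝ × ℝ | a ≤ z.1 ∧ z.1 ≤ z.2 ∧ z.2 ≤ b}) := by
  have hC := CC_cont m h
  have h1 : ContinuousOn (fun z : ℝ × ℝ × ℝ => u z.1 z.2.1)
      (Icc t0 t1 ×ˢ {z : ℝ × ℝ | a ≤ z.1 ∧ z.1 ≤ z.2 ∧ z.2 ≤ b}) := by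
    apply S.uc.comp (f := fun z : ℝ × ℝ × ℝ => (z.1, z.2.1)) (by fun_prop)
    rintro ⟨t, x, y⟩ ⟨h1, h2, h3, h4⟩
    simp only at h1 h2 h3 h4
    exact ⟨⟨ht0.le.trans h1.1, h1.2.trans_lt ht1⟩, by simp only; linarith, by simp only; linarith⟩
  have h2 : ContinuousOn (fun z : ℝ × ℝ × ℝ => u z.1 z.2.2)
      (Icc t0 t1 ×ˢ {z : ℝ × ℝ | a ≤ z.1 ∧ z.1 ≤ z.2 ∧ z.2 ≤ b}) := by
    apply S.uc.comp (f := fun z : ℝ × ℝ × ℝ => (z.1, z.2.2)) (by fun_prop)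
    rintro ⟨t, x, y⟩ ⟨h1, h2, h3, h4⟩
    simp only at h1 h2 h3 h4
    exact ⟨⟨ht0.le.trans h1.1, h1.2.trans_lt ht1⟩, by simp only; linarith, by simp only; linarith⟩
  have h3 := h1.rpow_const (p := -σ) (by
    rintro ⟨t, x, y⟩ ⟨h1, h2, h3, h4⟩
    exact Or.inl (hpos t h1 x ⟨h2, h3.trans h4⟩).ne')
  have h4 := h2.rpow_const (p := -σ) (by
    rintro ⟨t, x, y⟩ ⟨h1, h2, h3, h4⟩
    exact Or.inl (hpos t h1 y ⟨h2.trans h3, h4⟩).ne')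
  have h5 : Continuous fun z : ℝ × ℝ × ℝ => E * (CC m h z.2.2 - CC m h z.2.1) := by fun_prop
  have h6 : Continuous fun z : ℝ × ℝ × ℝ => E * (θ * Real.exp (L * (z.1 - t0))) := by fun_prop
  exact ((h4.sub h3).sub h5.continuousOn).add h6.continuousOn

lemma Sys.jtouch (S : Sys k R p q r s α β d e c₁ c₂ T F G u v)
    {a b m h σ σ' E E' θ L Γ lam t0 t x y : ℝ}
    (hσ : 0 < σ) (hE : 0 < E) (hE' : 0 < E') (hh : 0 < h) (hθ : 0 < θ) (ht0 : 0 < t0) (htt : t0 < t) (htT : t < T)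
    (ha : 0 < a) (hbR : b < R) (hax : a ≤ x) (hxy : x ≤ y) (hyb : y ≤ b)
    (hpos : ∀ z ∈ Icc a b, 0 < u t z)
    (hca : chi ((a - m) / h) = 0) (hcb : chi ((b - m) / h) = 0)
    (hreact : RR F u v a b σ σ' E E' t Γ)
    (hbump : MonotoneOn (fun x => chi1 ((x - m) / h) / h + k / x * chi ((x - m) / h)
        + lam * (h * Psi ((x - m) / h))) (Ici a))
    (herr : ∀ x ∈ Icc a b, d * lam + d * ((σ + 1) / σ) * E * (12 / h) * u t x ^ σ ≤ Γ)
    (hΓL : Γ < L)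
    (hf : ∀ s ∈ Icc t0 t, ∀ z ∈ {z : ℝ × ℝ | a ≤ z.1 ∧ z.1 ≤ z.2 ∧ z.2 ≤ b}, 0 ≤ ff u m h σ E θ L t0 s z)
    (hg : 0 ≤ ff v m h σ' E' θ L t0 t (x, y))
    (h0 : ff u m h σ E θ L t0 t (x, y) = 0) : False := by
  set X := θ * Real.exp (L * (t - t0)) with hX
  have hX0 : 0 < X := by positivity
  have htI : t ∈ Ioo 0 T := ⟨ht0.trans htt, htT⟩
  have hxy : x < y := by
    rcases hxy.lt_or_eq with h | h
    · exact h
    · subst h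
      simp only [ff, sub_self, mul_zero, zero_add] at h0
      rw [← hX] at h0
      have := mul_pos hE hX0
      linarith
  have hIo : ∀ x ∈ Icc a b, x ∈ Ioo 0 R := fun x hx => ⟨ha.trans_le hx.1, hx.2.trans_lt hbR⟩
  have hxI : x ∈ Icc a b := ⟨hax, hxy.le.trans hyb⟩
  have hyI : y ∈ Icc a b := ⟨hax.trans hxy.le, hyb⟩
  have hum : u t x ^ (-σ) ≤ u t y ^ (-σ) := by
    apply Real.rpow_le_rpow_of_nonpos (hpos y hyI) _ (by linarith)
    have h1 := hIo x hxI
    have h2 := hIo y hyI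
    exact S.um t ⟨htI.1.le, htI.2⟩ ⟨h1.1.le, h1.2.le⟩ ⟨h2.1.le, h2.2.le⟩ hxy.le
  set D := CC m h y - CC m h x - X with hD
  simp only [ff] at h0 hg
  rw [← hX] at h0 hg
  have e1 : u t y ^ (-σ) = u t x ^ (-σ) + E * D := by rw [hD]; linarith
  have hD0 : 0 ≤ D := by
    have : 0 ≤ E * D := by linarith
    exact nonneg_of_mul_nonneg_right this hE
  have e2 : v t x ^ (-σ') + E' * D ≤ v t y ^ (-σ') := by rw [hD]; linarith
  have J := S.jstep (σ := σ) (E := E) (D := D) (Γ := Γ) (lam := lam) (m := m) hσ hE hh htI ha hbR hax hxy hyb hpos hca hcb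
    (fun z w hz hzw hw => by
      have := hf t ⟨htt.le, le_rfl⟩ (z, w) ⟨hz, hzw, hw⟩
      simp only [ff] at this
      rw [← hX] at this
      simp only [CC] at this h0
      linarith)
    (hreact x y D hax hxy.le hyb hD0 e1 e2) hbump (herr x hxI)
  have hXd : HasDerivAt (fun t => E * (θ * Real.exp (L * (t - t0)))) (E * (L * X)) t := by
    have : HasDerivAt (fun t => L * (t - t0)) L t := by
      simpa using ((hasDerivAt_id t).sub_const t0).const_mul L
    refine ((this.exp.const_mul θ).const_mul E).congr_deriv ?_
    rw [hX]; ring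
  have dT : ∀ z ∈ Icc a b, _ := fun z hz =>
    (S.ut t htI z (hIo z hz)).rpow_const (p := -σ) (Or.inl (hpos z hz).ne')
  have g5 := time_cond (φ := fun t => ff u m h σ E θ L t0 t (x, y)) htt
    ((((dT y hyI).sub (dT x hxI)).sub_const _).add hXd) (by simp only [ff]; rw [← hX]; exact h0)
    (fun s hs => hf s hs (x, y) ⟨hax, hxy.le, hyb⟩)
  have e3 : h * Psi ((y - m) / h) - h * Psi ((x - m) / h) - D = X := by
    rw [hD]; simp only [CC]; ring
  rw [e3] at J
  have := mul_lt_mul_of_pos_left hΓL (mul_pos hE hX0)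
  linarith

lemma Sys.jcomp (S : Sys k R p q r s α β d e c₁ c₂ T F G u v)
    {a b m h σ σ' E E' L lam t0 t1 : ℝ} {Γ : ℝ → ℝ}
    (hσ : 0 < σ) (hσ' : 0 < σ') (hE : 0 < E) (hE' : 0 < E') (hh : 0 < h) (ht0 : 0 < t0) (htt : t0 ≤ t1) (htT : t1 < T)
    (ha : 0 < a) (hbR : b < R)
    (hpos : ∀ t ∈ Icc t0 t1, ∀ z ∈ Icc a b, 0 < u t z)
    (hpos' : ∀ t ∈ Icc t0 t1, ∀ z ∈ Icc a b, 0 < v t z)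
    (hca : chi ((a - m) / h) = 0) (hcb : chi ((b - m) / h) = 0)
    (hreact : ∀ t ∈ Icc t0 t1, RR F u v a b σ σ' E E' t (Γ t))
    (hreact' : ∀ t ∈ Icc t0 t1, RR (fun a b => G b a) v u a b σ' σ E' E t (Γ t))
    (hbump : MonotoneOn (fun x => chi1 ((x - m) / h) / h + k / x * chi ((x - m) / h)
        + lam * (h * Psi ((x - m) / h))) (Ici a))
    (herr : ∀ t ∈ Icc t0 t1, ∀ x ∈ Icc a b, d * lam + d * ((σ + 1) / σ) * E * (12 / h) * u t x ^ σ ≤ Γ t)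
    (herr' : ∀ t ∈ Icc t0 t1, ∀ x ∈ Icc a b,
      e * lam + e * ((σ' + 1) / σ') * E' * (12 / h) * v t x ^ σ' ≤ Γ t)
    (hΓL : ∀ t ∈ Icc t0 t1, Γ t < L)
    (hi : ∀ x y, a ≤ x → x ≤ y → y ≤ b → E * (CC m h y - CC m h x) ≤ u t0 y ^ (-σ) - u t0 x ^ (-σ))
    (hi' : ∀ x y, a ≤ x → x ≤ y → y ≤ b → E' * (CC m h y - CC m h x) ≤ v t0 y ^ (-σ') - v t0 x ^ (-σ')) :
    ∀ x y, a ≤ x → x ≤ y → y ≤ b → E * (CC m h y - CC m h x) ≤ u t1 y ^ (-σ) - u t1 x ^ (-σ) := by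
  intro x y hx hxy hy
  apply le_of_forall_pos_le_add
  intro ε hε
  set X := E * Real.exp (L * (t1 - t0)) with hX
  have hX0 : 0 < X := by positivity
  have hθ : 0 < ε / X := by positivity
  have T1 := touch (tri_compact a b) (ff u m h σ E (ε / X) L t0) (ff v m h σ' E' (ε / X) L t0)
    (S.ff_cont ha hbR ht0 htT hpos) (S.swap.ff_cont ha hbR ht0 htT hpos')
    (by
      rintro ⟨x, y⟩ ⟨h1, h2, h3⟩
      have := hi x y h1 h2 h3
      simp only [ff, sub_self, mul_zero, Real.exp_zero]
      have := mul_pos hE hθ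
      linarith)
    (by
      rintro ⟨x, y⟩ ⟨h1, h2, h3⟩
      have := hi' x y h1 h2 h3
      simp only [ff, sub_self, mul_zero, Real.exp_zero]
      have := mul_pos hE' hθ
      linarith)
    (by
      rintro t ht ⟨x, y⟩ ⟨h1, h2, h3⟩ hf hg h0
      have htc : t ∈ Icc t0 t1 := ⟨ht.1.le, ht.2⟩
      exact S.jtouch hσ hE hE' hh hθ ht0 ht.1 (ht.2.trans_lt htT) ha hbR h1 h2 h3 (hpos t htc) hca hcb
        (hreact t htc) hbump (herr t htc) (hΓL t htc) hf (hg t ⟨ht.1.le, le_rfl⟩ (x, y) ⟨h1, h2, h3⟩) h0)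
    (by
      rintro t ht ⟨x, y⟩ ⟨h1, h2, h3⟩ hf hg h0
      have htc : t ∈ Icc t0 t1 := ⟨ht.1.le, ht.2⟩
      exact S.swap.jtouch hσ' hE' hE hh hθ ht0 ht.1 (ht.2.trans_lt htT) ha hbR h1 h2 h3 (hpos' t htc) hca hcb
        (hreact' t htc) hbump (herr' t htc) (hΓL t htc) hg (hf t ⟨ht.1.le, le_rfl⟩ (x, y) ⟨h1, h2, h3⟩) h0)
  have := (T1 t1 ⟨htt, le_rfl⟩ (x, y) ⟨hx, hxy, hy⟩).1
  simp only [ff] at this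
  have e1 : E * (ε / X * Real.exp (L * (t1 - t0))) = ε := by
    rw [hX]; field_simp
  rw [e1] at this
  linarith

end SPB

namespace SPB
variable {k R p q r s α β d e c₁ c₂ T : ℝ} {F G : ℝ → ℝ → ℝ} {u v : ℝ → ℝ → ℝ}

lemma exists_omega {α β p q μ sq C₁ C₂ : ℝ} (hμ : 0 < μ) (hs : sq < 1) (hs0 : 0 < sq) (h1 : 0 < C₁)
    (h2 : 0 < C₂) : ∃ ω > 0, ω * (q + 1) ≤ μ / 2 ∧ ω * (p + 1) ≤ μ / 2 ∧ α * (ω * (q + 1)) ≤ 1 / 2 ∧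
      β * (ω * (p + 1)) ≤ 1 / 2 ∧ sq * C₂ ^ ω ≤ 1 ∧ sq ≤ C₁ ^ ω := by
  have lin : ∀ c ε : ℝ, 0 < ε → ∀ᶠ ω in nhdsWithin (0:ℝ) (Ioi 0), ω * c ≤ ε := by
    intro c ε hε
    have : ContinuousAt (fun ω : ℝ => ω * c) 0 := by fun_prop
    have := this.eventually_lt_const (u := ε) (by simpa using hε)
    exact (this.filter_mono nhdsWithin_le_nhds).mono fun _ h => h.le
  have e1 := lin (q + 1) (μ / 2) (by linarith)
  have e2 := lin (p + 1) (μ / 2) (by linarith)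
  have e3 := lin (α * (q + 1)) (1 / 2) (by norm_num)
  have e4 := lin (β * (p + 1)) (1 / 2) (by norm_num)
  have e5 : ∀ᶠ ω in nhdsWithin (0:ℝ) (Ioi 0), sq * C₂ ^ ω < 1 := by
    have : ContinuousAt (fun ω : ℝ => sq * C₂ ^ ω) 0 :=
      (Real.continuousAt_const_rpow h2.ne').const_mul sq
    exact (this.eventually_lt_const (u := 1) (by simpa using hs)).filter_mono nhdsWithin_le_nhds
  have e6 : ∀ᶠ ω in nhdsWithin (0:ℝ) (Ioi 0), sq < C₁ ^ ω := by
    have : ContinuousAt (fun ω : ℝ => C₁ ^ ω) 0 := Real.continuousAt_const_rpow h1.ne'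
    exact (this.eventually_const_lt (u := sq) (by simpa using hs)).filter_mono nhdsWithin_le_nhds
  have e7 : ∀ᶠ ω in nhdsWithin (0:ℝ) (Ioi 0), 0 < ω := eventually_mem_nhdsWithin
  obtain ⟨ω, a1, a2, a3, a4, a5, a6, a7⟩ :=
    (e1.and (e2.and (e3.and (e4.and (e5.and (e6.and e7)))))).exists
  exact ⟨ω, a7, a1, a2, by linarith, by linarith, a5.le, a6.le⟩

lemma pow_pair {a b q p ω : ℝ} (ha : 0 < a) (hb : 0 < b) :
    a ^ (ω * (q + 1)) / b ^ (ω * (p + 1)) = (a ^ (q + 1) / b ^ (p + 1)) ^ ω := by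
  rw [Real.div_rpow (by positivity) (by positivity), ← Real.rpow_mul ha.le, ← Real.rpow_mul hb.le,
    mul_comm ω, mul_comm ω]

/-- ratio bounds in the parabolic box -/
lemma box_ratio {κ K τ a b : ℝ} (hp : 1 < p) (hq : 1 < q) (hαβ : α * (q + 1) = β * (p + 1))
    (hκ : 0 < κ) (hτ : 0 < τ)
    (h1 : κ * τ ^ (-α) ≤ a) (h2 : a ≤ K * τ ^ (-α)) (h3 : κ * τ ^ (-β) ≤ b) (h4 : b ≤ K * τ ^ (-β)) :
    κ ^ (q + 1) / K ^ (p + 1) ≤ a ^ (q + 1) / b ^ (p + 1) ∧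
      a ^ (q + 1) / b ^ (p + 1) ≤ K ^ (q + 1) / κ ^ (p + 1) := by
  have t1 : 0 < τ ^ (-α) := by positivity
  have t2 : 0 < τ ^ (-β) := by positivity
  have ha : 0 < a := lt_of_lt_of_le (by positivity) h1
  have hb : 0 < b := lt_of_lt_of_le (by positivity) h3
  have hK : 0 < K := by
    by_contra h
    have := mul_nonpos_of_nonpos_of_nonneg (not_lt.1 h) t1.le
    linarith
  have e : (τ ^ (-α)) ^ (q + 1) = (τ ^ (-β)) ^ (p + 1) := by
    rw [← Real.rpow_mul hτ.le, ← Real.rpow_mul hτ.le]; congr 1; linarith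
  have c1 : ∀ x y : ℝ, 0 < x → 0 < y → (x * τ ^ (-α)) ^ (q + 1) / (y * τ ^ (-β)) ^ (p + 1) =
      x ^ (q + 1) / y ^ (p + 1) := by
    intro x y hx hy
    rw [Real.mul_rpow hx.le t1.le, Real.mul_rpow hy.le t2.le, e]
    have : 0 < (τ ^ (-β)) ^ (p + 1) := by positivity
    have : 0 < y ^ (p + 1) := by positivity
    field_simp
  rw [← c1 κ K hκ hK, ← c1 K κ hK hκ]
  constructor
  · apply div_le_div₀ (by positivity) (Real.rpow_le_rpow (by positivity) h1 (by linarith)) (by positivity)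
      (Real.rpow_le_rpow (by positivity) h4 (by linarith))
  · apply div_le_div₀ (by positivity) (Real.rpow_le_rpow (by positivity) h2 (by linarith)) (by positivity)
      (Real.rpow_le_rpow (by positivity) h3 (by linarith))

lemma Sys.boxreact (S : Sys k R p q r s α β d e c₁ c₂ T F G u v)
    {κ K τ a b σ σ' r0 κ₁ μ c0 : ℝ} (hκ : 0 < κ) (hK : 0 < K) (hτ : 0 < τ) (hμ : 0 < μ)
    (hσ2 : σ ≤ μ / 2)
    (h1 : κ * τ ^ (-α) ≤ a) (h2 : a ≤ K * τ ^ (-α)) (h3 : κ * τ ^ (-β) ≤ b)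
    (hs : (1 + μ) * F a b ≤ a * deriv (fun x => F x b) a + κ₁ * b * deriv (fun y => F a y) b)
    (hr : κ₁ ≤ r0 * (b ^ σ' / a ^ σ)) (hc0 : 0 < c0) (hc0' : c0 * K ≤ μ / 2 * c₁ * κ ^ p) :
    c0 / τ * a ≤ a * deriv (fun x => F x b) a
      - (1 + σ) * F a b + r0 * (b ^ σ' / a ^ σ) * (b * deriv (fun y => F a y) b) := by
  have t1 : 0 < τ ^ (-α) := by positivity
  have t2 : 0 < τ ^ (-β) := by positivity
  have ha : 0 < a := lt_of_lt_of_le (by positivity) h1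
  have hb : 0 < b := lt_of_lt_of_le (by positivity) h3
  have hFv := S.Fv a b ha.le hb.le
  have hFl := S.Fl a b ha.le hb.le
  have hc₁ := S.hc₁
  have hp := S.hp
  have b1 : (κ * τ ^ (-β)) ^ p ≤ b ^ p := Real.rpow_le_rpow (by positivity) h3 (by linarith)
  rw [mul_comm, rpow_bar hτ hκ.le S.hβp] at b1
  have k1 := mul_le_mul_of_nonneg_right hr (mul_nonneg hb.le hFv)
  have hF0 : 0 ≤ F a b := le_trans (by positivity) hFl
  have k2 : σ * F a b ≤ μ / 2 * F a b := mul_le_mul_of_nonneg_right hσ2 hF0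
  have k3 : μ / 2 * (c₁ * (τ ^ (-α) / τ * κ ^ p)) ≤ μ / 2 * F a b := by
    apply mul_le_mul_of_nonneg_left _ (by linarith)
    exact (mul_le_mul_of_nonneg_left b1 hc₁.le).trans hFl
  have k4 : c0 / τ * a ≤ c0 / τ * (K * τ ^ (-α)) := mul_le_mul_of_nonneg_left h2 (by positivity)
  have k5 : (τ ^ (-α) / τ) * (c0 * K) ≤ (τ ^ (-α) / τ) * (μ / 2 * c₁ * κ ^ p) :=
    mul_le_mul_of_nonneg_left hc0' (by positivity)
  have k6 : c0 / τ * (K * τ ^ (-α)) = (τ ^ (-α) / τ) * (c0 * K) := by ring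
  have k7 : μ / 2 * (c₁ * (τ ^ (-α) / τ * κ ^ p)) = (τ ^ (-α) / τ) * (μ / 2 * c₁ * κ ^ p) := by ring
  linarith

lemma CC_pos {m h : ℝ} (hh : 0 < h) : 0 < CC m h (m + h) - CC m h m := by
  obtain ⟨c, hc, he⟩ := exists_hasDerivAt_eq_slope Psi chi (zero_lt_one' ℝ) Psi_cont.continuousOn
    (fun x _ => Psi_deriv x)
  have : 0 < chi c := pow_pos (gp_pos (by rw [abs_lt]; constructor <;> linarith [hc.1, hc.2])) 3
  rw [he] at this
  simp only [CC, add_sub_cancel_left, sub_self, zero_div, div_self hh.ne']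
  rw [sub_zero, div_one] at this
  have := mul_pos hh this
  linarith

lemma Sys.jinit (S : Sys k R p q r s α β d e c₁ c₂ T F G u v) {a b m h σ E M m0 t0 : ℝ}
    (hσ : 0 < σ) (hE : 0 < E) (hh : 0 < h) (ht0 : t0 ∈ Ioo 0 T) (ha : 0 < a) (hbR : b < R)
    (hpos : ∀ z ∈ Icc a b, 0 < u t0 z) (hM : ∀ z ∈ Icc a b, u t0 z ≤ M)
    (hm : ∀ z ∈ Icc a b, deriv (u t0) z ≤ -m0) (hm0 : 0 < m0) (hEE : E ≤ σ * M ^ (-σ - 1) * m0) :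
    ∀ x y, a ≤ x → x ≤ y → y ≤ b → E * (CC m h y - CC m h x) ≤ u t0 y ^ (-σ) - u t0 x ^ (-σ) := by
  have hIo : ∀ x ∈ Icc a b, x ∈ Ioo 0 R := fun x hx => ⟨ha.trans_le hx.1, hx.2.trans_lt hbR⟩
  have dC : ∀ z, HasDerivAt (fun z => E * CC m h z) (E * chi ((z - m) / h)) z := by
    intro z
    refine (((scaled (Psi_deriv ((z - m) / h))).const_mul h).const_mul E).congr_deriv ?_
    field_simp
  have hD : ∀ z ∈ Icc a b, HasDerivAt (fun z => u t0 z ^ (-σ) - E * CC m h z)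
      (deriv (u t0) z * (-σ) * u t0 z ^ (-σ - 1) - E * chi ((z - m) / h)) z := fun z hz =>
    ((S.ux t0 ht0 z (hIo z hz)).rpow_const (Or.inl (hpos z hz).ne')).sub (dC z)
  have mono : MonotoneOn (fun z => u t0 z ^ (-σ) - E * CC m h z) (Icc a b) := by
    apply monotoneOn_of_deriv_nonneg (convex_Icc a b)
    · exact fun x hx => (hD x hx).continuousAt.continuousWithinAt
    · exact fun x hx => (hD x (interior_subset hx)).differentiableAt.differentiableWithinAt
    · intro z hz
      have hz := interior_subset hz
      rw [(hD z hz).deriv]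
      have h1 : M ^ (-σ - 1) ≤ u t0 z ^ (-σ - 1) :=
        Real.rpow_le_rpow_of_nonpos (hpos z hz) (hM z hz) (by linarith)
      have h2 : 0 < u t0 z ^ (-σ - 1) := Real.rpow_pos_of_pos (hpos z hz) _
      have h3 := hm z hz
      have h4 : σ * M ^ (-σ - 1) * m0 ≤ σ * u t0 z ^ (-σ - 1) * m0 := by gcongr
      have h5 : σ * u t0 z ^ (-σ - 1) * m0 ≤ σ * u t0 z ^ (-σ - 1) * (-deriv (u t0) z) :=
        mul_le_mul_of_nonneg_left (by linarith) (by positivity)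
      have h6 : E * chi ((z - m) / h) ≤ E * 1 := mul_le_mul_of_nonneg_left (chi_le_one _) hE.le
      linarith
  intro x y hx hxy hy
  have := mono ⟨hx, hxy.trans hy⟩ ⟨hx.trans hxy, hy⟩ hxy
  simp only at this
  linarith

/-- the error terms are dominated close to `T` -/
lemma err_near {d lam σ h K c0 : ℝ} (hd : 0 < d) (hlam : 0 ≤ lam) (hσ : 0 < σ) (hh : 0 < h)
    (hK : 0 < K) (hc0 : 0 < c0) (hασ : α * σ ≤ 1 / 2) :
    ∃ t' < T, ∀ t ∈ Ico t' T, ∀ E w, 0 < E → E ≤ 1 → 0 < w → w ≤ K * (T - t) ^ (-α) →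
      d * lam + d * ((σ + 1) / σ) * E * (12 / h) * w ^ σ ≤ c0 / (T - t) := by
  obtain ⟨t1, h1, h1'⟩ := near_T (T := T) (c := d * lam + 1) (ε := c0 / 2) (by linarith) (by positivity) one_pos
  obtain ⟨t2, h2, h2'⟩ := near_T (T := T) (c := d * ((σ + 1) / σ) * (12 / h) * K ^ σ) (ε := c0 / 2)
    (by linarith) (by positivity) (by linarith : 0 < 1 - α * σ)
  refine ⟨max t1 t2, max_lt h1 h2, fun t ht E w hE hE1 hw hwK => ?_⟩
  have hτ : 0 < T - t := by linarith [ht.2]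
  have i1 := h1' t ⟨(le_max_left _ _).trans ht.1, ht.2⟩
  have i2 := h2' t ⟨(le_max_right _ _).trans ht.1, ht.2⟩
  rw [Real.rpow_one] at i1
  rw [le_div_iff₀ hτ, add_mul]
  have w1 : w ^ σ ≤ (K * (T - t) ^ (-α)) ^ σ := Real.rpow_le_rpow hw.le hwK hσ.le
  have w2 : (K * (T - t) ^ (-α)) ^ σ * (T - t) = K ^ σ * (T - t) ^ (1 - α * σ) := by
    rw [Real.mul_rpow hK.le (by positivity), ← Real.rpow_mul hτ.le, mul_assoc,
      ← Real.rpow_add_one hτ.ne']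
    congr 2; ring
  have w3 : d * ((σ + 1) / σ) * E * (12 / h) * w ^ σ * (T - t) ≤
      d * ((σ + 1) / σ) * 1 * (12 / h) * (K * (T - t) ^ (-α)) ^ σ * (T - t) := by gcongr
  have w4 : d * ((σ + 1) / σ) * 1 * (12 / h) * (K * (T - t) ^ (-α)) ^ σ * (T - t) =
      d * ((σ + 1) / σ) * (12 / h) * K ^ σ * (T - t) ^ (1 - α * σ) := by
    rw [mul_assoc _ _ (T - t), w2]; ring
  have w5 : d * lam * (T - t) ≤ (d * lam + 1) * (T - t) := by nlinarith
  linarith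

end SPB

namespace SPB
variable {k R p q r s α β d e c₁ c₂ T : ℝ} {F G : ℝ → ℝ → ℝ} {u v : ℝ → ℝ → ℝ}

/-- two-sided bounds -/
lemma Sys.twoside (S : Sys k R p q r s α β d e c₁ c₂ T F G u v) {a b ρ1 : ℝ} (ha : 0 < a) (hab : a ≤ b)
    (hb : b < ρ1) (hR1 : ρ1 < R) (hB : ¬∃ C, ∀ t ∈ Ioo 0 T, u t ρ1 + v t ρ1 ≤ C) :
    ∃ κ > 0, ∃ K > 0, ∃ t' ∈ Ioo 0 T, ∀ t ∈ Ico t' T, ∀ x ∈ Icc a b,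
      κ * (T - t) ^ (-α) ≤ u t x ∧ u t x ≤ K * (T - t) ^ (-α) := by
  obtain ⟨κ, hκ, t1, h1, h1'⟩ := S.nondeg (ha.trans_le hab) hb hR1 hB
  obtain ⟨K, hK, t2, h2, h2'⟩ := S.typeI ha (by linarith : a < R)
  refine ⟨κ, hκ, K, hK, max t1 t2, ⟨lt_max_of_lt_left h1.1, max_lt h1.2 h2.2⟩, fun t ht x hx => ?_⟩
  have ht1 : t1 ≤ t := (le_max_left _ _).trans ht.1
  have ht2 : t2 ≤ t := (le_max_right _ _).trans ht.1
  constructor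
  · refine (h1' t ⟨ht1, ht.2⟩).trans ?_
    exact S.um t ⟨by linarith [h1.1], ht.2⟩ ⟨by linarith [hx.1], by linarith [hx.2]⟩
      ⟨by linarith, by linarith⟩ hx.2
  · exact h2' t ⟨ht2, ht.2⟩ x ⟨hx.1, by linarith [hx.2]⟩

lemma large_near {κ A : ℝ} (hα : 0 < α) (hκ : 0 < κ) (hA : 0 < A) :
    ∃ t' < T, ∀ t ∈ Ico t' T, A ≤ κ * (T - t) ^ (-α) := by
  obtain ⟨t', h, h'⟩ := near_T (T := T) (c := A) (ε := κ) hκ hA hα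
  refine ⟨t', h, fun t ht => ?_⟩
  have hτ : 0 < T - t := by linarith [ht.2]
  have := h' t ht
  have hp : 0 < (T - t) ^ α := by positivity
  rw [Real.rpow_neg hτ.le, ← div_eq_mul_inv, le_div_iff₀ hp]
  exact this.le

set_option maxHeartbeats 1000000 in
theorem Sys.single (S : Sys k R p q r s α β d e c₁ c₂ T F G u v)
    (hstruct : ∀ C₁ > (0:ℝ), ∀ C₂ > (0:ℝ),
      ∃ μ > (0:ℝ), ∃ A > (0:ℝ), ∃ κ₁ > (0:ℝ), ∃ κ₂ > (0:ℝ), κ₁ * κ₂ < 1 ∧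
        ∀ a b : ℝ, A ≤ a → A ≤ b →
          C₁ ≤ a ^ (q + 1) / b ^ (p + 1) → a ^ (q + 1) / b ^ (p + 1) ≤ C₂ →
          (1 + μ) * F a b
              ≤ a * deriv (fun x => F x b) a + κ₁ * b * deriv (fun y => F a y) b ∧
          (1 + μ) * G a b
              ≤ b * deriv (fun y => G a y) b + κ₂ * a * deriv (fun x => G x b) a)
    {ρ1 : ℝ} (hρ : 0 < ρ1) (hρR : ρ1 < R) : ∃ C, ∀ t ∈ Ioo 0 T, u t ρ1 + v t ρ1 ≤ C := by
  by_contra hB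
  have hB' : ¬∃ C, ∀ t ∈ Ioo 0 T, v t ρ1 + u t ρ1 ≤ C := by
    rintro ⟨C, hC⟩
    exact hB ⟨C, fun t ht => by rw [add_comm]; exact hC t ht⟩
  have hp := S.hp
  have hq := S.hq
  have hα := S.hα
  have hβ := S.hβ
  have hd := S.hd
  have he := S.he
  have hc₁ := S.hc₁
  have hαq := S.hαq
  have hβp := S.hβp
  obtain ⟨a, rfl⟩ : ∃ a, ρ1 = 6 * a := ⟨ρ1 / 6, by ring⟩
  have ha : 0 < a := by linarith
  -- interval [a, 5a], centre 3a, half-width 2a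
  obtain ⟨ka, hka, Ka, hKa, ta, hta, ha1⟩ := S.twoside ha (by linarith : a ≤ 5 * a) (by linarith) hρR hB
  obtain ⟨kb, hkb, Kb, hKb, tb, htb, hb1⟩ := S.swap.twoside ha (by linarith : a ≤ 5 * a) (by linarith) hρR hB'
  set κ := min ka kb with hκd
  have hκ : 0 < κ := lt_min hka hkb
  set K := max Ka Kb with hKd
  have hK : 0 < K := lt_max_of_lt_left hKa
  have hκa : κ ≤ ka := min_le_left _ _
  have hκb : κ ≤ kb := min_le_right _ _
  have hKa' : Ka ≤ K := le_max_left _ _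
  have hKb' : Kb ≤ K := le_max_right _ _
  clear_value κ K
  set C₁ := κ ^ (q + 1) / K ^ (p + 1) with hC₁
  set C₂ := K ^ (q + 1) / κ ^ (p + 1) with hC₂
  have hC₁0 : 0 < C₁ := by positivity
  have hC₂0 : 0 < C₂ := by positivity
  clear_value C₁ C₂
  obtain ⟨μ, hμ, A, hA, κ₁, hκ₁, κ₂, hκ₂, hκκ, hst⟩ := hstruct C₁ hC₁0 C₂ hC₂0
  set sq := Real.sqrt (κ₁ * κ₂) with hsq
  have hsq0 : 0 < sq := Real.sqrt_pos.2 (by positivity)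
  have hsq2 : sq * sq = κ₁ * κ₂ := Real.mul_self_sqrt (by positivity)
  have hsq1 : sq < 1 := by nlinarith
  clear_value sq
  obtain ⟨ω, hω, o1, o2, o3, o4, o5, o6⟩ := exists_omega (α := α) (β := β) (p := p) (q := q) hμ hsq1 hsq0
    hC₁0 hC₂0
  set σ := ω * (q + 1) with hσd
  set σ' := ω * (p + 1) with hσd'
  have hσ : 0 < σ := mul_pos hω (by linarith)
  have hσ' : 0 < σ' := mul_pos hω (by linarith)
  clear_value σ σ'
  set c0 := min (μ / 2 * c₁ * κ ^ p / K) (μ / 2 * c₁ * κ ^ q / K) with hc0d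
  have hc0 : 0 < c0 := lt_min (by positivity) (by positivity)
  have hc0p : c0 * K ≤ μ / 2 * c₁ * κ ^ p := (le_div_iff₀ hK).1 (min_le_left _ _)
  have hc0q : c0 * K ≤ μ / 2 * c₁ * κ ^ q := (le_div_iff₀ hK).1 (min_le_right _ _)
  clear_value c0
  set h := 2 * a with hh
  have hh0 : 0 < h := by linarith
  clear_value h
  obtain ⟨lam, hlam, hbump⟩ := bump_mono (l := h) (a := a) (k := k) (B := 0) hh0 ha S.hk le_rfl
  have hbump' : MonotoneOn (fun x => chi1 ((x - 3 * a) / h) / h + k / x * chi ((x - 3 * a) / h)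
        + lam * (h * Psi ((x - 3 * a) / h))) (Ici a) := by
    have := hbump lam le_rfl (3 * a) 0 (by simp)
    simpa using this
  obtain ⟨t1, g1, g1'⟩ := err_near (α := α) (T := T) hd hlam hσ hh0 hK hc0 o3
  obtain ⟨t2, g2, g2'⟩ := err_near (α := β) (T := T) he hlam hσ' hh0 hK hc0 o4
  obtain ⟨t3, g3, g3'⟩ := large_near (T := T) hα hκ hA
  obtain ⟨t4, g4, g4'⟩ := large_near (T := T) hβ hκ hA
  set tm := max (max ta tb) (max (max t1 t2) (max t3 t4)) with htm
  have m1 : ta ≤ tm := (le_max_left _ _).trans (le_max_left _ _)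
  have m2 : tb ≤ tm := (le_max_right _ _).trans (le_max_left _ _)
  have m3 : t1 ≤ tm := (le_max_left _ _).trans ((le_max_left _ _).trans (le_max_right _ _))
  have m4 : t2 ≤ tm := (le_max_right _ _).trans ((le_max_left _ _).trans (le_max_right _ _))
  have m5 : t3 ≤ tm := (le_max_left _ _).trans ((le_max_right _ _).trans (le_max_right _ _))
  have m6 : t4 ≤ tm := (le_max_right _ _).trans ((le_max_right _ _).trans (le_max_right _ _))
  have htm0 : 0 < tm := hta.1.trans_le m1
  have htmT : tm < T := max_lt (max_lt hta.2 htb.2) (max_lt (max_lt g1 g2) (max_lt g3 g4))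
  clear_value tm
  -- bounds
  have Bu : ∀ t ∈ Ico tm T, ∀ x ∈ Icc a (5 * a),
      κ * (T - t) ^ (-α) ≤ u t x ∧ u t x ≤ K * (T - t) ^ (-α) := by
    intro t ht x hx
    have hτ : 0 < T - t := by linarith [ht.2]
    have hpw : 0 < (T - t) ^ (-α) := by positivity
    obtain ⟨i1, i2⟩ := ha1 t ⟨m1.trans ht.1, ht.2⟩ x hx
    exact ⟨(mul_le_mul_of_nonneg_right hκa hpw.le).trans i1,
      i2.trans (mul_le_mul_of_nonneg_right hKa' hpw.le)⟩
  have Bv : ∀ t ∈ Ico tm T, ∀ x ∈ Icc a (5 * a),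
      κ * (T - t) ^ (-β) ≤ v t x ∧ v t x ≤ K * (T - t) ^ (-β) := by
    intro t ht x hx
    have hτ : 0 < T - t := by linarith [ht.2]
    have hpw : 0 < (T - t) ^ (-β) := by positivity
    obtain ⟨i1, i2⟩ := hb1 t ⟨m2.trans ht.1, ht.2⟩ x hx
    exact ⟨(mul_le_mul_of_nonneg_right hκb hpw.le).trans i1,
      i2.trans (mul_le_mul_of_nonneg_right hKb' hpw.le)⟩
  have upos : ∀ t ∈ Ico tm T, ∀ x ∈ Icc a (5 * a), 0 < u t x := fun t ht x hx => by
    have hτ : 0 < T - t := by linarith [ht.2]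
    exact lt_of_lt_of_le (by positivity) (Bu t ht x hx).1
  have vpos : ∀ t ∈ Ico tm T, ∀ x ∈ Icc a (5 * a), 0 < v t x := fun t ht x hx => by
    have hτ : 0 < T - t := by linarith [ht.2]
    exact lt_of_lt_of_le (by positivity) (Bv t ht x hx).1
  -- initial slope
  set t0 := (tm + T) / 2 with ht0
  have ht0m : tm < t0 := by linarith
  have ht0T : t0 < T := by linarith
  clear_value t0
  obtain ⟨mu, hmu, hmu'⟩ := S.hopf ha (by linarith : a ≤ 5 * a) (by linarith) htm0 ht0m ht0T
    (upos tm ⟨le_rfl, htmT⟩ a ⟨le_rfl, by linarith⟩)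
  obtain ⟨mv, hmv, hmv'⟩ := S.swap.hopf ha (by linarith : a ≤ 5 * a) (by linarith) htm0 ht0m ht0T
    (vpos tm ⟨le_rfl, htmT⟩ a ⟨le_rfl, by linarith⟩)
  have hτ0 : 0 < T - t0 := by linarith
  set ηu := min 1 (σ * (K * (T - t0) ^ (-α)) ^ (-σ - 1) * mu) with hηu
  set ηv := min 1 (σ' * (K * (T - t0) ^ (-β)) ^ (-σ' - 1) * mv) with hηv
  have hηu0 : 0 < ηu := lt_min one_pos (by positivity)
  have hηv0 : 0 < ηv := lt_min one_pos (by positivity)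
  have hηu1 : ηu ≤ 1 := min_le_left _ _
  have hηv1 : ηv ≤ 1 := min_le_left _ _
  have hηu2 : ηu ≤ (σ * (K * (T - t0) ^ (-α)) ^ (-σ - 1) * mu) := min_le_right _ _
  have hηv2 : ηv ≤ (σ' * (K * (T - t0) ^ (-β)) ^ (-σ' - 1) * mv) := min_le_right _ _
  clear_value ηu ηv
  set r0 := κ₁ / sq with hr0
  have hr00 : 0 < r0 := by positivity
  set r1 := r0 * σ' / σ with hr1
  have hr10 : 0 < r1 := by positivity
  set E := min ηu (ηv / r1) with hEd
  have hE : 0 < E := lt_min hηu0 (by positivity)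
  set E' := r1 * E with hEd'
  have hE' : 0 < E' := by positivity
  have hEu : E ≤ ηu := min_le_left _ _
  have hEv : E' ≤ ηv := by
    have : E ≤ ηv / r1 := min_le_right _ _
    rw [le_div_iff₀ hr10] at this
    rw [hEd']; linarith
  have rat1 : σ * E' / (σ' * E) = r0 := by
    rw [hEd', hr1]; field_simp
  have rat2 : σ' * E / (σ * E') = κ₂ / sq := by
    rw [hEd', hr1, hr0]; field_simp; linarith
  clear_value E' E r1 r0
  -- structure in the box
  have hαβ : α * (q + 1) = β * (p + 1) := by linarith
  have box : ∀ t ∈ Ico tm T, ∀ x y, κ * (T - t) ^ (-α) ≤ x → x ≤ K * (T - t) ^ (-α) →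
      κ * (T - t) ^ (-β) ≤ y → y ≤ K * (T - t) ^ (-β) →
      (c0 / (T - t) * x ≤ x * deriv (fun x => F x y) x - (1 + σ) * F x y
        + r0 * (y ^ σ' / x ^ σ) * (y * deriv (fun y => F x y) y)) ∧
      (c0 / (T - t) * y ≤ y * deriv (fun y => G x y) y - (1 + σ') * G x y
        + κ₂ / sq * (x ^ σ / y ^ σ') * (x * deriv (fun x => G x y) x)) := by
    intro t ht x y h1 h2 h3 h4
    have hτ : 0 < T - t := by linarith [ht.2]
    have hx : 0 < x := lt_of_lt_of_le (by positivity) h1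
    have hy : 0 < y := lt_of_lt_of_le (by positivity) h3
    obtain ⟨b1, b2⟩ := box_ratio hp hq hαβ hκ hτ h1 h2 h3 h4
    rw [← hC₁] at b1
    rw [← hC₂] at b2
    obtain ⟨s1, s2⟩ := hst x y ((g3' t ⟨m5.trans ht.1, ht.2⟩).trans h1)
      ((g4' t ⟨m6.trans ht.1, ht.2⟩).trans h3) b1 b2
    set Q := x ^ (q + 1) / y ^ (p + 1) with hQ
    have hQ0 : 0 < Q := hC₁0.trans_le b1
    have hpair : x ^ σ / y ^ σ' = Q ^ ω := by rw [hσd, hσd', hQ]; exact pow_pair hx hy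
    have hpair' : y ^ σ' / x ^ σ = (Q ^ ω)⁻¹ := by rw [← hpair, inv_div]
    have hQω : 0 < Q ^ ω := by positivity
    clear_value Q
    have q1 : sq * Q ^ ω ≤ 1 := le_trans (mul_le_mul_of_nonneg_left
      (Real.rpow_le_rpow hQ0.le b2 hω.le) hsq0.le) o5
    have q2 : sq ≤ Q ^ ω := o6.trans (Real.rpow_le_rpow hC₁0.le b1 hω.le)
    constructor
    · apply S.boxreact (κ₁ := κ₁) hκ hK hτ hμ o1 h1 h2 h3 s1 _ hc0 hc0p
      rw [hpair', hr0, ← div_eq_mul_inv, div_div, le_div_iff₀ (by positivity)]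
      have := mul_le_mul_of_nonneg_left q1 hκ₁.le
      linarith
    · apply S.swap.boxreact (κ₁ := κ₂) hκ hK hτ hμ o2 h3 h4 h1 s2 _ hc0 hc0q
      rw [hpair, div_mul_eq_mul_div, le_div_iff₀ hsq0]
      exact mul_le_mul_of_nonneg_left q2 hκ₂.le
  -- comparison
  have main : ∀ t ∈ Ico t0 T, E * (CC (3 * a) h (3 * a + h) - CC (3 * a) h (3 * a)) ≤
      u t (5 * a) ^ (-σ) := by
    intro tt htt
    have hIc : ∀ t ∈ Icc t0 tt, t ∈ Ico tm T := fun t ht => ⟨by linarith [ht.1], ht.2.trans_lt htt.2⟩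
    have e5 : 3 * a + h = 5 * a := by rw [hh]; ring
    have J := S.jcomp (a := a) (b := 5 * a) (m := 3 * a) (h := h) (σ := σ) (σ' := σ') (E := E) (E' := E')
      (L := c0 / (T - tt) + 1) (lam := lam) (t0 := t0) (t1 := tt) (Γ := fun t => c0 / (T - t))
      hσ hσ' hE hE' hh0 (htm0.trans ht0m) htt.1 htt.2 ha (by linarith)
      (fun t ht => upos t (hIc t ht)) (fun t ht => vpos t (hIc t ht))
      (by
        apply chi_zero
        have : (a - 3 * a) / h = -1 := by rw [hh]; field_simp; ring
        rw [this]; norm_num)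
      (by
        apply chi_zero
        have : (5 * a - 3 * a) / h = 1 := by rw [hh]; field_simp; ring
        rw [this]; norm_num)
      (by
        intro t ht x y D hx hxy hy hD h1 h2
        have hm := hIc t ht
        have hτ : 0 < T - t := by linarith [hm.2]
        have hxI : x ∈ Icc a (5 * a) := ⟨hx, hxy.trans hy⟩
        have hyI : y ∈ Icc a (5 * a) := ⟨hx.trans hxy, hy⟩
        refine S.react (ul := κ * (T - t) ^ (-α)) (uu := K * (T - t) ^ (-α)) (vl := κ * (T - t) ^ (-β))
          (vu := K * (T - t) ^ (-β)) hσ hσ' hE hE' hD (by positivity) (by positivity) ?_ (Bu t hm x hxI).2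
          (Bu t hm y hyI).1 (Bv t hm x hxI).2 (Bv t hm y hyI).1 (upos t hm x hxI) (vpos t hm x hxI) h1 h2
        intro A B i1 i2 i3 i4
        rw [rat1]
        exact (box t hm A B i1 i2 i3 i4).1)
      (by
        intro t ht x y D hx hxy hy hD h1 h2
        have hm := hIc t ht
        have hτ : 0 < T - t := by linarith [hm.2]
        have hxI : x ∈ Icc a (5 * a) := ⟨hx, hxy.trans hy⟩
        have hyI : y ∈ Icc a (5 * a) := ⟨hx.trans hxy, hy⟩
        refine S.swap.react (ul := κ * (T - t) ^ (-β)) (uu := K * (T - t) ^ (-β)) (vl := κ * (T - t) ^ (-α))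
          (vu := K * (T - t) ^ (-α)) hσ' hσ hE' hE hD (by positivity) (by positivity) ?_ (Bv t hm x hxI).2
          (Bv t hm y hyI).1 (Bu t hm x hxI).2 (Bu t hm y hyI).1 (vpos t hm x hxI) (upos t hm x hxI) h1 h2
        intro A B i1 i2 i3 i4
        rw [rat2]
        exact (box t hm B A i3 i4 i1 i2).2)
      hbump'
      (fun t ht x hx => g1' t ⟨m3.trans (hIc t ht).1, (hIc t ht).2⟩ E (u t x) hE
        (hEu.trans hηu1) (upos t (hIc t ht) x hx) (Bu t (hIc t ht) x hx).2)
      (fun t ht x hx => g2' t ⟨m4.trans (hIc t ht).1, (hIc t ht).2⟩ E' (v t x) hE'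
        (hEv.trans hηv1) (vpos t (hIc t ht) x hx) (Bv t (hIc t ht) x hx).2)
      (fun t ht => by
        have : c0 / (T - t) ≤ c0 / (T - tt) :=
          div_le_div_of_nonneg_left hc0.le (by linarith [htt.2]) (by linarith [ht.2])
        linarith)
      (S.jinit hσ hE hh0 ⟨htm0.trans ht0m, ht0T⟩ ha (by linarith) (upos t0 ⟨ht0m.le, ht0T⟩)
        (fun z hz => (Bu t0 ⟨ht0m.le, ht0T⟩ z hz).2) hmu' hmu (hEu.trans hηu2))
      (S.swap.jinit hσ' hE' hh0 ⟨htm0.trans ht0m, ht0T⟩ ha (by linarith) (vpos t0 ⟨ht0m.le, ht0T⟩)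
        (fun z hz => (Bv t0 ⟨ht0m.le, ht0T⟩ z hz).2) hmv' hmv (hEv.trans hηv2))
      (3 * a) (5 * a) (by linarith) (by linarith) le_rfl
    rw [e5]
    have := upos tt (hIc tt ⟨htt.1, le_rfl⟩) (3 * a) ⟨by linarith, by linarith⟩
    have : 0 < u tt (3 * a) ^ (-σ) := Real.rpow_pos_of_pos this _
    linarith
  have hCC := mul_pos hE (CC_pos (m := 3 * a) hh0)
  set η := E * (CC (3 * a) h (3 * a + h) - CC (3 * a) h (3 * a)) with hη
  obtain ⟨t5, g5, g5'⟩ := near_T (T := T) (c := κ ^ (-σ)) (ε := η) hCC (by positivity) (mul_pos hα hσ)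
  have ht : max t0 t5 ∈ Ico t0 T := ⟨le_max_left _ _, max_lt ht0T g5⟩
  have k1 := main _ ht
  have k2 := g5' _ ⟨le_max_right t0 t5, ht.2⟩
  have hτ : 0 < T - max t0 t5 := by linarith [ht.2]
  have k3 := (Bu _ ⟨ht0m.le.trans ht.1, ht.2⟩ (5 * a) ⟨by linarith, le_rfl⟩).1
  have k4 := Real.rpow_le_rpow_of_nonpos (by positivity) k3 (by linarith : -σ ≤ 0)
  rw [Real.mul_rpow hκ.le (by positivity), ← Real.rpow_mul hτ.le] at k4
  have e6 : -α * -σ = α * σ := by ring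
  rw [e6] at k4
  linarith

end SPB

/-- Single-point blow-up for the general cooperative system
`u_t - δ Δu = F(u,v)`, `v_t - Δv = G(u,v)` (in radial coordinates `ρ = |x|`)
under the growth bounds `c₁ v^p ≤ F ≤ c₂(v^p + u^r + 1)`,
`c₁ u^q ≤ G ≤ c₂(u^q + v^s + 1)` with `r = p(q+1)/(p+1)`, `s = q(p+1)/(q+1)`,
and the structure condition (H): blow-up occurs only at the origin. -/
theorem single_point_blowup_general
    (n : ℕ) (hn : 1 ≤ n) (R : ℝ) (hR : 0 < R)
    (p q δ : ℝ) (hp : 1 < p) (hq : 1 < q) (hδ : 0 < δ)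
    (c₁ c₂ : ℝ) (hc₁ : 0 < c₁) (hc₂ : 0 < c₂)
    (T : ℝ) (hT : 0 < T)
    (F G : ℝ → ℝ → ℝ)
    (hF_C1 : ContDiff ℝ 1 (Function.uncurry F))
    (hG_C1 : ContDiff ℝ 1 (Function.uncurry G))
    (hFv : ∀ a b : ℝ, 0 ≤ a → 0 ≤ b → 0 ≤ deriv (fun y => F a y) b)
    (hGu : ∀ a b : ℝ, 0 ≤ a → 0 ≤ b → 0 ≤ deriv (fun x => G x b) a)
    (hF_low : ∀ a b : ℝ, 0 ≤ a → 0 ≤ b → c₁ * b ^ p ≤ F a b)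
    (hF_up : ∀ a b : ℝ, 0 ≤ a → 0 ≤ b →
      F a b ≤ c₂ * (b ^ p + a ^ (p * (q + 1) / (p + 1)) + 1))
    (hG_low : ∀ a b : ℝ, 0 ≤ a → 0 ≤ b → c₁ * a ^ q ≤ G a b)
    (hG_up : ∀ a b : ℝ, 0 ≤ a → 0 ≤ b →
      G a b ≤ c₂ * (a ^ q + b ^ (q * (p + 1) / (q + 1)) + 1))
    (hstruct : ∀ C₁ > (0:ℝ), ∀ C₂ > (0:ℝ),
      ∃ μ > (0:ℝ), ∃ A > (0:ℝ), ∃ κ₁ > (0:ℝ), ∃ κ₂ > (0:ℝ), κ₁ * κ₂ < 1 ∧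
        ∀ a b : ℝ, A ≤ a → A ≤ b →
          C₁ ≤ a ^ (q + 1) / b ^ (p + 1) → a ^ (q + 1) / b ^ (p + 1) ≤ C₂ →
          (1 + μ) * F a b
              ≤ a * deriv (fun x => F x b) a + κ₁ * b * deriv (fun y => F a y) b ∧
          (1 + μ) * G a b
              ≤ b * deriv (fun y => G a y) b + κ₂ * a * deriv (fun x => G x b) a)
    (u v : ℝ → ℝ → ℝ)
    (hu_nn : ∀ t ∈ Ico (0:ℝ) T, ∀ ρ ∈ Icc (0:ℝ) R, 0 ≤ u t ρ)
    (hv_nn : ∀ t ∈ Ico (0:ℝ) T, ∀ ρ ∈ Icc (0:ℝ) R, 0 ≤ v t ρ)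
    (hu_cont : ContinuousOn (Function.uncurry u) (Ico (0:ℝ) T ×ˢ Icc (0:ℝ) R))
    (hv_cont : ContinuousOn (Function.uncurry v) (Ico (0:ℝ) T ×ˢ Icc (0:ℝ) R))
    (hu_regx : ∀ t ∈ Ioo (0:ℝ) T, ContDiffOn ℝ 2 (u t) (Ioo (0:ℝ) R))
    (hv_regx : ∀ t ∈ Ioo (0:ℝ) T, ContDiffOn ℝ 2 (v t) (Ioo (0:ℝ) R))
    (hu_regt : ∀ ρ ∈ Ioo (0:ℝ) R, ∀ t ∈ Ioo (0:ℝ) T, DifferentiableAt ℝ (fun s => u s ρ) t)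
    (hv_regt : ∀ ρ ∈ Ioo (0:ℝ) R, ∀ t ∈ Ioo (0:ℝ) T, DifferentiableAt ℝ (fun s => v s ρ) t)
    (hu_bc : ∀ t ∈ Ioo (0:ℝ) T, u t R = 0)
    (hv_bc : ∀ t ∈ Ioo (0:ℝ) T, v t R = 0)
    (hu_mono : ∀ t ∈ Ico (0:ℝ) T, AntitoneOn (u t) (Icc (0:ℝ) R))
    (hv_mono : ∀ t ∈ Ico (0:ℝ) T, AntitoneOn (v t) (Icc (0:ℝ) R))
    (hu_pde : ∀ t ∈ Ioo (0:ℝ) T, ∀ ρ ∈ Ioo (0:ℝ) R,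
      deriv (fun s => u s ρ) t
        = δ * (deriv (deriv (u t)) ρ + ((n : ℝ) - 1) / ρ * deriv (u t) ρ)
          + F (u t ρ) (v t ρ))
    (hv_pde : ∀ t ∈ Ioo (0:ℝ) T, ∀ ρ ∈ Ioo (0:ℝ) R,
      deriv (fun s => v s ρ) t
        = deriv (deriv (v t)) ρ + ((n : ℝ) - 1) / ρ * deriv (v t) ρ
          + G (u t ρ) (v t ρ))
    (hblow : ∀ M : ℝ, ∀ ε > (0:ℝ), ∃ t, T - ε < t ∧ t < T ∧ M < u t 0 + v t 0) :
    ∀ ρ ∈ Ioo (0:ℝ) R, ∃ C : ℝ, ∀ t ∈ Ioo (0:ℝ) T, u t ρ + v t ρ ≤ C := by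
  have hpq : 0 < p * q - 1 := by nlinarith
  have hpq2 : q * p - 1 ≠ 0 := by nlinarith
  have hpq3 : p * q - 1 ≠ 0 := hpq.ne'
  have hp1 : 0 < p + 1 := by linarith
  have hq1 : 0 < q + 1 := by linarith
  have S : SPB.Sys ((n : ℝ) - 1) R p q (p * (q + 1) / (p + 1)) (q * (p + 1) / (q + 1))
      ((p + 1) / (p * q - 1)) ((q + 1) / (p * q - 1)) δ 1 c₁ c₂ T F G u v := by
    have ux : ∀ w : ℝ → ℝ → ℝ, (∀ t ∈ Ioo (0:ℝ) T, ContDiffOn ℝ 2 (w t) (Ioo (0:ℝ) R)) →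
        ∀ t ∈ Ioo (0:ℝ) T, ∀ x ∈ Ioo (0:ℝ) R, HasDerivAt (w t) (deriv (w t) x) x := by
      intro w hw t ht x hx
      exact (((hw t ht).differentiableOn (by norm_num)).differentiableAt
        (isOpen_Ioo.mem_nhds hx)).hasDerivAt
    have uxx : ∀ w : ℝ → ℝ → ℝ, (∀ t ∈ Ioo (0:ℝ) T, ContDiffOn ℝ 2 (w t) (Ioo (0:ℝ) R)) →
        ∀ t ∈ Ioo (0:ℝ) T, ∀ x ∈ Ioo (0:ℝ) R, HasDerivAt (deriv (w t)) (deriv (deriv (w t)) x) x := by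
      intro w hw t ht x hx
      have h1 : ContDiffOn ℝ 1 (deriv (w t)) (Ioo 0 R) :=
        (hw t ht).deriv_of_isOpen isOpen_Ioo (by norm_num)
      exact ((h1.differentiableOn (by norm_num)).differentiableAt
        (isOpen_Ioo.mem_nhds hx)).hasDerivAt
    refine
      { hk := ?_, hR := hR, hp := hp, hq := hq, hr := ?_, hs := ?_, hα := by positivity,
        hβ := by positivity, hαq := ?_, hβp := ?_, hαr := ?_, hβs := ?_, hd := hδ, he := one_pos,
        hc₁ := hc₁, hc₂ := hc₂, hT := hT, FC := hF_C1, GC := hG_C1, Fv := hFv, Gu := hGu,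
        Fl := hF_low, Fup := hF_up, Gl := hG_low, Gup := hG_up, un := hu_nn, vn := hv_nn,
        uc := hu_cont, vc := hv_cont, ux := ux u hu_regx, vx := ux v hv_regx,
        uxx := uxx u hu_regx, vxx := uxx v hv_regx, ut := ?_, vt := ?_, ub := hu_bc, vb := hv_bc,
        um := hu_mono, vm := hv_mono }
    · have : (1:ℝ) ≤ n := by exact_mod_cast hn
      linarith
    · rw [lt_div_iff₀ hp1]; linarith
    · rw [lt_div_iff₀ hq1]; linarith
    · field_simp; ring
    · field_simp; ring
    · rw [div_mul_div_comm, div_add_one hpq3, div_eq_div_iff (by positivity) hpq3]; ring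
    · rw [div_mul_div_comm, div_add_one hpq3, div_eq_div_iff (by positivity) hpq3]; ring
    · intro t ht x hx
      have := (hu_regt x hx t ht).hasDerivAt
      rw [hu_pde t ht x hx] at this
      exact this
    · intro t ht x hx
      have := (hv_regt x hx t ht).hasDerivAt
      rw [hv_pde t ht x hx] at this
      rw [one_mul]
      exact this
  intro ρ hρ
  exact S.single hstruct hρ.1 hρ.2
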